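/- arXiv:2502.04678 — 6 statements merged into one kernel-verified Lean document; each statement's English description precedes it below -/
import Mathlib

section
/- There exists a universal constant C > 0 such that for every number of arms K ≥ 2, number of contexts M ≥ 1, time horizon T ≥ 2, and every directed feedback graph G on the arm set [K] containing all self-loops, there is a randomized learning algorithm — i.e., for each round t a function mapping the observation history (the past contexts c_1,…,c_{t−1}, past plays a_1,…,a_{t−1}, and the revealed losses ℓ_{s,c}(a) for all s < t, all contexts c ∈ [M] and all arms a ∈ N_out(a_s)) together with the current context c_t to a probability distribution over [K] from which the played arm a_t is drawn — with the following guarantee: for every loss assignment ℓ_{t,c}(a) ∈ [0,1] (t ∈ [T], c ∈ [M], a ∈ [K]) fixed in advance by an oblivious adversary, every probability distribution ν on [M] from which the contexts c_1,…,c_T are drawn i.i.d., and every policy π : [M] → [K], the expected regret satisfies E[Σ_{t=1}^T (ℓ_{t,c_t}(a_t) − ℓ_{t,c_t}(π(c_t)))] ≤ C·√(α T)·(log(K T))², where α is the independence number of G. -/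
open Finset

section Generic
variable {S X : Type} [Fintype X]

noncomputable def Ex (k : S → X → ℝ) (st : S → X → S) : ℕ → S → (S → ℝ) → ℝ
  | 0, s, F => F s
  | n+1, s, F => ∑ x, k s x * Ex k st n (st s x) F

variable {k : S → X → ℝ} {st : S → X → S}

lemma Ex_add_time (m n : ℕ) (s : S) (F : S → ℝ) :
    Ex k st (m + n) s F = Ex k st m s (fun s' => Ex k st n s' F) := by
  induction m generalizing s with
  | zero => simp [Ex]
  | succ m ih =>
    rw [Nat.succ_add]
    simp only [Ex, ih]

lemma Ex_succ' (n : ℕ) (s : S) (F : S → ℝ) :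
    Ex k st (n + 1) s F = Ex k st n s (fun s' => ∑ x, k s' x * F (st s' x)) := by
  rw [Ex_add_time]; rfl

lemma Ex_mono (hk : ∀ s x, 0 ≤ k s x) (P : ℕ → S → Prop)
    (hP : ∀ i s x, P i s → P (i+1) (st s x)) (n : ℕ) {F G : S → ℝ}
    (i : ℕ) (s : S) (hs : P i s) (hFG : ∀ s, P (i + n) s → F s ≤ G s) :
    Ex k st n s F ≤ Ex k st n s G := by
  induction n generalizing s i with
  | zero => exact hFG s hs
  | succ n ih =>
    simp only [Ex]
    refine Finset.sum_le_sum fun x _ => mul_le_mul_of_nonneg_left ?_ (hk s x)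
    refine ih (i+1) _ (hP i s x hs) ?_
    intro s' h'
    apply hFG
    convert h' using 1
    omega

lemma Ex_congr (hk : ∀ s x, 0 ≤ k s x) (P : ℕ → S → Prop)
    (hP : ∀ i s x, P i s → P (i+1) (st s x)) (n : ℕ) {F G : S → ℝ}
    (i : ℕ) (s : S) (hs : P i s) (hFG : ∀ s, P (i + n) s → F s = G s) :
    Ex k st n s F = Ex k st n s G :=
  le_antisymm (Ex_mono hk P hP n i s hs fun s h => (hFG s h).le)
    (Ex_mono hk P hP n i s hs fun s h => (hFG s h).ge)

lemma Ex_const (h1 : ∀ s, ∑ x, k s x = 1) (n : ℕ) (s : S) (c : ℝ) :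
    Ex k st n s (fun _ => c) = c := by
  induction n generalizing s with
  | zero => rfl
  | succ n ih => simp only [Ex, ih, ← Finset.sum_mul, h1, one_mul]

lemma Ex_add (n : ℕ) (s : S) (F G : S → ℝ) :
    Ex k st n s (fun s => F s + G s) = Ex k st n s F + Ex k st n s G := by
  induction n generalizing s with
  | zero => rfl
  | succ n ih => simp only [Ex, ih, mul_add, Finset.sum_add_distrib]

lemma Ex_smul (n : ℕ) (s : S) (c : ℝ) (F : S → ℝ) :
    Ex k st n s (fun s => c * F s) = c * Ex k st n s F := by
  induction n generalizing s with
  | zero => rfl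
  | succ n ih =>
    simp only [Ex, ih, Finset.mul_sum]
    exact Finset.sum_congr rfl fun x _ => by ring

lemma Ex_sum {ι : Type} (I : Finset ι) (n : ℕ) (s : S) (F : ι → S → ℝ) :
    Ex k st n s (fun s => ∑ i ∈ I, F i s) = ∑ i ∈ I, Ex k st n s (F i) := by
  induction n generalizing s with
  | zero => rfl
  | succ n ih =>
    simp only [Ex, ih, Finset.mul_sum]
    rw [Finset.sum_comm]

lemma Ex_telescope (hk : ∀ s x, 0 ≤ k s x) (P : S → Prop)
    (hP : ∀ s x, P s → P (st s x)) (Ψ d : S → ℝ) (h0 : ∀ s, P s → 0 ≤ Ψ s)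
    (hd : ∀ s, P s → ∑ x, k s x * Ψ (st s x) ≤ Ψ s - d s) (n : ℕ) (s : S) (hs : P s)
    (h1 : ∀ s, ∑ x, k s x = 1) :
    ∑ t ∈ Finset.range n, Ex k st t s d ≤ Ψ s := by
  have key : ∀ n, ∑ t ∈ Finset.range n, Ex k st t s d + Ex k st n s Ψ ≤ Ψ s := by
    intro n
    induction n with
    | zero => simp [Ex]
    | succ n ih =>
      rw [Finset.sum_range_succ, Ex_succ']
      have : Ex k st n s (fun s' => ∑ x, k s' x * Ψ (st s' x)) ≤
          Ex k st n s (fun s' => Ψ s' + (-1) * d s') :=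
        Ex_mono hk (fun _ => P) (fun _ => hP) n 0 s hs
          (fun s h => by have := hd s h; linarith)
      rw [Ex_add, Ex_smul] at this
      linarith
  have h2 : 0 ≤ Ex k st n s Ψ := by
    have := Ex_mono (k := k) (st := st) hk (fun _ => P) (fun _ => hP) n 0 s hs
      (F := fun _ => 0) (G := Ψ) h0
    rwa [Ex_const h1] at this
  linarith [key n]

def runS (st : S → X → S) (s : S) : (t : ℕ) → (Fin t → X) → S
  | 0, _ => s
  | t+1, w => st (runS st s t (fun i => w i.castSucc)) (w (Fin.last t))

lemma run_snoc (s : S) (n : ℕ) (w : Fin n → X) (x : X) (t : ℕ) (ht : t ≤ n) :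
    runS st s t (fun i => Fin.snoc (α := fun _ => X) w x ⟨i.1, by omega⟩)
      = runS st s t (fun i => w ⟨i.1, by omega⟩) := by
  congr 1
  funext i
  have : (⟨i.1, by omega⟩ : Fin (n+1)) = Fin.castSucc ⟨i.1, by omega⟩ := rfl
  rw [this, Fin.snoc_castSucc]

lemma traj_sum (s : S) (n : ℕ) (F : S → ℝ) :
    ∑ w : Fin n → X, (∏ t : Fin n, k (runS st s t.1 (fun i => w ⟨i.1, by omega⟩)) (w t)) *
      F (runS st s n w) = Ex k st n s F := by
  induction n generalizing F with
  | zero => simp [Ex, runS]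
  | succ n ih =>
    rw [Ex_succ', ← ih]
    rw [← (Fin.snocEquiv (fun _ : Fin (n+1) => X)).sum_comp, Fintype.sum_prod_type,
      Finset.sum_comm]
    refine Finset.sum_congr rfl fun w _ => ?_
    rw [Finset.mul_sum]
    refine Finset.sum_congr rfl fun x _ => ?_
    rw [Fin.prod_univ_castSucc]
    simp only [Fin.snocEquiv_apply, Fin.snoc_castSucc, Fin.snoc_last, runS, Fin.val_castSucc,
      Fin.val_last]
    have e1 : ∀ t : Fin n, runS st s t.1
        (fun i => Fin.snoc (α := fun _ => X) w x ⟨i.1, by omega⟩) =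
        runS st s t.1 (fun i => w ⟨i.1, by omega⟩) := fun t => run_snoc s n w x t.1 (by omega)
    have e2 := run_snoc (st := st) s n w x n le_rfl
    simp only [e1, e2]
    ring

lemma traj_reward (h1 : ∀ s, ∑ x, k s x = 1) (s : S) (n : ℕ) (y : S → X → ℝ) :
    ∑ w : Fin n → X, (∏ t : Fin n, k (runS st s t.1 (fun i => w ⟨i.1, by omega⟩)) (w t)) *
      (∑ t : Fin n, y (runS st s t.1 (fun i => w ⟨i.1, by omega⟩)) (w t)) =
      ∑ t ∈ Finset.range n, Ex k st t s (fun s => ∑ x, k s x * y s x) := by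
  induction n with
  | zero => simp
  | succ n ih =>
    rw [Finset.sum_range_succ, ← ih, ← traj_sum]
    rw [← (Fin.snocEquiv (fun _ : Fin (n+1) => X)).sum_comp, Fintype.sum_prod_type,
      Finset.sum_comm, ← Finset.sum_add_distrib]
    refine Finset.sum_congr rfl fun w _ => ?_
    simp only [Fin.prod_univ_castSucc, Fin.sum_univ_castSucc]
    simp only [Fin.snocEquiv_apply, Fin.snoc_castSucc, Fin.snoc_last, runS, Fin.val_castSucc,
      Fin.val_last]
    have e1 : ∀ x, ∀ t : Fin n, runS st s t.1
        (fun i => Fin.snoc (α := fun _ => X) w x ⟨i.1, by omega⟩) =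
        runS st s t.1 (fun i => w ⟨i.1, by omega⟩) := fun x t => run_snoc s n w x t.1 (by omega)
    have e2 := fun x => run_snoc (st := st) s n w x n le_rfl
    simp only [e1, e2]
    have h2 := h1 (runS st s n w)
    set Pw := ∏ t : Fin n, k (runS st s t.1 (fun i => w ⟨i.1, by omega⟩)) (w t)
    set R := ∑ t : Fin n, y (runS st s t.1 (fun i => w ⟨i.1, by omega⟩)) (w t)
    have : ∀ x, Pw * k (runS st s n w) x * (R + y (runS st s n w) x) =
      (Pw * R) * k (runS st s n w) x + Pw * (k (runS st s n w) x * y (runS st s n w) x) := by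
      intro x; ring
    simp only [this, Finset.sum_add_distrib, ← Finset.mul_sum, h2, mul_one]

end Generic

section Graph
variable {A : Type} [Fintype A] [DecidableEq A]

/-- weighted Caro–Wei -/
lemma caro_wei (N : A → A → Prop) [DecidableRel N] (hr : ∀ a, N a a)
    (hs : ∀ a b, N a b → N b a) (w : A → ℝ) (hw : ∀ a, 0 < w a) (al : ℕ)
    (V : Finset A)
    (hal : ∀ S : Finset A, S ⊆ V → (∀ i ∈ S, ∀ j ∈ S, i ≠ j → ¬ N i j) → S.card ≤ al) :
    ∑ a ∈ V, w a / (∑ b ∈ V with N b a, w b) ≤ al := by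
  induction hn : V.card using Nat.strong_induction_on generalizing V al with
  | _ n ih =>
  rcases V.eq_empty_or_nonempty with rfl | hne
  · simp
  obtain ⟨v, hv, hmin⟩ := V.exists_min_image (fun a => ∑ b ∈ V with N b a, w b) hne
  set V' := V.filter (fun b => ¬ N b v) with hV'
  have hlt : V'.card < n := by
    rw [← hn]
    apply Finset.card_lt_card
    refine ⟨Finset.filter_subset _ _, fun h => ?_⟩
    have := h hv
    simp [hV', hr] at this
  have hal1 : 1 ≤ al := by
    have := hal {v} (by simpa using hv) (by simp)
    simpa using this
  have h1 := ih _ hlt (al - 1) V' (by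
    intro S hS hind
    have hvS : v ∉ S := fun h => by
      have := hS h
      simp [hV', hr] at this
    have := hal (insert v S) (by
      intro x hx
      rcases Finset.mem_insert.1 hx with rfl | hx
      · exact hv
      · exact (Finset.mem_filter.1 (hS hx)).1) (by
      intro i hi j hj hij
      rcases Finset.mem_insert.1 hi with hi1 | hi1 <;> rcases Finset.mem_insert.1 hj with hj1 | hj1
      · exact absurd (hi1.trans hj1.symm) hij
      · intro h
        rw [hi1] at h
        exact (Finset.mem_filter.1 (hS hj1)).2 (hs _ _ h)
      · rw [hj1]; exact (Finset.mem_filter.1 (hS hi1)).2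
      · exact hind i hi1 j hj1 hij)
    rw [Finset.card_insert_of_notMem hvS] at this
    omega) rfl
  have pos : ∀ a ∈ V, 0 < ∑ b ∈ V with N b a, w b := fun a ha =>
    Finset.sum_pos (fun b _ => hw b) ⟨a, by simp [ha, hr]⟩
  rw [← Finset.sum_filter_add_sum_filter_not V (fun b => N b v)]
  have h2 : ∑ a ∈ V with N a v, w a / (∑ b ∈ V with N b a, w b) ≤ 1 := by
    calc ∑ a ∈ V with N a v, w a / (∑ b ∈ V with N b a, w b)
        ≤ ∑ a ∈ V with N a v, w a / (∑ b ∈ V with N b v, w b) := by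
          refine Finset.sum_le_sum fun a ha => ?_
          have ha' := (Finset.mem_filter.1 ha).1
          exact div_le_div_of_nonneg_left (hw a).le (pos v hv) (hmin a ha')
      _ = 1 := by rw [← Finset.sum_div]; exact div_self (pos v hv).ne'
  have h3 : ∑ a ∈ V', w a / (∑ b ∈ V with N b a, w b) ≤
      ∑ a ∈ V', w a / (∑ b ∈ V' with N b a, w b) := by
    refine Finset.sum_le_sum fun a ha => ?_
    refine div_le_div_of_nonneg_left (hw a).le
      (Finset.sum_pos (fun b _ => hw b) ⟨a, by simp [ha, hr]⟩) ?_
    refine Finset.sum_le_sum_of_subset_of_nonneg ?_ (fun b _ _ => (hw b).le)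
    exact Finset.filter_subset_filter _ (Finset.filter_subset _ _)
  have : ((al - 1 : ℕ) : ℝ) = al - 1 := by push_cast [hal1]; ring
  rw [this] at h1
  linarith

lemma exists_heavy (E : A → A → Prop) [DecidableRel E] (hr : ∀ a, E a a)
    (w : A → ℝ) (hw : ∀ a, 0 < w a) (al : ℕ)
    (hal : ∀ S : Finset A, (∀ i ∈ S, ∀ j ∈ S, i ≠ j → ¬ E i j) → S.card ≤ al)
    (V : Finset A) (hV : V.Nonempty) :
    ∃ v ∈ V, ∑ a ∈ V, w a ≤ 2 * al * ∑ b ∈ V with E b v, w b := by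
  let N : A → A → Prop := fun a b => E a b ∨ E b a
  have h1 := caro_wei N (fun a => Or.inl (hr a)) (fun a b h => h.symm) w hw al V
    (fun S _ h => hal S fun i hi j hj hij hE => h i hi j hj hij (Or.inl hE))
  by_contra hcon
  push Not at hcon
  have pos : ∀ a ∈ V, 0 < ∑ b ∈ V with N b a, w b := fun a ha =>
    Finset.sum_pos (fun b _ => hw b) ⟨a, by simp [ha, N, hr]⟩
  have hW : 0 < ∑ a ∈ V, w a := Finset.sum_pos (fun b _ => hw b) hV
  have hcs : (∑ a ∈ V, w a) ^ 2 ≤ (∑ a ∈ V, w a / (∑ b ∈ V with N b a, w b)) *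
      (∑ a ∈ V, w a * (∑ b ∈ V with N b a, w b)) := by
    apply Finset.sum_sq_le_sum_mul_sum_of_sq_le_mul
    · exact fun a ha => (div_pos (hw a) (pos a ha)).le
    · exact fun a ha => (mul_pos (hw a) (pos a ha)).le
    · intro a ha
      have := (pos a ha).ne'
      apply le_of_eq
      field_simp
  have hQ : ∑ a ∈ V, w a * (∑ b ∈ V with N b a, w b) ≤
      2 * ∑ a ∈ V, w a * (∑ b ∈ V with E b a, w b) := by
    have : ∑ a ∈ V, w a * (∑ b ∈ V with E b a, w b) = ∑ a ∈ V, w a * (∑ b ∈ V with E a b, w b) := by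
      simp only [Finset.sum_filter, Finset.mul_sum]
      rw [Finset.sum_comm]
      refine Finset.sum_congr rfl fun a _ => Finset.sum_congr rfl fun b _ => ?_
      split_ifs <;> ring
    rw [two_mul]
    nth_rw 2 [this]
    rw [← Finset.sum_add_distrib]
    refine Finset.sum_le_sum fun a _ => ?_
    rw [← mul_add]
    refine mul_le_mul_of_nonneg_left ?_ (hw a).le
    simp only [Finset.sum_filter, ← Finset.sum_add_distrib]
    refine Finset.sum_le_sum fun b _ => ?_
    have := hw b
    by_cases h1 : E b a <;> by_cases h2 : E a b <;> simp [N, h1, h2] <;> linarith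
  have hal0 : 0 < (al : ℝ) := by
    obtain ⟨v, hv⟩ := hV
    have := hal {v} (by simp)
    simp at this
    exact_mod_cast this
  have hlt : ∑ a ∈ V, w a * (2 * al * (∑ b ∈ V with E b a, w b)) < ∑ a ∈ V, w a * (∑ a ∈ V, w a) :=
    Finset.sum_lt_sum_of_nonempty hV fun a ha => mul_lt_mul_of_pos_left (hcon a ha) (hw a)
  rw [← Finset.sum_mul, ← pow_two] at hlt
  have e : ∑ a ∈ V, w a * (2 * al * (∑ b ∈ V with E b a, w b)) =
    al * (2 * ∑ a ∈ V, w a * (∑ b ∈ V with E b a, w b)) := by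
    rw [Finset.mul_sum, Finset.mul_sum]
    exact Finset.sum_congr rfl fun a _ => by ring
  rw [e] at hlt
  have hQ0 : 0 ≤ ∑ a ∈ V, w a * (∑ b ∈ V with N b a, w b) :=
    Finset.sum_nonneg fun a ha => (mul_pos (hw a) (pos a ha)).le
  nlinarith [mul_le_mul_of_nonneg_right h1 hQ0, mul_le_mul_of_nonneg_left hQ hal0.le]

lemma graph_aux (E : A → A → Prop) [DecidableRel E] (hr : ∀ a, E a a)
    (w : A → ℝ) (hw : ∀ a, 0 < w a) (al : ℕ)
    (hal : ∀ S : Finset A, (∀ i ∈ S, ∀ j ∈ S, i ≠ j → ¬ E i j) → S.card ≤ al)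
    (hal1 : 1 ≤ al) (γ : ℝ) (hγ : 0 < γ) (V : Finset A) :
    ∑ a ∈ V, w a / ((∑ b ∈ V with E b a, w b) + γ) ≤
      2 * al * Real.log ((∑ a ∈ V, w a + γ) / γ) := by
  have hal1' : (1:ℝ) ≤ al := by exact_mod_cast hal1
  induction hn : V.card generalizing V with
  | zero =>
    rw [Finset.card_eq_zero] at hn
    subst hn
    simp [hγ.ne']
  | succ n ih =>
    have hV : V.Nonempty := by
      rw [← Finset.card_pos]; omega
    obtain ⟨v, hv, hh⟩ := exists_heavy E hr w hw al hal V hV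
    have h1 := ih (V.erase v) (by rw [Finset.card_erase_of_mem hv]; omega)
    rw [← Finset.add_sum_erase V _ hv]
    have h2 : ∑ a ∈ V.erase v, w a / ((∑ b ∈ V with E b a, w b) + γ) ≤
        ∑ a ∈ V.erase v, w a / ((∑ b ∈ V.erase v with E b a, w b) + γ) := by
      refine Finset.sum_le_sum fun a ha => ?_
      refine div_le_div_of_nonneg_left (hw a).le
        (add_pos_of_nonneg_of_pos (Finset.sum_nonneg fun b _ => (hw b).le) hγ) ?_
      gcongr
      · exact fun b _ _ => (hw b).le
      · exact Finset.erase_subset _ _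
    set y := ∑ a ∈ V.erase v, w a with hy
    have hy0 : 0 ≤ y := Finset.sum_nonneg fun b _ => (hw b).le
    have hsum : ∑ a ∈ V, w a = w v + y := by rw [← Finset.add_sum_erase V _ hv]
    have hwv := hw v
    have h3 : w v / ((∑ b ∈ V with E b v, w b) + γ) ≤ 2 * al * (w v / (w v + y + γ)) := by
      rw [hsum] at hh
      have : 0 ≤ ∑ b ∈ V with E b v, w b := Finset.sum_nonneg fun b _ => (hw b).le
      rw [mul_div_assoc', div_le_div_iff₀ (by positivity) (by positivity)]
      have : w v + y + γ ≤ 2 * al * ((∑ b ∈ V with E b v, w b) + γ) := by nlinarith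
      nlinarith
    have h4 : w v / (w v + y + γ) ≤ Real.log ((w v + y + γ) / (y + γ)) := by
      have := Real.one_sub_inv_le_log_of_pos (x := (w v + y + γ) / (y + γ)) (by positivity)
      convert this using 1
      field_simp
      ring
    have h5 : Real.log ((w v + y + γ) / γ) = Real.log ((w v + y + γ) / (y + γ)) +
        Real.log ((y + γ) / γ) := by
      rw [← Real.log_mul (by positivity) (by positivity)]
      congr 1
      field_simp
    have h6 : 2 * (al:ℝ) * (w v / (w v + y + γ)) ≤
      2 * al * Real.log ((w v + y + γ) / (y + γ)) := by gcongr
    rw [hsum, h5, mul_add]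
    linarith

noncomputable def nin (E : A → A → Prop) [DecidableRel E] (q : A → ℝ) (a : A) : ℝ :=
  ∑ b, if E b a then q b else 0

lemma graph_lemma (E : A → A → Prop) [DecidableRel E] (hr : ∀ a, E a a)
    (w : A → ℝ) (hw : ∀ a, 0 < w a) (hw1 : ∑ a, w a = 1) (al : ℕ)
    (hal : ∀ S : Finset A, (∀ i ∈ S, ∀ j ∈ S, i ≠ j → ¬ E i j) → S.card ≤ al)
    (hal1 : 1 ≤ al) (γ : ℝ) (hγ : 0 < γ) :
    ∑ a, w a / (nin E w a + γ) ≤ 2 * al * Real.log ((1 + γ) / γ) := by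
  have := graph_aux E hr w hw al hal hal1 γ hγ Finset.univ
  rw [hw1] at this
  simpa only [nin, Finset.sum_filter] using this

end Graph

section Iid
variable {C : Type} [Fintype C]

noncomputable def Ait (ν X : C → ℝ) : ℕ → (ℝ → ℝ) → ℝ → ℝ
  | 0, φ, s => φ s
  | n+1, φ, s => ∑ c, ν c * Ait ν X n φ (s + X c)

variable {ν X : C → ℝ}

lemma Ait_add (n : ℕ) (φ ψ : ℝ → ℝ) (s : ℝ) :
    Ait ν X n (fun u => φ u + ψ u) s = Ait ν X n φ s + Ait ν X n ψ s := by
  induction n generalizing s with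
  | zero => rfl
  | succ n ih => simp only [Ait, ih, mul_add, Finset.sum_add_distrib]

lemma Ait_smul (n : ℕ) (b : ℝ) (φ : ℝ → ℝ) (s : ℝ) :
    Ait ν X n (fun u => b * φ u) s = b * Ait ν X n φ s := by
  induction n generalizing s with
  | zero => rfl
  | succ n ih =>
    simp only [Ait, ih, Finset.mul_sum]
    exact Finset.sum_congr rfl fun x _ => by ring

lemma Ait_const (h1 : ∑ c, ν c = 1) (n : ℕ) (b s : ℝ) :
    Ait ν X n (fun _ => b) s = b := by
  induction n generalizing s with
  | zero => rfl
  | succ n ih => simp only [Ait, ih, ← Finset.sum_mul, h1, one_mul]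

lemma Ait_id (h1 : ∑ c, ν c = 1) (n : ℕ) (s : ℝ) :
    Ait ν X n (fun u => u) s = s + n * ∑ c, ν c * X c := by
  induction n generalizing s with
  | zero => simp [Ait]
  | succ n ih =>
    simp only [Ait, ih, mul_add, Finset.sum_add_distrib, ← Finset.sum_mul, h1]
    push_cast; ring

lemma Ait_mono (hν : ∀ c, 0 ≤ ν c) (hX : ∀ c, 0 ≤ X c) (n : ℕ) (φ ψ : ℝ → ℝ) (s0 s : ℝ)
    (hs : s0 ≤ s) (h : ∀ u, s0 ≤ u → φ u ≤ ψ u) : Ait ν X n φ s ≤ Ait ν X n ψ s := by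
  induction n generalizing s with
  | zero => exact h s hs
  | succ n ih =>
    refine Finset.sum_le_sum fun c _ => mul_le_mul_of_nonneg_left (ih _ ?_) (hν c)
    linarith [hX c]

lemma Ait_anti (hν : ∀ c, 0 ≤ ν c) (hX : ∀ c, 0 ≤ X c) (n : ℕ) (φ : ℝ → ℝ)
    (h : ∀ u v, 0 < u → u ≤ v → φ v ≤ φ u) (s s' : ℝ) (hs : 0 < s) (hss : s ≤ s') :
    Ait ν X n φ s' ≤ Ait ν X n φ s := by
  induction n generalizing s s' with
  | zero => exact h s s' hs hss
  | succ n ih =>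
    refine Finset.sum_le_sum fun c _ => mul_le_mul_of_nonneg_left (ih _ _ ?_ ?_) (hν c)
    · linarith [hX c]
    · linarith

lemma Ait_key (hν : ∀ c, 0 ≤ ν c) (h1 : ∑ c, ν c = 1) (hX : ∀ c, 0 ≤ X c) (hX1 : ∀ c, X c ≤ 1)
    (n : ℕ) (φ : ℝ → ℝ) (h : ∀ u v, 0 < u → u ≤ v → φ v ≤ φ u) (s : ℝ) (hs : 0 < s) :
    n * (∑ c, ν c * X c) * Ait ν X n φ (s + 1) ≤ Ait ν X n (fun u => (u - s) * φ u) s := by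
  induction n generalizing s with
  | zero => simp [Ait]
  | succ n ih =>
    set f := ∑ c, ν c * X c with hf
    have hf0 : 0 ≤ f := Finset.sum_nonneg fun c _ => mul_nonneg (hν c) (hX c)
    have step : ∀ c, Ait ν X n (fun u => (u - s) * φ u) (s + X c) =
        Ait ν X n (fun u => (u - (s + X c)) * φ u) (s + X c) + X c * Ait ν X n φ (s + X c) := by
      intro c
      rw [← Ait_smul, ← Ait_add]
      congr 1; funext u; ring
    have hA1 : Ait ν X (n+1) φ (s+1) ≤ Ait ν X n φ (s+1) := by
      calc Ait ν X (n+1) φ (s+1) = ∑ c, ν c * Ait ν X n φ (s + 1 + X c) := rfl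
        _ ≤ ∑ c, ν c * Ait ν X n φ (s + 1) := by
          refine Finset.sum_le_sum fun c _ => mul_le_mul_of_nonneg_left ?_ (hν c)
          exact Ait_anti hν hX n φ h _ _ (by linarith) (by linarith [hX c])
        _ = _ := by rw [← Finset.sum_mul, h1, one_mul]
    calc ((n+1 : ℕ) : ℝ) * f * Ait ν X (n+1) φ (s+1)
        ≤ n * f * Ait ν X (n+1) φ (s+1) + f * Ait ν X n φ (s+1) := by
          push_cast; nlinarith [mul_le_mul_of_nonneg_left hA1 hf0]
      _ = ∑ c, ν c * (n * f * Ait ν X n φ (s + X c + 1) + X c * Ait ν X n φ (s + 1)) := by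
          simp only [mul_add, Finset.sum_add_distrib]
          congr 1
          · simp only [Ait, Finset.mul_sum]
            refine Finset.sum_congr rfl fun c _ => ?_
            rw [show s + 1 + X c = s + X c + 1 by ring]; ring
          · rw [hf, Finset.sum_mul]
            exact Finset.sum_congr rfl fun c _ => by ring
      _ ≤ ∑ c, ν c * Ait ν X n (fun u => (u - s) * φ u) (s + X c) := by
          refine Finset.sum_le_sum fun c _ => mul_le_mul_of_nonneg_left ?_ (hν c)
          rw [step]
          refine add_le_add (ih _ (by linarith [hX c])) ?_
          refine mul_le_mul_of_nonneg_left ?_ (hX c)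
          exact Ait_anti hν hX n φ h _ _ (by linarith [hX c]) (by linarith [hX1 c])

lemma inv_anti (u v : ℝ) (hu : 0 < u) (huv : u ≤ v) : 1 / v ≤ 1 / u :=
  one_div_le_one_div_of_le hu huv

lemma Ait_inv (hν : ∀ c, 0 ≤ ν c) (h1 : ∑ c, ν c = 1) (hX : ∀ c, 0 ≤ X c) (hX1 : ∀ c, X c ≤ 1)
    (n : ℕ) (s : ℝ) (hs : 1 < s) :
    n * (∑ c, ν c * X c) * Ait ν X n (fun u => 1 / u) s ≤ 1 := by
  have := Ait_key hν h1 hX hX1 n (fun u => 1 / u) inv_anti (s - 1) (by linarith)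
  rw [sub_add_cancel] at this
  refine this.trans ?_
  refine le_trans (b := Ait ν X n (fun _ => 1) (s-1)) ?_ (Ait_const h1 n 1 _).le
  refine Ait_mono hν hX n _ _ (s-1) _ le_rfl fun u hu => ?_
  have : 0 < u := by linarith
  rw [mul_one_div, div_le_one this]
  linarith

lemma Ait_inv2 (hν : ∀ c, 0 ≤ ν c) (h1 : ∑ c, ν c = 1) (hX : ∀ c, 0 ≤ X c) (hX1 : ∀ c, X c ≤ 1)
    (n : ℕ) (s : ℝ) (hs : 2 < s) :
    (n * (∑ c, ν c * X c)) ^ 2 * Ait ν X n (fun u => (1 / u) ^ 2) s ≤ 1 := by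
  have := Ait_key hν h1 hX hX1 n (fun u => (1 / u) ^ 2) (fun u v hu huv => by
    have := inv_anti u v hu huv
    have : 0 ≤ 1 / v := by have := hu.trans_le huv; positivity
    gcongr) (s - 1) (by linarith)
  rw [sub_add_cancel] at this
  have h2 := Ait_inv hν h1 hX hX1 n (s - 1) (by linarith)
  set f := ∑ c, ν c * X c with hf
  have hf0 : 0 ≤ f := Finset.sum_nonneg fun c _ => mul_nonneg (hν c) (hX c)
  have h3 : Ait ν X n (fun u => (u - (s - 1)) * (1 / u) ^ 2) (s - 1) ≤
      Ait ν X n (fun u => 1 / u) (s - 1) := by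
    refine Ait_mono hν hX n _ _ (s-1) _ le_rfl fun u hu => ?_
    have : 0 < u := by linarith
    rw [div_pow, one_pow, mul_one_div, div_le_div_iff₀ (by positivity) this]
    nlinarith
  have hnf : 0 ≤ n * f := by positivity
  nlinarith [mul_le_mul_of_nonneg_left (this.trans h3) hnf]

lemma Ait_inv_lower (hν : ∀ c, 0 ≤ ν c) (h1 : ∑ c, ν c = 1) (hX : ∀ c, 0 ≤ X c)
    (n : ℕ) (s : ℝ) (hs : 0 < s) :
    1 / (s + n * ∑ c, ν c * X c) ≤ Ait ν X n (fun u => 1 / u) s := by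
  set f := ∑ c, ν c * X c with hf
  have hf0 : 0 ≤ f := Finset.sum_nonneg fun c _ => mul_nonneg (hν c) (hX c)
  set m := s + n * f with hm
  have hm0 : 0 < m := by positivity
  have h2 : Ait ν X n (fun u => 2 / m + (-1 / m ^ 2) * u) s ≤ Ait ν X n (fun u => 1 / u) s := by
    refine Ait_mono hν hX n _ _ s _ le_rfl fun u hu => ?_
    have hu0 : 0 < u := by linarith
    have : 0 ≤ (u - m) ^ 2 / (u * m ^ 2) := by positivity
    have e : 1 / u - (2 / m + (-1 / m ^ 2) * u) = (u - m) ^ 2 / (u * m ^ 2) := by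
      field_simp; ring
    linarith
  rw [Ait_add, Ait_const h1, Ait_smul, Ait_id h1, ← hf, ← hm] at h2
  refine le_trans (le_of_eq ?_) h2
  field_simp; ring

lemma Ait_exp (hν : ∀ c, 0 ≤ ν c) (h1 : ∑ c, ν c = 1) (hX : ∀ c, 0 ≤ X c) (hX1 : ∀ c, X c ≤ 1)
    (n : ℕ) (s : ℝ) :
    Ait ν X n (fun u => Real.exp (-4 * u)) s ≤
      Real.exp (-4 * s - (2/3) * n * ∑ c, ν c * X c) := by
  set f := ∑ c, ν c * X c with hf
  have he : Real.exp (-4) ≤ 1/3 := by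
    have : (3:ℝ) ≤ Real.exp 4 := by
      have := Real.add_one_le_exp (4:ℝ); linarith
    rw [Real.exp_neg]
    rw [one_div]
    exact inv_anti₀ (by norm_num) this
  have hx : ∀ x : ℝ, 0 ≤ x → x ≤ 1 → Real.exp (-4 * x) ≤ 1 - (2/3) * x := by
    intro x hx0 hx1
    have := convexOn_exp.2 (Set.mem_univ (-4)) (Set.mem_univ 0) hx0 (sub_nonneg.2 hx1) (by ring)
    simp only [smul_eq_mul, mul_zero, add_zero, Real.exp_zero, mul_one] at this
    rw [mul_comm]
    nlinarith
  induction n generalizing s with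
  | zero => simp [Ait]
  | succ n ih =>
    calc Ait ν X (n+1) (fun u => Real.exp (-4 * u)) s
        ≤ ∑ c, ν c * Real.exp (-4 * (s + X c) - (2/3) * n * f) :=
          Finset.sum_le_sum fun c _ => mul_le_mul_of_nonneg_left (ih _) (hν c)
      _ ≤ ∑ c, ν c * ((1 - (2/3) * X c) * Real.exp (-4 * s - (2/3) * n * f)) := by
          refine Finset.sum_le_sum fun c _ => mul_le_mul_of_nonneg_left ?_ (hν c)
          rw [show -4 * (s + X c) - (2/3) * n * f = -4 * X c + (-4 * s - (2/3) * n * f) by ring,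
            Real.exp_add]
          exact mul_le_mul_of_nonneg_right (hx _ (hX c) (hX1 c)) (Real.exp_pos _).le
      _ = (1 - (2/3) * f) * Real.exp (-4 * s - (2/3) * n * f) := by
          simp only [← mul_assoc, ← Finset.sum_mul]
          congr 1
          simp only [mul_sub, Finset.sum_sub_distrib, mul_one, h1]
          rw [hf, Finset.mul_sum]
          congr 1
          exact Finset.sum_congr rfl fun c _ => by ring
      _ ≤ Real.exp (-(2/3) * f) * Real.exp (-4 * s - (2/3) * n * f) := by
          refine mul_le_mul_of_nonneg_right ?_ (Real.exp_pos _).le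
          have := Real.add_one_le_exp (-(2/3) * f)
          linarith
      _ = _ := by
          rw [← Real.exp_add]; congr 1; push_cast; ring

end Iid

section Softmax
variable {A : Type} [Fintype A] [Nonempty A]

noncomputable def smx (η : ℝ) (v : A → ℝ) (a : A) : ℝ :=
  Real.exp (-η * v a) / ∑ b, Real.exp (-η * v b)

lemma smx_den (η : ℝ) (v : A → ℝ) : 0 < ∑ b, Real.exp (-η * v b) :=
  Finset.sum_pos (fun _ _ => Real.exp_pos _) Finset.univ_nonempty

lemma smx_pos (η : ℝ) (v : A → ℝ) (a : A) : 0 < smx η v a :=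
  div_pos (Real.exp_pos _) (smx_den η v)

lemma smx_sum (η : ℝ) (v : A → ℝ) : ∑ a, smx η v a = 1 := by
  simp only [smx, ← Finset.sum_div]
  exact div_self (smx_den η v).ne'

lemma smx_ratio (η : ℝ) (v w : A → ℝ) (h0 : ∀ a, 0 ≤ η * (v a - w a))
    (h1 : ∀ a, η * (v a - w a) ≤ 1) (a : A) :
    smx η w a ≤ 3 * smx η v a ∧ smx η v a ≤ 3 * smx η w a := by
  have he : Real.exp 1 ≤ 3 := by linarith [Real.exp_one_lt_d9]
  have ha : ∀ a, Real.exp (-η * v a) ≤ Real.exp (-η * w a) := fun a =>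
    Real.exp_le_exp.2 (by nlinarith [h0 a])
  have hb : ∀ a, Real.exp (-η * w a) ≤ 3 * Real.exp (-η * v a) := fun a => by
    calc Real.exp (-η * w a) ≤ Real.exp (1 + -η * v a) :=
          Real.exp_le_exp.2 (by nlinarith [h1 a])
      _ = Real.exp 1 * Real.exp (-η * v a) := Real.exp_add _ _
      _ ≤ _ := by gcongr
  have hA : ∑ b, Real.exp (-η * v b) ≤ ∑ b, Real.exp (-η * w b) :=
    Finset.sum_le_sum fun b _ => ha b
  have hB : ∑ b, Real.exp (-η * w b) ≤ 3 * ∑ b, Real.exp (-η * v b) := by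
    rw [Finset.mul_sum]; exact Finset.sum_le_sum fun b _ => hb b
  have p1 := smx_den η v
  have p2 := smx_den η w
  have q1 := Real.exp_pos (-η * v a)
  have q2 := Real.exp_pos (-η * w a)
  constructor
  · unfold smx
    rw [mul_div_assoc', div_le_div_iff₀ p2 p1]
    nlinarith [ha a, hb a]
  · unfold smx
    rw [mul_div_assoc', div_le_div_iff₀ p1 p2]
    nlinarith [ha a, hb a]

lemma smx_perturb (η : ℝ) (v w k : A → ℝ) (x : A → ℝ) (hx : ∀ a, x a = η * (v a - w a))
    (hx1 : ∀ a, |x a| ≤ 1) :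
    ∑ a, smx η v a * k a ≤ ∑ a, smx η w a * k a +
      6 * ∑ a, smx η w a * (x a ^ 2 + k a ^ 2) := by
  set Z := ∑ b, smx η w b * Real.exp (-x b) with hZ
  have hq := smx_sum η w
  have hqp := smx_pos η w
  have hexp : ∀ a, |Real.exp (-x a) - 1| ≤ 2 * |x a| := fun a => by
    have := Real.abs_exp_sub_one_le (x := -x a) (by simpa using hx1 a)
    simpa using this
  have hv : ∀ a, smx η v a = smx η w a * Real.exp (-x a) / Z := by
    intro a
    have p1 := smx_den η v
    have p2 := smx_den η w
    have e : ∀ b, Real.exp (-η * w b) * Real.exp (-x b) = Real.exp (-η * v b) := by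
      intro b; rw [← Real.exp_add, hx]; congr 1; ring
    have hZ2 : Z = (∑ b, Real.exp (-η * v b)) / ∑ b, Real.exp (-η * w b) := by
      rw [hZ, Finset.sum_div]
      refine Finset.sum_congr rfl fun b _ => ?_
      rw [← e b]; unfold smx; ring
    rw [hZ2]
    unfold smx
    rw [← e a]
    field_simp
  have hZ3 : 1 / 3 ≤ Z := by
    calc (1:ℝ) / 3 = ∑ b, smx η w b * (1/3) := by rw [← Finset.sum_mul, hq]; norm_num
      _ ≤ Z := by
        refine Finset.sum_le_sum fun b _ => mul_le_mul_of_nonneg_left ?_ (hqp b).le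
        have h3 : Real.exp 1 ≤ 3 := by linarith [Real.exp_one_lt_d9]
        have : Real.exp (-1) ≤ Real.exp (-x b) := Real.exp_le_exp.2 (by
          linarith [(abs_le.1 (hx1 b)).2])
        refine le_trans ?_ this
        rw [Real.exp_neg, one_div]
        exact inv_anti₀ (Real.exp_pos 1) h3
  have hZ0 : 0 < Z := by linarith
  set Xb := ∑ b, smx η w b * |x b| with hXb
  have hZ1 : |Z - 1| ≤ 2 * Xb := by
    have : Z - 1 = ∑ b, smx η w b * (Real.exp (-x b) - 1) := by
      simp only [mul_sub, Finset.sum_sub_distrib, mul_one, hq, hZ]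
    rw [this, hXb, Finset.mul_sum]
    refine (Finset.abs_sum_le_sum_abs _ _).trans (Finset.sum_le_sum fun b _ => ?_)
    rw [abs_mul, abs_of_pos (hqp b)]
    nlinarith [hexp b, hqp b]
  have hd : ∀ a, |smx η v a - smx η w a| ≤ 6 * smx η w a * (|x a| + Xb) := by
    intro a
    have e : smx η v a - smx η w a = smx η w a * ((Real.exp (-x a) - 1) - (Z - 1)) / Z := by
      rw [hv]; field_simp; ring
    rw [e, abs_div, abs_of_pos hZ0, div_le_iff₀ hZ0, abs_mul, abs_of_pos (hqp a)]
    have h1 : |(Real.exp (-x a) - 1) - (Z - 1)| ≤ 2 * (|x a| + Xb) := by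
      refine (abs_sub _ _).trans ?_
      linarith [hexp a]
    have h2 : 0 ≤ |x a| + Xb :=
      add_nonneg (abs_nonneg _) (Finset.sum_nonneg fun b _ => mul_nonneg (hqp b).le (abs_nonneg _))
    have h3 : 0 ≤ smx η w a * (|x a| + Xb) := mul_nonneg (hqp a).le h2
    nlinarith [mul_le_mul_of_nonneg_left h1 (hqp a).le]
  have hJ : Xb ^ 2 ≤ ∑ b, smx η w b * x b ^ 2 := by
    have : Xb ^ 2 ≤ (∑ b, smx η w b) * ∑ b, smx η w b * x b ^ 2 := by
      apply Finset.sum_sq_le_sum_mul_sum_of_sq_le_mul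
      · exact fun b _ => (hqp b).le
      · exact fun b _ => mul_nonneg (hqp b).le (sq_nonneg _)
      · intro b _
        rw [mul_pow, sq_abs]; apply le_of_eq; ring
    rwa [hq, one_mul] at this
  have hterm : ∀ a, smx η v a * k a ≤ smx η w a * k a +
      6 * (smx η w a * ((x a ^ 2 + Xb ^ 2)/2 + k a ^ 2)) := by
    intro a
    have h1 : (smx η v a - smx η w a) * k a ≤ 6 * smx η w a * (|x a| + Xb) * |k a| := by
      refine (le_abs_self _).trans ?_
      rw [abs_mul]
      exact mul_le_mul_of_nonneg_right (hd a) (abs_nonneg _)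
    have h2 : (|x a| + Xb) * |k a| ≤ (x a ^ 2 + Xb ^ 2)/2 + k a ^ 2 := by
      nlinarith [sq_nonneg (|x a| - |k a|), sq_nonneg (Xb - |k a|), sq_abs (x a), sq_abs (k a)]
    nlinarith [mul_le_mul_of_nonneg_left h2 (hqp a).le]
  refine (Finset.sum_le_sum fun a _ => hterm a).trans ?_
  rw [Finset.sum_add_distrib, ← Finset.mul_sum]
  have e : ∑ a, smx η w a * ((x a ^ 2 + Xb ^ 2)/2 + k a ^ 2) =
      (∑ a, smx η w a * x a ^ 2) / 2 + Xb ^ 2 / 2 + ∑ a, smx η w a * k a ^ 2 := by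
    have : ∀ a, smx η w a * ((x a ^ 2 + Xb ^ 2)/2 + k a ^ 2) =
      smx η w a * x a ^ 2 / 2 + smx η w a * (Xb ^ 2 / 2) + smx η w a * k a ^ 2 := by
      intro a; ring
    simp only [this, Finset.sum_add_distrib, ← Finset.sum_div, ← Finset.sum_mul, hq, one_mul]
  rw [e]
  simp only [mul_add, Finset.sum_add_distrib] at *
  linarith

end Softmax

section Chain
variable {C A : Type} [Fintype C] [Fintype A] [DecidableEq A] [Nonempty A]

structure Par (A : Type) where
  E : A → A → Prop
  dec : DecidableRel E
  γ : ℝ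
  L : ℕ

attribute [instance] Par.dec

structure St (C A : Type) where
  n : ℕ
  th : C → A → ℝ
  th1 : C → A → ℝ
  th0 : C → A → ℝ
  acc : A → ℝ
  g : A → ℝ
  D : A → ℝ

noncomputable def Par.eta (P : Par A) : ℝ := 1 / (30 * P.L)

noncomputable def pol (P : Par A) (θ : C → A → ℝ) (c : C) (a : A) : ℝ := smx P.eta (θ c) a

noncomputable def bar (P : Par A) (ν : C → ℝ) (θ : C → A → ℝ) (a : A) : ℝ :=
  ∑ c, ν c * pol P θ c a

noncomputable def fq (P : Par A) (ν : C → ℝ) (θ : C → A → ℝ) (a : A) : ℝ :=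
  nin P.E (bar P ν θ) a

noncomputable def rr (P : Par A) (ν : C → ℝ) (θ : C → A → ℝ) (g : A → ℝ) (a : A) : ℝ :=
  fq P ν θ a / (g a + P.γ)

noncomputable def cp (P : Par A) (ν : C → ℝ) (θ : C → A → ℝ) (g : A → ℝ) (a : A) : ℝ :=
  Real.exp (2 / 3 * P.L * fq P ν θ a - 4 * P.L * (g a + P.γ))

noncomputable def QQ (P : Par A) (ν : C → ℝ) (θ : C → A → ℝ) (g : A → ℝ) (a : A) : ℝ :=
  (1 - rr P ν θ g a) ^ 2 + fq P ν θ a / (g a + P.γ) ^ 2 / P.L + 1 / P.L + cp P ν θ g a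

noncomputable def uu (P : Par A) (σ : St C A) (x : C × A) (a : A) : ℝ :=
  if P.E x.2 a ∧ σ.D a < 12 * P.L then
    pol P σ.th0 x.1 x.2 / pol P σ.th x.1 x.2 / (σ.g a + P.γ) else 0

noncomputable def inner' (P : Par A) (ℓ : ℕ → C → A → ℝ) (σ : St C A) (x : C × A) : St C A where
  n := σ.n + 1
  th := fun c a => σ.th c a + uu P σ x a * ℓ σ.n c a
  th1 := σ.th1
  th0 := σ.th0
  acc := fun a => σ.acc a + nin P.E (pol P σ.th1 x.1) a
  g := σ.g
  D := fun a => σ.D a + uu P σ x a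

noncomputable def bd (P : Par A) (σ : St C A) : St C A where
  n := σ.n
  th := σ.th
  th1 := σ.th
  th0 := σ.th1
  acc := fun _ => 0
  g := fun a => σ.acc a / P.L
  D := fun _ => 0

noncomputable def full (P : Par A) (ℓ : ℕ → C → A → ℝ) (σ : St C A) (x : C × A) : St C A :=
  if (σ.n + 1) % P.L = 0 then bd P (inner' P ℓ σ x) else inner' P ℓ σ x

noncomputable def init (P : Par A) : St C A where
  n := 0
  th := fun _ _ => 0
  th1 := fun _ _ => 0
  th0 := fun _ _ => 0
  acc := fun _ => 0
  g := fun _ => 0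
  D := fun _ => 12 * P.L

noncomputable def ker (P : Par A) (ν : C → ℝ) (σ : St C A) (x : C × A) : ℝ :=
  ν x.1 * pol P σ.th x.1 x.2

structure Hyp (P : Par A) (ℓ : ℕ → C → A → ℝ) (ν : C → ℝ) (Λ : ℝ) : Prop where
  L1 : 1 ≤ P.L
  γL : 2 < P.γ * P.L
  ecap : Real.exp (-4 * (P.γ * P.L)) ≤ 1 / P.L
  l0 : ∀ t c a, 0 ≤ ℓ t c a
  l1 : ∀ t c a, ℓ t c a ≤ 1
  ν0 : ∀ c, 0 ≤ ν c
  ν1 : ∑ c, ν c = 1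
  refl : ∀ a, P.E a a
  gr : ∀ w : A → ℝ, (∀ a, 0 < w a) → ∑ a, w a = 1 → ∑ a, w a / (nin P.E w a + P.γ) ≤ Λ

structure InvB (P : Par A) (σ : St C A) : Prop where
  acc0 : ∀ a, 0 ≤ σ.acc a
  g0 : ∀ a, 0 ≤ σ.g a
  D0 : ∀ a, 0 ≤ σ.D a
  D1 : ∀ a, σ.D a ≤ 15 * P.L
  t01 : ∀ c a, σ.th0 c a ≤ σ.th1 c a
  t10 : ∀ c a, σ.th1 c a ≤ σ.th0 c a + 15 * P.L
  t1 : ∀ c a, σ.th1 c a ≤ σ.th c a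
  t2 : ∀ c a, σ.th c a ≤ σ.th1 c a + σ.D a

variable {P : Par A} {ℓ : ℕ → C → A → ℝ} {ν : C → ℝ} {Λ : ℝ}

lemma Hyp.Lpos (H : Hyp P ℓ ν Λ) : (1:ℝ) ≤ P.L := by exact_mod_cast H.L1

lemma Hyp.γpos (H : Hyp P ℓ ν Λ) : 0 < P.γ := by
  have := H.Lpos; have := H.γL
  by_contra h
  nlinarith

lemma Hyp.etaL (H : Hyp P ℓ ν Λ) : P.eta * (30 * P.L) = 1 := by
  have := H.Lpos
  unfold Par.eta; field_simp

lemma Hyp.etapos (H : Hyp P ℓ ν Λ) : 0 < P.eta := by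
  have := H.Lpos
  unfold Par.eta; positivity

lemma pol_pos (θ : C → A → ℝ) (c : C) (a : A) : 0 < pol P θ c a := smx_pos _ _ _

lemma pol_sum (θ : C → A → ℝ) (c : C) : ∑ a, pol P θ c a = 1 := smx_sum _ _

lemma bar_pos (H : Hyp P ℓ ν Λ) (θ : C → A → ℝ) (a : A) : 0 < bar P ν θ a := by
  unfold bar
  apply lt_of_le_of_ne (Finset.sum_nonneg fun c _ => mul_nonneg (H.ν0 c) (pol_pos θ c a).le)
  intro h
  have h2 := (Finset.sum_eq_zero_iff_of_nonneg
    (fun c _ => mul_nonneg (H.ν0 c) (pol_pos (P := P) θ c a).le)).1 h.symm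
  have : ∑ c, ν c = 0 := Finset.sum_eq_zero fun c hc => by
    rcases mul_eq_zero.1 (h2 c hc) with h | h
    · exact h
    · exact absurd h (pol_pos θ c a).ne'
  linarith [H.ν1]

lemma bar_sum (H : Hyp P ℓ ν Λ) (θ : C → A → ℝ) : ∑ a, bar P ν θ a = 1 := by
  unfold bar
  rw [Finset.sum_comm]
  simp only [← Finset.mul_sum, pol_sum, mul_one, H.ν1]

lemma nin_nonneg {q : A → ℝ} (hq : ∀ a, 0 ≤ q a) (a : A) : 0 ≤ nin P.E q a :=
  Finset.sum_nonneg fun b _ => by split_ifs <;> [exact hq b; exact le_rfl]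

lemma nin_le {q : A → ℝ} (hq : ∀ a, 0 ≤ q a) (h1 : ∑ a, q a = 1) (a : A) : nin P.E q a ≤ 1 := by
  rw [← h1]
  exact Finset.sum_le_sum fun b _ => by split_ifs <;> [exact le_rfl; exact hq b]

lemma fq_pos (H : Hyp P ℓ ν Λ) (θ : C → A → ℝ) (a : A) : 0 < fq P ν θ a := by
  refine (bar_pos H θ a).trans_le ?_
  have := Finset.single_le_sum (f := fun b => if P.E b a then bar P ν θ b else 0)
    (fun b _ => by split_ifs <;> [exact (bar_pos H θ b).le; exact le_rfl])
    (Finset.mem_univ a)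
  simpa [H.refl a, fq, nin] using this

lemma fq_le (H : Hyp P ℓ ν Λ) (θ : C → A → ℝ) (a : A) : fq P ν θ a ≤ 1 :=
  nin_le (fun b => (bar_pos H θ b).le) (bar_sum H θ) a

lemma fq_eq (θ : C → A → ℝ) (a : A) : ∑ c, ν c * nin P.E (pol P θ c) a = fq P ν θ a := by
  unfold fq nin bar
  simp only [Finset.mul_sum]
  rw [Finset.sum_comm]
  refine Finset.sum_congr rfl fun b _ => ?_
  split_ifs
  · rfl
  · simp

lemma ker_nonneg (H : Hyp P ℓ ν Λ) (σ : St C A) (x : C × A) : 0 ≤ ker P ν σ x :=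
  mul_nonneg (H.ν0 _) (pol_pos _ _ _).le

lemma ker_sum (H : Hyp P ℓ ν Λ) (σ : St C A) : ∑ x, ker P ν σ x = 1 := by
  rw [Fintype.sum_prod_type]
  simp only [ker, ← Finset.mul_sum, pol_sum, mul_one, H.ν1]

lemma ratio (H : Hyp P ℓ ν Λ) {σ : St C A} (I : InvB P σ) (c : C) (a : A) :
    pol P σ.th0 c a ≤ 3 * pol P σ.th c a ∧ pol P σ.th c a ≤ 3 * pol P σ.th0 c a := by
  have he := H.etaL
  have hp := H.etapos
  apply smx_ratio
  · intro b
    exact mul_nonneg hp.le (by linarith [I.t01 c b, I.t1 c b])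
  · intro b
    rw [← he]
    exact mul_le_mul_of_nonneg_left (by linarith [I.t10 c b, I.t2 c b, I.D1 b]) hp.le

lemma uu_nonneg (H : Hyp P ℓ ν Λ) {σ : St C A} (I : InvB P σ) (x : C × A) (a : A) :
    0 ≤ uu P σ x a := by
  unfold uu
  split_ifs
  · have := pol_pos (P := P) σ.th0 x.1 x.2
    have := pol_pos (P := P) σ.th x.1 x.2
    have := I.g0 a
    have := H.γpos
    positivity
  · exact le_rfl

lemma uu_le (H : Hyp P ℓ ν Λ) {σ : St C A} (I : InvB P σ) (x : C × A) (a : A) :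
    uu P σ x a ≤ 3 / (σ.g a + P.γ) := by
  have := I.g0 a
  have := H.γpos
  unfold uu
  split_ifs
  · have h1 := pol_pos (P := P) σ.th x.1 x.2
    gcongr
    rw [div_le_iff₀ h1]
    exact (ratio H I x.1 x.2).1
  · positivity

lemma uu_le' (H : Hyp P ℓ ν Λ) {σ : St C A} (I : InvB P σ) (x : C × A) (a : A) :
    σ.D a + uu P σ x a ≤ 15 * P.L := by
  by_cases h : σ.D a < 12 * P.L
  · have h1 := uu_le H I x a
    have h2 : 3 / (σ.g a + P.γ) ≤ 3 * P.L := by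
      have := I.g0 a
      have := H.γpos
      have := H.γL
      have := H.Lpos
      rw [div_le_iff₀ (by positivity)]
      nlinarith
    linarith
  · have : uu P σ x a = 0 := by unfold uu; simp [h]
    linarith [I.D1 a]

lemma InvB_inner (H : Hyp P ℓ ν Λ) {σ : St C A} (I : InvB P σ) (x : C × A) :
    InvB P (inner' P ℓ σ x) where
  acc0 := fun a => add_nonneg (I.acc0 a) (nin_nonneg (fun b => (pol_pos _ _ b).le) a)
  g0 := I.g0
  D0 := fun a => add_nonneg (I.D0 a) (uu_nonneg H I x a)
  D1 := fun a => uu_le' H I x a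
  t01 := I.t01
  t10 := I.t10
  t1 := fun c a => by
    have := mul_nonneg (uu_nonneg H I x a) (H.l0 σ.n c a)
    have := I.t1 c a
    simp only [inner']; linarith
  t2 := fun c a => by
    have := mul_le_mul_of_nonneg_left (H.l1 σ.n c a) (uu_nonneg H I x a)
    have := I.t2 c a
    simp only [inner']; linarith

lemma InvB_bd {σ : St C A} (I : InvB P σ) : InvB P (bd P σ) where
  acc0 := fun a => le_rfl
  g0 := fun a => div_nonneg (I.acc0 a) (Nat.cast_nonneg _)
  D0 := fun a => le_rfl
  D1 := fun a => by simp only [bd]; positivity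
  t01 := I.t1
  t10 := fun c a => by simp only [bd]; linarith [I.t2 c a, I.D1 a]
  t1 := fun c a => le_rfl
  t2 := fun c a => by simp [bd]

lemma InvB_init : InvB P (init P : St C A) := by
  constructor <;> intros <;> simp only [init] <;> nlinarith [Nat.cast_nonneg (α := ℝ) P.L]

lemma ker_W (σ : St C A) (a : A) :
    ∑ x : C × A, ker P ν σ x * (if P.E x.2 a then pol P σ.th0 x.1 x.2 / pol P σ.th x.1 x.2 else 0)
      = fq P ν σ.th0 a := by
  rw [Fintype.sum_prod_type, ← fq_eq]
  refine Finset.sum_congr rfl fun c _ => ?_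
  unfold nin
  rw [Finset.mul_sum]
  refine Finset.sum_congr rfl fun b _ => ?_
  have := (pol_pos (P := P) σ.th c b).ne'
  simp only [ker]
  split_ifs
  · field_simp
  · simp

noncomputable def ub (P : Par A) (ν : C → ℝ) (σ : St C A) (a : A) : ℝ :=
  if σ.D a < 12 * P.L then rr P ν σ.th0 σ.g a else 0

noncomputable def vb (P : Par A) (ν : C → ℝ) (σ : St C A) (a : A) : ℝ :=
  if σ.D a < 12 * P.L then 3 * (fq P ν σ.th0 a / (σ.g a + P.γ) ^ 2) else 0

lemma ker_u (σ : St C A) (a : A) : ∑ x, ker P ν σ x * uu P σ x a = ub P ν σ a := by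
  unfold uu ub
  split_ifs with h
  · unfold rr
    rw [← ker_W, Finset.sum_div]
    refine Finset.sum_congr rfl fun x _ => ?_
    simp only [h, and_true]
    split_ifs
    · ring
    · simp
  · simp [h]

lemma ker_u2 (H : Hyp P ℓ ν Λ) {σ : St C A} (I : InvB P σ) (a : A) :
    ∑ x, ker P ν σ x * uu P σ x a ^ 2 ≤ vb P ν σ a := by
  have hg := I.g0 a
  have hγ := H.γpos
  have h0 : 0 < σ.g a + P.γ := by positivity
  have h1 : ∑ x, ker P ν σ x * uu P σ x a ^ 2 ≤
      3 / (σ.g a + P.γ) * ∑ x, ker P ν σ x * uu P σ x a := by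
    rw [Finset.mul_sum]
    refine Finset.sum_le_sum fun x _ => ?_
    have a1 := uu_le H I x a
    have a2 := uu_nonneg H I x a
    have a3 := ker_nonneg H σ x
    have : uu P σ x a ^ 2 ≤ 3 / (σ.g a + P.γ) * uu P σ x a := by
      rw [pow_two]; exact mul_le_mul_of_nonneg_right a1 a2
    calc ker P ν σ x * uu P σ x a ^ 2 ≤ ker P ν σ x * (3 / (σ.g a + P.γ) * uu P σ x a) :=
          mul_le_mul_of_nonneg_left this a3
      _ = _ := by ring
  refine h1.trans (le_of_eq ?_)
  rw [ker_u]
  unfold ub vb rr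
  split_ifs
  · field_simp
  · simp

/-- inner chain facts -/
structure PI (P : Par A) (σ1 : St C A) (i : ℕ) (σ : St C A) : Prop where
  I : InvB P σ
  n : σ.n = σ1.n + i
  th0 : σ.th0 = σ1.th0
  th1 : σ.th1 = σ1.th1
  g : σ.g = σ1.g

lemma PI_zero {σ1 : St C A} (I : InvB P σ1) : PI P σ1 0 σ1 := ⟨I, rfl, rfl, rfl, rfl⟩

lemma PI_step (H : Hyp P ℓ ν Λ) (σ1 : St C A) (i : ℕ) (σ : St C A) (x : C × A)
    (h : PI P σ1 i σ) : PI P σ1 (i+1) (inner' P ℓ σ x) :=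
  ⟨InvB_inner H h.I x, by simp only [inner', h.n]; ring, h.th0, h.th1, h.g⟩

noncomputable abbrev EI (P : Par A) (ℓ : ℕ → C → A → ℝ) (ν : C → ℝ) :=
  Ex (ker P ν) (inner' P ℓ)

lemma EI_mono (H : Hyp P ℓ ν Λ) {σ1 : St C A} (I : InvB P σ1) (j : ℕ) {F G : St C A → ℝ}
    (h : ∀ σ, PI P σ1 j σ → F σ ≤ G σ) : EI P ℓ ν j σ1 F ≤ EI P ℓ ν j σ1 G :=
  Ex_mono (ker_nonneg H) (PI P σ1) (PI_step H σ1) j 0 σ1 (PI_zero I)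
    (by simpa using h)

lemma EI_congr (H : Hyp P ℓ ν Λ) {σ1 : St C A} (I : InvB P σ1) (j : ℕ) {F G : St C A → ℝ}
    (h : ∀ σ, PI P σ1 j σ → F σ = G σ) : EI P ℓ ν j σ1 F = EI P ℓ ν j σ1 G :=
  Ex_congr (ker_nonneg H) (PI P σ1) (PI_step H σ1) j 0 σ1 (PI_zero I)
    (by simpa using h)

lemma EI_acc (σ : St C A) (j : ℕ) (φ : ℝ → ℝ) (s0 : ℝ) (a : A) :
    EI P ℓ ν j σ (fun σ' => φ (s0 + σ'.acc a)) =
      Ait ν (fun c => nin P.E (pol P σ.th1 c) a) j φ (s0 + σ.acc a) := by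
  induction j generalizing σ with
  | zero => rfl
  | succ j ih =>
    simp only [EI, Ex, Ait] at *
    simp only [ih]
    rw [Fintype.sum_prod_type]
    refine Finset.sum_congr rfl fun c _ => ?_
    simp only [inner', ker]
    simp only [← add_assoc]
    rw [← Finset.sum_mul, ← Finset.mul_sum, pol_sum, mul_one]

end Chain

section Epoch
variable {C A : Type} [Fintype C] [Fintype A] [DecidableEq A] [Nonempty A]
variable {P : Par A} {ℓ : ℕ → C → A → ℝ} {ν : C → ℝ} {Λ : ℝ}

lemma Hyp.kl (H : Hyp P ℓ ν Λ) (θ : C → A → ℝ) (a : A) :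
    1 / (P.L : ℝ) ≤ 2 * (P.γ / (fq P ν θ a + P.γ)) := by
  have h1 := H.Lpos
  have h2 := H.γpos
  have h3 := H.γL
  have h4 := fq_pos H θ a
  have h5 := fq_le H θ a
  rw [← mul_div_assoc, div_le_div_iff₀ (by positivity) (by positivity)]
  nlinarith

lemma ep_r (H : Hyp P ℓ ν Λ) {σ : St C A} (h0 : σ.acc = fun _ => 0) (a : A) :
    EI P ℓ ν P.L σ (fun σ' => rr P ν σ.th1 (fun b => σ'.acc b / P.L) a) ≤ 1 ∧
    1 - P.γ / (fq P ν σ.th1 a + P.γ) ≤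
      EI P ℓ ν P.L σ (fun σ' => rr P ν σ.th1 (fun b => σ'.acc b / P.L) a) := by
  have h1 := H.Lpos
  have h2 := H.γpos
  have h3 := H.γL
  have h4 := fq_pos H σ.th1 a
  have e : (fun σ' : St C A => rr P ν σ.th1 (fun b => σ'.acc b / P.L) a) =
      fun σ' => (P.L * fq P ν σ.th1 a) * (fun u => 1 / u) (P.γ * P.L + σ'.acc a) := by
    funext σ'
    unfold rr
    have : σ'.acc a / P.L + P.γ = (P.γ * P.L + σ'.acc a) / P.L := by field_simp; ring
    simp only [this]
    rw [div_div_eq_mul_div]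
    ring
  rw [e]
  rw [EI, Ex_smul]
  have e2 := EI_acc (P := P) (ℓ := ℓ) (ν := ν) σ P.L (fun u => 1 / u) (P.γ * P.L) a
  rw [EI] at e2
  rw [e2, h0, add_zero]
  have hx0 : ∀ c, 0 ≤ nin P.E (pol P σ.th1 c) a := fun c => nin_nonneg (fun b => (pol_pos _ _ _).le) a
  have hx1 : ∀ c, nin P.E (pol P σ.th1 c) a ≤ 1 :=
    fun c => nin_le (fun b => (pol_pos _ _ _).le) (pol_sum _ _) a
  have k1 := Ait_inv H.ν0 H.ν1 hx0 hx1 P.L (P.γ * P.L) (by linarith)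
  have k2 := Ait_inv_lower H.ν0 H.ν1 hx0 P.L (P.γ * P.L) (by linarith)
  rw [fq_eq] at k1 k2
  refine ⟨k1, ?_⟩
  calc 1 - P.γ / (fq P ν σ.th1 a + P.γ)
      = P.L * fq P ν σ.th1 a * (1 / (P.γ * P.L + P.L * fq P ν σ.th1 a)) := by
        field_simp; ring
    _ ≤ _ := by gcongr

lemma ep_r2 (H : Hyp P ℓ ν Λ) {σ : St C A} (h0 : σ.acc = fun _ => 0) (a : A) :
    EI P ℓ ν P.L σ (fun σ' => rr P ν σ.th1 (fun b => σ'.acc b / P.L) a ^ 2) ≤ 1 := by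
  have h1 := H.Lpos
  have h2 := H.γpos
  have h3 := H.γL
  have h4 := fq_pos H σ.th1 a
  have e : (fun σ' : St C A => rr P ν σ.th1 (fun b => σ'.acc b / P.L) a ^ 2) =
      fun σ' => (P.L * fq P ν σ.th1 a) ^ 2 * (fun u => (1 / u) ^ 2) (P.γ * P.L + σ'.acc a) := by
    funext σ'
    unfold rr
    have : σ'.acc a / P.L + P.γ = (P.γ * P.L + σ'.acc a) / P.L := by field_simp; ring
    simp only [this]
    rw [div_div_eq_mul_div]
    ring
  rw [e]
  rw [EI, Ex_smul]
  have e2 := EI_acc (P := P) (ℓ := ℓ) (ν := ν) σ P.L (fun u => (1 / u) ^ 2) (P.γ * P.L) a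
  rw [EI] at e2
  rw [e2, h0, add_zero]
  have hx0 : ∀ c, 0 ≤ nin P.E (pol P σ.th1 c) a := fun c => nin_nonneg (fun b => (pol_pos _ _ _).le) a
  have hx1 : ∀ c, nin P.E (pol P σ.th1 c) a ≤ 1 :=
    fun c => nin_le (fun b => (pol_pos _ _ _).le) (pol_sum _ _) a
  have k1 := Ait_inv2 H.ν0 H.ν1 hx0 hx1 P.L (P.γ * P.L) (by linarith)
  rw [fq_eq] at k1
  exact k1

lemma ep_cp (H : Hyp P ℓ ν Λ) {σ : St C A} (h0 : σ.acc = fun _ => 0) (a : A) :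
    EI P ℓ ν P.L σ (fun σ' => cp P ν σ.th1 (fun b => σ'.acc b / P.L) a) ≤ 1 / P.L := by
  have h1 := H.Lpos
  have e : (fun σ' : St C A => cp P ν σ.th1 (fun b => σ'.acc b / P.L) a) =
      fun σ' => Real.exp (2 / 3 * P.L * fq P ν σ.th1 a) *
        (fun u => Real.exp (-4 * u)) (P.γ * P.L + σ'.acc a) := by
    funext σ'
    unfold cp
    simp only []
    rw [← Real.exp_add]
    congr 1
    field_simp
    ring
  rw [e]
  rw [EI, Ex_smul]
  have e2 := EI_acc (P := P) (ℓ := ℓ) (ν := ν) σ P.L (fun u => Real.exp (-4 * u)) (P.γ * P.L) a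
  rw [EI] at e2
  rw [e2, h0, add_zero]
  have hx0 : ∀ c, 0 ≤ nin P.E (pol P σ.th1 c) a := fun c => nin_nonneg (fun b => (pol_pos _ _ _).le) a
  have hx1 : ∀ c, nin P.E (pol P σ.th1 c) a ≤ 1 :=
    fun c => nin_le (fun b => (pol_pos _ _ _).le) (pol_sum _ _) a
  have k1 := Ait_exp H.ν0 H.ν1 hx0 hx1 P.L (P.γ * P.L)
  rw [fq_eq] at k1
  refine le_trans ?_ H.ecap
  calc _ ≤ Real.exp (2 / 3 * P.L * fq P ν σ.th1 a) *
      Real.exp (-4 * (P.γ * P.L) - (2/3) * P.L * fq P ν σ.th1 a) := by gcongr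
    _ = _ := by rw [← Real.exp_add]; congr 1; ring

lemma ep_v (H : Hyp P ℓ ν Λ) {σ : St C A} (I : InvB P σ) (h0 : σ.acc = fun _ => 0) (a : A) :
    EI P ℓ ν P.L σ (fun σ' => fq P ν σ.th1 a / (σ'.acc a / P.L + P.γ) ^ 2)
      ≤ 2 / (fq P ν σ.th1 a + P.γ) := by
  have h1 := H.Lpos
  have h2 := H.γpos
  have h4 := fq_pos H σ.th1 a
  set f := fq P ν σ.th1 a with hf
  rcases le_total P.γ f with h | h
  · have e : (fun σ' : St C A => f / (σ'.acc a / P.L + P.γ) ^ 2) =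
      fun σ' => (1 / f) * rr P ν σ.th1 (fun b => σ'.acc b / P.L) a ^ 2 := by
      funext σ'
      unfold rr
      rw [← hf]
      field_simp
    rw [e, EI, Ex_smul]
    have := ep_r2 H h0 a
    rw [EI] at this
    calc _ ≤ 1 / f * 1 := by gcongr
      _ ≤ _ := by
        rw [mul_one, div_le_div_iff₀ h4 (by positivity)]; linarith
  · have : EI P ℓ ν P.L σ (fun σ' => f / (σ'.acc a / P.L + P.γ) ^ 2) ≤
        EI P ℓ ν P.L σ (fun σ' => 2 / (f + P.γ)) := by
      refine EI_mono H I _ fun σ' h' => ?_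
      have h5 := h'.I.acc0 a
      have h6 : P.γ ≤ σ'.acc a / P.L + P.γ := by
        have : 0 ≤ σ'.acc a / P.L := by positivity
        linarith
      calc f / (σ'.acc a / P.L + P.γ) ^ 2 ≤ f / P.γ ^ 2 := by gcongr
        _ ≤ _ := by
          rw [div_le_div_iff₀ (by positivity) (by positivity)]
          nlinarith
    refine this.trans ?_
    rw [EI, Ex_const (ker_sum H)]

lemma ep_Q (H : Hyp P ℓ ν Λ) {σ : St C A} (I : InvB P σ) (h0 : σ.acc = fun _ => 0) (a : A) :
    EI P ℓ ν P.L σ (fun σ' => QQ P ν σ.th1 (fun b => σ'.acc b / P.L) a)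
      ≤ 8 * (P.γ / (fq P ν σ.th1 a + P.γ)) := by
  have h1 := H.Lpos
  have h2 := H.γpos
  have h3 := H.γL
  have h4 := fq_pos H σ.th1 a
  obtain ⟨a1, a2⟩ := ep_r H h0 a
  have a3 := ep_r2 H h0 a
  have a4 := ep_cp H h0 a
  have a5 := ep_v H I h0 a
  have a6 := H.kl σ.th1 a
  have e : (fun σ' : St C A => QQ P ν σ.th1 (fun b => σ'.acc b / P.L) a) =
     fun σ' => (((1 + 1 / (P.L:ℝ)) + rr P ν σ.th1 (fun b => σ'.acc b / P.L) a ^ 2) +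
      (-2) * rr P ν σ.th1 (fun b => σ'.acc b / P.L) a) +
      ((1 / (P.L:ℝ)) * (fq P ν σ.th1 a / (σ'.acc a / P.L + P.γ) ^ 2) +
      cp P ν σ.th1 (fun b => σ'.acc b / P.L) a) := by
    funext σ'
    unfold QQ
    ring
  rw [e]
  simp only [EI] at *
  simp only [Ex_add, Ex_const (ker_sum H), Ex_smul]
  set f := fq P ν σ.th1 a with hf
  have b1 : 1 / (P.L:ℝ) * Ex (ker P ν) (inner' P ℓ) P.L σ
      (fun σ' => f / (σ'.acc a / P.L + P.γ) ^ 2) ≤ 2 * (P.γ / (f + P.γ)) := by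
    calc _ ≤ 1 / (P.L:ℝ) * (2 / (f + P.γ)) := by gcongr
      _ ≤ P.γ * (2 / (f + P.γ)) := by
        gcongr
        rw [div_le_iff₀ (by positivity)]; linarith
      _ = _ := by ring
  linarith

lemma ep_bar (H : Hyp P ℓ ν Λ) (θ : C → A → ℝ) :
    ∑ a, bar P ν θ a / (fq P ν θ a + P.γ) ≤ Λ :=
  H.gr _ (bar_pos H θ) (bar_sum H θ)

lemma QQ_nonneg (H : Hyp P ℓ ν Λ) (θ : C → A → ℝ) (g : A → ℝ) (a : A) : 0 ≤ QQ P ν θ g a := by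
  have := fq_pos H θ a
  unfold QQ cp
  positivity

/-- exponential tail of the cap -/
lemma in_cap (H : Hyp P ℓ ν Λ) {σ : St C A} (I : InvB P σ) (hD : σ.D = fun _ => 0)
    (j : ℕ) (hj : j ≤ P.L) (a : A) :
    EI P ℓ ν j σ (fun σ' => if σ'.D a < 12 * P.L then 0 else 1) ≤ cp P ν σ.th0 σ.g a := by
  have h1 := H.Lpos
  have h2 := H.γpos
  have h4 := fq_pos H σ.th0 a
  have hg := I.g0 a
  set f := fq P ν σ.th0 a with hf
  set lam := (σ.g a + P.γ) / 3 with hlam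
  have hl0 : 0 < lam := by positivity
  have main : ∀ i, EI P ℓ ν i σ (fun σ' => Real.exp (lam * σ'.D a)) ≤ Real.exp (2/3 * i * f) := by
    intro i
    induction i with
    | zero => simp [EI, Ex, hD]
    | succ i ih =>
      rw [EI, Ex_succ']
      have : EI P ℓ ν i σ (fun s' => ∑ x, ker P ν s' x * Real.exp (lam * (inner' P ℓ s' x).D a)) ≤
          EI P ℓ ν i σ (fun σ' => Real.exp (2/3 * f) * Real.exp (lam * σ'.D a)) := by
        refine EI_mono H I _ fun s h => ?_
        have hb : ub P ν s a ≤ f / (σ.g a + P.γ) := by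
          unfold ub rr
          rw [h.th0, h.g]
          split_ifs
          · exact le_rfl
          · positivity
        calc ∑ x, ker P ν s x * Real.exp (lam * (inner' P ℓ s x).D a)
            ≤ ∑ x, ker P ν s x * (Real.exp (lam * s.D a) * (1 + 2 * (lam * uu P s x a))) := by
              refine Finset.sum_le_sum fun x _ => mul_le_mul_of_nonneg_left ?_ (ker_nonneg H s x)
              simp only [inner', mul_add, Real.exp_add]
              have u0 := uu_nonneg H h.I x a
              have u1 := uu_le H h.I x a
              rw [h.g] at u1
              have u2 : lam * uu P s x a ≤ 1 := by
                calc _ ≤ lam * (3 / (σ.g a + P.γ)) := by gcongr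
                  _ = 1 := by rw [hlam]; field_simp
              have u3 : 0 ≤ lam * uu P s x a := by positivity
              have := Real.abs_exp_sub_one_le (x := lam * uu P s x a) (by rwa [abs_of_nonneg u3])
              rw [abs_of_nonneg u3] at this
              have := (abs_le.1 this).2
              have e0 := Real.exp_pos (lam * s.D a)
              have := mul_le_mul_of_nonneg_left this e0.le
              linarith
          _ = Real.exp (lam * s.D a) * (∑ x, ker P ν s x + 2 * lam * ∑ x, ker P ν s x * uu P s x a) := by
              rw [mul_add, Finset.mul_sum, Finset.mul_sum, Finset.mul_sum, ← Finset.sum_add_distrib]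
              refine Finset.sum_congr rfl fun x _ => by ring
          _ = Real.exp (lam * s.D a) * (1 + 2 * lam * ub P ν s a) := by
              rw [ker_sum H, ker_u]
          _ ≤ Real.exp (lam * s.D a) * Real.exp (2/3 * f) := by
              gcongr
              have : 2 * lam * ub P ν s a ≤ 2/3 * f := by
                calc _ ≤ 2 * lam * (f / (σ.g a + P.γ)) := by gcongr
                  _ = _ := by rw [hlam]; field_simp
              linarith [Real.add_one_le_exp (2/3 * f)]
          _ = _ := mul_comm _ _
      refine this.trans ?_
      rw [EI, Ex_smul]
      calc _ ≤ Real.exp (2/3 * f) * Real.exp (2/3 * i * f) := by gcongr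
        _ = _ := by rw [← Real.exp_add]; congr 1; push_cast; ring
  have k1 : EI P ℓ ν j σ (fun σ' => if σ'.D a < 12 * P.L then 0 else 1) ≤
      EI P ℓ ν j σ (fun σ' => Real.exp (-(lam * (12 * P.L))) * Real.exp (lam * σ'.D a)) := by
    refine EI_mono H I _ fun s h => ?_
    split_ifs with hh
    · positivity
    · rw [← Real.exp_add]
      apply Real.one_le_exp
      push Not at hh
      nlinarith
  refine k1.trans ?_
  rw [EI, Ex_smul]
  calc _ ≤ Real.exp (-(lam * (12 * P.L))) * Real.exp (2/3 * j * f) := by gcongr; exact main j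
    _ = Real.exp (2/3 * j * f + -(lam * (12 * P.L))) := by rw [← Real.exp_add, add_comm]
    _ ≤ _ := by
      unfold cp
      apply Real.exp_le_exp.2
      have : (j:ℝ) ≤ P.L := by exact_mod_cast hj
      have := mul_le_mul_of_nonneg_right this h4.le
      rw [hlam]
      linarith

end Epoch

section Dev
variable {C A : Type} [Fintype C] [Fintype A] [DecidableEq A] [Nonempty A]
variable {P : Par A} {ℓ : ℕ → C → A → ℝ} {ν : C → ℝ} {Λ : ℝ}

noncomputable def YY (ℓ : ℕ → C → A → ℝ) (σ1 : St C A) (j : ℕ) (c : C) (a : A) (σ : St C A) : ℝ :=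
  (σ.th c a - σ1.th c a) - ∑ i ∈ Finset.range j, ℓ (σ1.n + i) c a

lemma ub_sq (σ : St C A) (a : A) :
    (ub P ν σ a - 1) ^ 2 ≤ (1 - rr P ν σ.th0 σ.g a) ^ 2 + (if σ.D a < 12 * P.L then 0 else 1) := by
  unfold ub
  split_ifs
  · nlinarith
  · nlinarith [sq_nonneg (1 - rr P ν σ.th0 σ.g a)]

lemma dev_step (H : Hyp P ℓ ν Λ) {σ1 : St C A} (j : ℕ) (c : C) (a : A)
    (s : St C A) (h : PI P σ1 j s) :
    ∑ x, ker P ν s x * YY ℓ σ1 (j+1) c a (inner' P ℓ s x) ^ 2 ≤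
      (1 + 1 / (P.L:ℝ)) * YY ℓ σ1 j c a s ^ 2 + ((P.L:ℝ) * (if s.D a < 12 * P.L then 0 else 1) +
        (P.L * (1 - rr P ν σ1.th0 σ1.g a) ^ 2 + 3 * (fq P ν σ1.th0 a / (σ1.g a + P.γ) ^ 2) + 1)) := by
  have h1 := H.Lpos
  have l0 := H.l0 s.n c a
  have l1 := H.l1 s.n c a
  have hf := fq_pos H σ1.th0 a
  have hγ := H.γpos
  have hg := h.I.g0 a
  have hu2 := ker_u2 H h.I a
  have hub : 0 ≤ ub P ν s a := by
    rw [← ker_u]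
    exact Finset.sum_nonneg fun x _ => mul_nonneg (ker_nonneg H s x) (uu_nonneg H h.I x a)
  have hv : vb P ν s a ≤ 3 * (fq P ν σ1.th0 a / (σ1.g a + P.γ) ^ 2) := by
    unfold vb
    rw [h.th0, h.g]
    split_ifs
    · exact le_rfl
    · positivity
  set Y := YY ℓ σ1 j c a s with hY
  set l := ℓ s.n c a with hl
  have e1 : ∀ x, YY ℓ σ1 (j+1) c a (inner' P ℓ s x) = Y + l * (uu P s x a - 1) := by
    intro x
    rw [hY, hl]
    simp only [YY, inner', Finset.sum_range_succ, h.n]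
    ring
  have e2 : ∑ x, ker P ν s x * YY ℓ σ1 (j+1) c a (inner' P ℓ s x) ^ 2 =
      (Y ^ 2 - 2 * Y * l + l ^ 2) * ∑ x, ker P ν s x + (2 * Y * l - 2 * l ^ 2) *
        ∑ x, ker P ν s x * uu P s x a + l ^ 2 * ∑ x, ker P ν s x * uu P s x a ^ 2 := by
    simp only [e1, Finset.mul_sum]
    rw [← Finset.sum_add_distrib, ← Finset.sum_add_distrib]
    refine Finset.sum_congr rfl fun x _ => by ring
  rw [e2, ker_sum H, ker_u]
  have hs := ub_sq (P := P) (ν := ν) s a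
  rw [h.th0, h.g] at hs
  set b := ub P ν s a with hb
  set cap : ℝ := if s.D a < 12 * P.L then 0 else 1
  set V := ∑ x, ker P ν s x * uu P s x a ^ 2
  have hV : 0 ≤ V := Finset.sum_nonneg fun x _ => mul_nonneg (ker_nonneg H s x) (sq_nonneg _)
  set R := (1 - rr P ν σ1.th0 σ1.g a) ^ 2
  set F := 3 * (fq P ν σ1.th0 a / (σ1.g a + P.γ) ^ 2)
  have ll : l ^ 2 ≤ 1 := by nlinarith
  have q1 : 2 * Y * (l * (b - 1)) ≤ (1 / (P.L:ℝ)) * Y ^ 2 + P.L * (l * (b - 1)) ^ 2 := by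
    have : 0 ≤ (1 / (P.L:ℝ)) * (Y - P.L * (l * (b - 1))) ^ 2 := by positivity
    have e : (1 / (P.L:ℝ)) * (Y - P.L * (l * (b - 1))) ^ 2 =
      (1 / (P.L:ℝ)) * Y ^ 2 + P.L * (l * (b - 1)) ^ 2 - 2 * Y * (l * (b - 1)) := by
      field_simp
      ring
    linarith
  have q2 : P.L * (l * (b - 1)) ^ 2 ≤ P.L * (R + cap) := by
    gcongr
    rw [mul_pow]
    nlinarith [sq_nonneg (b-1)]
  have q3 : l ^ 2 * V ≤ F := by nlinarith
  have q4 : 0 ≤ l ^ 2 * b := by positivity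
  nlinarith

lemma dev_sq (H : Hyp P ℓ ν Λ) {σ1 : St C A} (I : InvB P σ1) (hD : σ1.D = fun _ => 0)
    (j : ℕ) (hj : j ≤ P.L) (c : C) (a : A) :
    EI P ℓ ν j σ1 (fun s => YY ℓ σ1 j c a s ^ 2) ≤
      3 * P.L * QQ P ν σ1.th0 σ1.g a * j * (1 + 1 / (P.L:ℝ)) ^ j := by
  have h1 := H.Lpos
  have hQ := QQ_nonneg H σ1.th0 σ1.g a
  induction j with
  | zero => simp [EI, Ex, YY]
  | succ j ih =>
    specialize ih (by omega)
    have hc := in_cap H I hD j (by omega) a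
    rw [EI, Ex_succ']
    have := EI_mono H I j (dev_step H j c a)
    refine this.trans ?_
    simp only [EI] at *
    simp only [Ex_add, Ex_smul, Ex_const (ker_sum H)]
    have hf := fq_pos H σ1.th0 a
    have hγ := H.γpos
    have hg := I.g0 a
    have hF : 0 ≤ fq P ν σ1.th0 a / (σ1.g a + P.γ) ^ 2 := by positivity
    have hcp : 0 ≤ cp P ν σ1.th0 σ1.g a := (Real.exp_pos _).le
    have eQ : P.L * QQ P ν σ1.th0 σ1.g a = P.L * (1 - rr P ν σ1.th0 σ1.g a) ^ 2 +
        fq P ν σ1.th0 a / (σ1.g a + P.γ) ^ 2 + 1 + P.L * cp P ν σ1.th0 σ1.g a := by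
      unfold QQ; field_simp
    set Q := QQ P ν σ1.th0 σ1.g a
    set x := (1 + 1 / (P.L:ℝ)) with hx
    have hx1 : 1 ≤ x := by rw [hx]; have : 0 ≤ 1 / (P.L:ℝ) := by positivity
                           linarith
    have hxj : 1 ≤ x ^ (j+1) := one_le_pow₀ hx1
    have c1 := mul_le_mul_of_nonneg_left ih (by linarith : 0 ≤ x)
    have c2 := mul_le_mul_of_nonneg_left hc (by linarith : (0:ℝ) ≤ P.L)
    have c3 : 3 * P.L * Q ≤ 3 * P.L * Q * x ^ (j+1) := le_mul_of_one_le_right (by positivity) hxj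
    have c4 : 0 ≤ P.L * (1 - rr P ν σ1.th0 σ1.g a) ^ 2 := by positivity
    have c5 : 0 ≤ P.L * cp P ν σ1.th0 σ1.g a := by positivity
    have e : 3 * P.L * Q * ((j+1:ℕ):ℝ) * x ^ (j+1) =
      x * (3 * P.L * Q * j * x ^ j) + 3 * P.L * Q * x ^ (j+1) := by
      push_cast; ring
    rw [e]
    linarith

lemma dev_fin (H : Hyp P ℓ ν Λ) {σ1 : St C A} (I : InvB P σ1) (hD : σ1.D = fun _ => 0)
    (j : ℕ) (hj : j ≤ P.L) (c : C) (a : A) :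
    EI P ℓ ν j σ1 (fun s => P.eta ^ 2 * YY ℓ σ1 j c a s ^ 2) ≤
      QQ P ν σ1.th0 σ1.g a / 100 := by
  have h1 := H.Lpos
  have hQ := QQ_nonneg H σ1.th0 σ1.g a
  have := dev_sq H I hD j hj c a
  rw [EI, Ex_smul]
  rw [EI] at this
  have hjL : (j:ℝ) ≤ P.L := by exact_mod_cast hj
  have hx : (1 + 1 / (P.L:ℝ)) ^ j ≤ 3 := by
    calc (1 + 1 / (P.L:ℝ)) ^ j ≤ (Real.exp (1 / P.L)) ^ j := by
          gcongr; linarith [Real.add_one_le_exp (1 / (P.L:ℝ))]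
      _ = Real.exp (j * (1 / P.L)) := by rw [Real.exp_nat_mul]
      _ ≤ Real.exp 1 := by
          apply Real.exp_le_exp.2
          rw [mul_one_div, div_le_one (by positivity)]; exact hjL
      _ ≤ 3 := by linarith [Real.exp_one_lt_d9]
  have he : P.eta = 1 / (30 * P.L) := rfl
  calc _ ≤ P.eta ^ 2 * (3 * P.L * QQ P ν σ1.th0 σ1.g a * P.L * 3) := by
        gcongr
        refine this.trans ?_
        gcongr
    _ = _ := by
        rw [he]; field_simp; norm_num; ring

end Dev

section Pot
variable {C A : Type} [Fintype C] [Fintype A] [DecidableEq A] [Nonempty A]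
variable {P : Par A} {ℓ : ℕ → C → A → ℝ} {ν : C → ℝ} {Λ : ℝ}

structure FI (P : Par A) (σ : St C A) : Prop where
  I : InvB P σ
  b0 : σ.n % P.L = 0 → σ.acc = fun _ => 0
  b1 : σ.n % P.L = 0 → σ.th1 = σ.th
  b2 : P.L ≤ σ.n → σ.n % P.L = 0 → σ.D = fun _ => 0
  b3 : σ.n < P.L → ∀ a, 12 * P.L ≤ σ.D a

lemma FI_init : FI P (init P : St C A) where
  I := InvB_init
  b0 := fun _ => rfl
  b1 := fun _ => rfl
  b2 := fun h _ => by
    have : P.L = 0 := by simpa [init] using h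
    funext a
    simp [init, this]
  b3 := fun _ a => le_rfl

lemma FI_step (H : Hyp P ℓ ν Λ) (σ : St C A) (x : C × A) (h : FI P σ) : FI P (full P ℓ σ x) := by
  unfold full
  split_ifs with hn
  · refine ⟨InvB_bd (InvB_inner H h.I x), fun _ => rfl, fun _ => rfl, fun _ _ => rfl, ?_⟩
    intro h2
    simp only [bd, inner'] at h2
    rw [Nat.mod_eq_of_lt h2] at hn
    omega
  · refine ⟨InvB_inner H h.I x, fun h' => absurd h' hn, fun h' => absurd h' hn,
      fun _ h' => absurd h' hn, ?_⟩
    intro h2 a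
    simp only [inner'] at h2 ⊢
    linarith [h.b3 (by omega) a, uu_nonneg H h.I x a]

lemma full_n (σ : St C A) (x : C × A) : (full P ℓ σ x).n = σ.n + 1 := by
  unfold full; split_ifs <;> rfl

lemma full_th (σ : St C A) (x : C × A) :
    (full P ℓ σ x).th = fun c a => σ.th c a + uu P σ x a * ℓ σ.n c a := by
  unfold full; split_ifs <;> rfl

noncomputable def Psi (P : Par A) (ν : C → ℝ) (π : C → A) (σ : St C A) : ℝ :=
  ∑ c, ν c * (1 / P.eta * Real.log (∑ a, Real.exp (-P.eta * σ.th c a)) + σ.th c (π c))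

noncomputable def dd (P : Par A) (ℓ : ℕ → C → A → ℝ) (ν : C → ℝ) (π : C → A) (σ : St C A) : ℝ :=
  ∑ c, ν c * (∑ a, pol P σ.th c a * (ℓ σ.n c a * ub P ν σ a) - ℓ σ.n c (π c) * ub P ν σ (π c)
    - P.eta * ∑ a, pol P σ.th c a * vb P ν σ a)

lemma Psi_nonneg (H : Hyp P ℓ ν Λ) (π : C → A) (σ : St C A) : 0 ≤ Psi P ν π σ := by
  refine Finset.sum_nonneg fun c _ => mul_nonneg (H.ν0 c) ?_
  have he := H.etapos
  have h1 : -P.eta * σ.th c (π c) ≤ Real.log (∑ a, Real.exp (-P.eta * σ.th c a)) := by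
    rw [Real.le_log_iff_exp_le (smx_den _ _)]
    exact Finset.single_le_sum (f := fun a => Real.exp (-P.eta * σ.th c a))
      (fun a _ => (Real.exp_pos _).le) (Finset.mem_univ _)
  have h2 : 1 / P.eta * (-P.eta * σ.th c (π c)) ≤
      1 / P.eta * Real.log (∑ a, Real.exp (-P.eta * σ.th c a)) := by gcongr
  have h3 : 1 / P.eta * (-P.eta * σ.th c (π c)) = - σ.th c (π c) := by field_simp
  linarith

lemma Psi_init (H : Hyp P ℓ ν Λ) (π : C → A) :
    Psi P ν π (init P) = 30 * P.L * Real.log (Fintype.card A) := by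
  have h1 := H.Lpos
  simp only [Psi, init, mul_zero, Real.exp_zero, Finset.sum_const, Finset.card_univ, nsmul_eq_mul,
    mul_one, add_zero, ← Finset.sum_mul, H.ν1, one_mul]
  simp [Par.eta]

lemma pot_c (H : Hyp P ℓ ν Λ) {σ : St C A} (I : InvB P σ) (x : C × A) (c : C) :
    1 / P.eta * Real.log (∑ a, Real.exp (-P.eta * (σ.th c a + uu P σ x a * ℓ σ.n c a))) ≤
    1 / P.eta * Real.log (∑ a, Real.exp (-P.eta * σ.th c a)) -
      ∑ a, pol P σ.th c a * (ℓ σ.n c a * uu P σ x a) +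
      P.eta * ∑ a, pol P σ.th c a * uu P σ x a ^ 2 := by
  have he := H.etapos
  have heL := H.etaL
  have h1 := H.Lpos
  set S := ∑ a, Real.exp (-P.eta * σ.th c a) with hS
  set S' := ∑ a, Real.exp (-P.eta * (σ.th c a + uu P σ x a * ℓ σ.n c a)) with hS'
  have S0 : 0 < S := smx_den _ _
  have S0' : 0 < S' := Finset.sum_pos (fun _ _ => Real.exp_pos _) Finset.univ_nonempty
  have a1 : Real.log S' ≤ Real.log S + (S' / S - 1) := by
    have := Real.log_le_sub_one_of_pos (div_pos S0' S0)
    rw [Real.log_div S0'.ne' S0.ne'] at this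
    linarith
  have a2 : S' / S = ∑ a, pol P σ.th c a * Real.exp (-(P.eta * (uu P σ x a * ℓ σ.n c a))) := by
    rw [hS', Finset.sum_div]
    refine Finset.sum_congr rfl fun a _ => ?_
    rw [mul_add, Real.exp_add]
    simp only [pol, smx, ← hS]
    rw [neg_mul P.eta (uu P σ x a * _)]
    ring
  have a3 : S' / S ≤ ∑ a, (pol P σ.th c a - P.eta * (pol P σ.th c a * (ℓ σ.n c a * uu P σ x a)) +
      P.eta ^ 2 * (pol P σ.th c a * uu P σ x a ^ 2)) := by
    rw [a2]
    refine Finset.sum_le_sum fun a _ => ?_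
    have u0 := uu_nonneg H I x a
    have u1 := uu_le' H I x a
    have u2 := I.D0 a
    have l0 := H.l0 σ.n c a
    have l1 := H.l1 σ.n c a
    have p0 := pol_pos (P := P) σ.th c a
    have y0 : 0 ≤ P.eta * (uu P σ x a * ℓ σ.n c a) := by positivity
    have y2 : P.eta * (uu P σ x a * ℓ σ.n c a) ≤ P.eta * uu P σ x a := by
      gcongr; exact mul_le_of_le_one_right u0 l1
    have y1 : P.eta * (uu P σ x a * ℓ σ.n c a) ≤ 1 := by
      have : P.eta * uu P σ x a ≤ P.eta * (30 * P.L) := by gcongr; linarith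
      linarith
    have := (abs_le.1 (Real.abs_exp_sub_one_sub_id_le
      (x := -(P.eta * (uu P σ x a * ℓ σ.n c a))) (by rw [abs_neg, abs_of_nonneg y0]; exact y1))).2
    have y3 : (P.eta * (uu P σ x a * ℓ σ.n c a)) ^ 2 ≤ (P.eta * uu P σ x a) ^ 2 := by gcongr
    have : Real.exp (-(P.eta * (uu P σ x a * ℓ σ.n c a))) ≤
      1 - (P.eta * (uu P σ x a * ℓ σ.n c a)) + (P.eta * uu P σ x a) ^ 2 := by
      rw [neg_sq] at this; linarith
    have := mul_le_mul_of_nonneg_left this p0.le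
    refine this.trans (le_of_eq (by ring))
  rw [Finset.sum_add_distrib, Finset.sum_sub_distrib, pol_sum, ← Finset.mul_sum,
    ← Finset.mul_sum] at a3
  have a4 : Real.log S' ≤ Real.log S - P.eta * ∑ a, pol P σ.th c a * (ℓ σ.n c a * uu P σ x a) +
    P.eta ^ 2 * ∑ a, pol P σ.th c a * uu P σ x a ^ 2 := by linarith
  have := mul_le_mul_of_nonneg_left a4 (by positivity : 0 ≤ 1 / P.eta)
  refine this.trans (le_of_eq ?_)
  field_simp

lemma pot_step (H : Hyp P ℓ ν Λ) (π : C → A) {σ : St C A} (I : InvB P σ) :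
    ∑ x, ker P ν σ x * Psi P ν π (full P ℓ σ x) ≤ Psi P ν π σ - dd P ℓ ν π σ := by
  have he := H.etapos
  have e0 : Psi P ν π σ - dd P ℓ ν π σ = ∑ c, ν c *
      (1 / P.eta * Real.log (∑ a, Real.exp (-P.eta * σ.th c a)) + σ.th c (π c) -
      (∑ a, pol P σ.th c a * (ℓ σ.n c a * ub P ν σ a) - ℓ σ.n c (π c) * ub P ν σ (π c)
    - P.eta * ∑ a, pol P σ.th c a * vb P ν σ a)) := by
    unfold Psi dd
    rw [← Finset.sum_sub_distrib]
    simp only [mul_sub]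
  have e1 : ∑ x, ker P ν σ x * Psi P ν π (full P ℓ σ x) = ∑ c, ν c * ∑ x, ker P ν σ x *
      (1 / P.eta * Real.log (∑ a, Real.exp (-P.eta * (σ.th c a + uu P σ x a * ℓ σ.n c a))) +
        (σ.th c (π c) + uu P σ x (π c) * ℓ σ.n c (π c))) := by
    simp only [Psi, full_th, Finset.mul_sum]
    rw [Finset.sum_comm]
    refine Finset.sum_congr rfl fun c _ => Finset.sum_congr rfl fun x _ => by ring
  rw [e0, e1]
  refine Finset.sum_le_sum fun c _ => mul_le_mul_of_nonneg_left ?_ (H.ν0 c)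
  set B := 1 / P.eta * Real.log (∑ a, Real.exp (-P.eta * σ.th c a)) with hB
  calc _ ≤ ∑ x, ker P ν σ x * ((B - ∑ a, pol P σ.th c a * (ℓ σ.n c a * uu P σ x a) +
      P.eta * ∑ a, pol P σ.th c a * uu P σ x a ^ 2) +
        (σ.th c (π c) + uu P σ x (π c) * ℓ σ.n c (π c))) := by
        refine Finset.sum_le_sum fun x _ => mul_le_mul_of_nonneg_left ?_ (ker_nonneg H σ x)
        have := pot_c H I x c
        linarith
    _ = (B + σ.th c (π c)) * ∑ x, ker P ν σ x -
        ∑ a, pol P σ.th c a * (ℓ σ.n c a * ∑ x, ker P ν σ x * uu P σ x a) +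
        P.eta * ∑ a, pol P σ.th c a * ∑ x, ker P ν σ x * uu P σ x a ^ 2 +
        ℓ σ.n c (π c) * ∑ x, ker P ν σ x * uu P σ x (π c) := by
        have s1 : ∑ a, pol P σ.th c a * (ℓ σ.n c a * ∑ x, ker P ν σ x * uu P σ x a) =
          ∑ x, ker P ν σ x * ∑ a, pol P σ.th c a * (ℓ σ.n c a * uu P σ x a) := by
          simp only [Finset.mul_sum]
          rw [Finset.sum_comm]
          refine Finset.sum_congr rfl fun c _ => Finset.sum_congr rfl fun x _ => by ring
        have s2 : ∑ a, pol P σ.th c a * ∑ x, ker P ν σ x * uu P σ x a ^ 2 =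
          ∑ x, ker P ν σ x * ∑ a, pol P σ.th c a * uu P σ x a ^ 2 := by
          simp only [Finset.mul_sum]
          rw [Finset.sum_comm]
          refine Finset.sum_congr rfl fun c _ => Finset.sum_congr rfl fun x _ => by ring
        rw [s1, s2]
        rw [Finset.mul_sum, Finset.mul_sum univ _ P.eta, Finset.mul_sum univ _ (ℓ σ.n c (π c)),
          ← Finset.sum_sub_distrib, ← Finset.sum_add_distrib, ← Finset.sum_add_distrib]
        refine Finset.sum_congr rfl fun x _ => by ring
    _ ≤ _ := by
        simp only [ker_u, ker_sum H]
        have : ∑ a, pol P σ.th c a * ∑ x, ker P ν σ x * uu P σ x a ^ 2 ≤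
          ∑ a, pol P σ.th c a * vb P ν σ a := Finset.sum_le_sum fun a _ =>
            mul_le_mul_of_nonneg_left (ker_u2 H I a) (pol_pos _ _ _).le
        have := mul_le_mul_of_nonneg_left this he.le
        linarith

noncomputable abbrev EF (P : Par A) (ℓ : ℕ → C → A → ℝ) (ν : C → ℝ) :=
  Ex (ker P ν) (full P ℓ)

lemma pot_total (H : Hyp P ℓ ν Λ) (π : C → A) (n : ℕ) :
    ∑ t ∈ Finset.range n, EF P ℓ ν t (init P) (dd P ℓ ν π) ≤
      30 * P.L * Real.log (Fintype.card A) := by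
  rw [← Psi_init H π]
  exact Ex_telescope (ker_nonneg H) (FI P) (FI_step H) _ _ (fun s _ => Psi_nonneg H π s)
    (fun s h => pot_step H π h.I) n _ FI_init (ker_sum H)

end Pot

section Full
variable {C A : Type} [Fintype C] [Fintype A] [DecidableEq A] [Nonempty A]
variable {P : Par A} {ℓ : ℕ → C → A → ℝ} {ν : C → ℝ} {Λ : ℝ}

def FT (P : Par A) (i : ℕ) (σ : St C A) : Prop := FI P σ ∧ σ.n = i

lemma EF_mono (H : Hyp P ℓ ν Λ) (t : ℕ) {F G : St C A → ℝ}
    (h : ∀ σ, FI P σ → σ.n = t → F σ ≤ G σ) :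
    EF P ℓ ν t (init P) F ≤ EF P ℓ ν t (init P) G :=
  Ex_mono (ker_nonneg H) (FT P) (fun i s x hs => ⟨FI_step H s x hs.1, by rw [full_n, hs.2]⟩) t 0 _
    ⟨FI_init, rfl⟩ (fun s hs => h s hs.1 (by simpa using hs.2))

lemma EF_inner (e i j : ℕ) (σ : St C A) (hn : σ.n = e * P.L + i) (hij : i + j < P.L)
    (F : St C A → ℝ) : EF P ℓ ν j σ F = EI P ℓ ν j σ F := by
  induction j generalizing i σ with
  | zero => rfl
  | succ j ih =>
    simp only [EF, EI, Ex] at *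
    refine Finset.sum_congr rfl fun x _ => ?_
    have h1 : full P ℓ σ x = inner' P ℓ σ x := by
      unfold full
      rw [if_neg]
      rw [hn, add_assoc, mul_comm, Nat.mul_add_mod, Nat.mod_eq_of_lt (by omega)]
      omega
    rw [h1, ih (i+1) _ (by simp only [inner', hn]; ring) (by omega)]

lemma EF_bd (e i j : ℕ) (σ : St C A) (hn : σ.n = e * P.L + i) (hij : i + (j + 1) = P.L)
    (F : St C A → ℝ) : EF P ℓ ν (j+1) σ F = EI P ℓ ν (j+1) σ (fun s => F (bd P s)) := by
  induction j generalizing i σ with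
  | zero =>
    simp only [EF, EI, Ex] at *
    refine Finset.sum_congr rfl fun x _ => ?_
    have h1 : full P ℓ σ x = bd P (inner' P ℓ σ x) := by
      unfold full
      rw [if_pos]
      have : σ.n + 1 = (e + 1) * P.L := by rw [hn, add_mul]; omega
      rw [this]; simp
    rw [h1]
  | succ j ih =>
    rw [EF, EI, Ex, Ex]
    refine Finset.sum_congr rfl fun x _ => ?_
    have h1 : full P ℓ σ x = inner' P ℓ σ x := by
      unfold full
      rw [if_neg]
      rw [hn, add_assoc, mul_comm, Nat.mul_add_mod, Nat.mod_eq_of_lt (by omega)]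
      omega
    rw [h1]
    have := ih (i+1) (inner' P ℓ σ x) (by simp only [inner', hn]; ring) (by omega)
    rw [EF, EI] at this
    rw [this]

lemma EF_epoch (H : Hyp P ℓ ν Λ) (e j : ℕ) (hj : j < P.L) (F G : St C A → ℝ)
    (h : ∀ σ, FI P σ → σ.n = e * P.L → EI P ℓ ν P.L σ (fun s => EI P ℓ ν j (bd P s) F) ≤ G σ) :
    EF P ℓ ν ((e + 1) * P.L + j) (init P) F ≤ EF P ℓ ν (e * P.L) (init P) G := by
  have e1 : (e + 1) * P.L + j = e * P.L + (P.L + j) := by ring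
  rw [e1, EF, Ex_add_time]
  refine EF_mono H _ fun σ hσ hn => ?_
  refine le_trans (le_of_eq ?_) (h σ hσ hn)
  rw [Ex_add_time]
  have hL : P.L = (P.L - 1) + 1 := by omega
  have := EF_bd (ℓ := ℓ) (ν := ν) e 0 (P.L - 1) σ (by omega) (by omega)
    (fun s' => Ex (ker P ν) (full P ℓ) j s' F)
  rw [← hL, EF] at this
  rw [this]
  refine EI_congr H hσ.I _ fun s hs => ?_
  refine EF_inner (e+1) 0 j _ ?_ (by omega) F
  simp only [bd]
  rw [hs.n, hn]
  ring

lemma EF_G (H : Hyp P ℓ ν Λ) (e j : ℕ) (hj : j < P.L) (F : St C A → ℝ)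
    (G : (C → A → ℝ) → (A → ℝ) → ℝ) (B : ℝ)
    (hF : ∀ σ, InvB P σ → σ.n = (e + 1) * P.L + j → F σ ≤ G σ.th0 σ.g)
    (hG : ∀ σ : St C A, InvB P σ → (σ.acc = fun _ => 0) →
      EI P ℓ ν P.L σ (fun s => G σ.th1 (fun b => s.acc b / P.L)) ≤ B) :
    EF P ℓ ν ((e + 1) * P.L + j) (init P) F ≤ B := by
  have := EF_epoch H e j hj F (fun _ => B) ?_
  · simpa only [EF, Ex_const (ker_sum H)] using this
  intro σ hσ hn
  refine le_trans ?_ (hG σ hσ.I (hσ.b0 (by rw [hn]; simp)))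
  refine EI_mono H hσ.I _ fun s hs => ?_
  have : EI P ℓ ν j (bd P s) F ≤ EI P ℓ ν j (bd P s) (fun _ => G σ.th1 (fun b => s.acc b / P.L)) := by
    refine EI_mono H (InvB_bd hs.I) _ fun s' hs' => ?_
    have := hF s' hs'.I (by rw [hs'.n]; simp only [bd]; rw [hs.n, hn]; ring)
    rw [hs'.th0, hs'.g] at this
    simpa only [bd, hs.th1] using this
  refine this.trans ?_
  rw [EI, Ex_const (ker_sum H)]

noncomputable def tI (ℓ : ℕ → C → A → ℝ) (P : Par A) (ν : C → ℝ) (π : C → A) (σ : St C A) : ℝ :=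
  ∑ c, ν c * (ℓ σ.n c (π c) * (ub P ν σ (π c) - 1))

noncomputable def tV (P : Par A) (ν : C → ℝ) (σ : St C A) : ℝ :=
  ∑ c, ν c * ∑ a, pol P σ.th c a * vb P ν σ a

noncomputable def tT (ℓ : ℕ → C → A → ℝ) (P : Par A) (ν : C → ℝ) (σ : St C A) : ℝ :=
  ∑ c, ν c * ∑ a, pol P σ.th c a * (ℓ σ.n c a * (1 - ub P ν σ a))

lemma ub_nonneg (H : Hyp P ℓ ν Λ) {σ : St C A} (I : InvB P σ) (a : A) : 0 ≤ ub P ν σ a := by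
  rw [← ker_u]
  exact Finset.sum_nonneg fun x _ => mul_nonneg (ker_nonneg H σ x) (uu_nonneg H I x a)

lemma decomp (σ : St C A) (π : C → A) :
    ∑ x, ker P ν σ x * (ℓ σ.n x.1 x.2 - ℓ σ.n x.1 (π x.1)) =
      dd P ℓ ν π σ + (P.eta * tV P ν σ + (tT ℓ P ν σ + tI ℓ P ν π σ)) := by
  rw [Fintype.sum_prod_type]
  unfold dd tV tT tI
  rw [Finset.mul_sum, ← Finset.sum_add_distrib, ← Finset.sum_add_distrib, ← Finset.sum_add_distrib]
  refine Finset.sum_congr rfl fun c _ => ?_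
  simp only [ker, mul_assoc, ← Finset.mul_sum, mul_sub, Finset.sum_sub_distrib, mul_one,
    ← Finset.sum_mul, pol_sum]
  ring

lemma bar_mul (θ : C → A → ℝ) (X : A → ℝ) :
    ∑ c, ν c * ∑ a, pol P θ c a * X a = ∑ a, bar P ν θ a * X a := by
  simp only [Finset.mul_sum, bar, Finset.sum_mul]
  rw [Finset.sum_comm]
  refine Finset.sum_congr rfl fun c _ => Finset.sum_congr rfl fun x _ => by ring

lemma tI_le (H : Hyp P ℓ ν Λ) (π : C → A) (t : ℕ) :
    EF P ℓ ν t (init P) (tI ℓ P ν π) ≤ 0 := by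
  have hL := H.L1
  have hl := H.l0
  have hν := H.ν0
  by_cases ht : t < P.L
  · have := EF_mono H t (F := tI ℓ P ν π) (G := fun _ => 0) ?_
    · simpa only [EF, Ex_const (ker_sum H)] using this
    intro σ hσ hn
    unfold tI
    refine Finset.sum_nonpos fun c _ => ?_
    have : ub P ν σ (π c) = 0 := by
      unfold ub
      rw [if_neg]
      have := hσ.b3 (by omega) (π c)
      linarith
    rw [this]
    have := hl σ.n c (π c)
    have := hν c
    have : 0 ≤ ν c * ℓ σ.n c (π c) := by positivity
    linarith
  · obtain ⟨e, he⟩ : ∃ e, t / P.L = e + 1 := ⟨t / P.L - 1, by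
      have : 0 < t / P.L := Nat.div_pos (by omega) (by omega)
      omega⟩
    have hd := Nat.div_add_mod t P.L
    rw [he, mul_comm] at hd
    rw [← hd]
    refine EF_G H e (t % P.L) (Nat.mod_lt _ (by omega)) _
      (fun θ g => ∑ c, ν c * (ℓ t c (π c) * (rr P ν θ g (π c) + (-1)))) 0 ?_ ?_
    · intro σ I hn
      unfold tI
      rw [hn, hd]
      refine Finset.sum_le_sum fun c _ => mul_le_mul_of_nonneg_left
        (mul_le_mul_of_nonneg_left ?_ (hl _ _ _)) (hν c)
      unfold ub
      have : 0 ≤ rr P ν σ.th0 σ.g (π c) := div_nonneg (fq_pos H _ _).le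
        (add_nonneg (I.g0 _) H.γpos.le)
      split_ifs <;> linarith
    · intro σ I h0
      simp only [EI, Ex_sum, Ex_smul, Ex_add, Ex_const (ker_sum H)]
      refine Finset.sum_nonpos fun c _ => ?_
      have h1 := (ep_r H h0 (π c)).1
      rw [EI] at h1
      refine mul_nonpos_of_nonneg_of_nonpos (hν c) (mul_nonpos_of_nonneg_of_nonpos (hl _ _ _) ?_)
      linarith

lemma tV_le (H : Hyp P ℓ ν Λ) (t : ℕ) :
    EF P ℓ ν t (init P) (tV P ν) ≤ 18 * Λ := by
  have hL := H.L1
  have hν := H.ν0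
  have hΛ : 0 ≤ Λ := (Finset.sum_nonneg fun a _ => div_nonneg (bar_pos H _ _).le
    (add_nonneg (fq_pos H _ _).le H.γpos.le)).trans (ep_bar H (fun _ _ => 0))
  by_cases ht : t < P.L
  · have := EF_mono H t (F := tV P ν) (G := fun _ => 18 * Λ) ?_
    · simpa only [EF, Ex_const (ker_sum H)] using this
    intro σ hσ hn
    refine le_trans (b := 0) ?_ (by positivity)
    unfold tV
    refine Finset.sum_nonpos fun c _ => ?_
    have : ∀ a, vb P ν σ a = 0 := fun a => by
      unfold vb
      rw [if_neg]
      have := hσ.b3 (by omega) a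
      linarith
    simp [this]
  · obtain ⟨e, he⟩ : ∃ e, t / P.L = e + 1 := ⟨t / P.L - 1, by
      have : 0 < t / P.L := Nat.div_pos (by omega) (by omega)
      omega⟩
    have hd := Nat.div_add_mod t P.L
    rw [he, mul_comm] at hd
    rw [← hd]
    refine EF_G H e (t % P.L) (Nat.mod_lt _ (by omega)) _
      (fun θ g => 9 * ∑ a, bar P ν θ a * (fq P ν θ a / (g a + P.γ) ^ 2)) (18 * Λ) ?_ ?_
    · intro σ I hn
      rw [← bar_mul]
      unfold tV
      rw [Finset.mul_sum]
      refine Finset.sum_le_sum fun c _ => ?_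
      rw [mul_left_comm]
      refine mul_le_mul_of_nonneg_left ?_ (hν c)
      rw [Finset.mul_sum]
      refine Finset.sum_le_sum fun a _ => ?_
      have p1 := (ratio H I c a).2
      have p2 := pol_pos (P := P) σ.th c a
      have p3 := pol_pos (P := P) σ.th0 c a
      have f0 := fq_pos H σ.th0 a
      have hF : 0 ≤ fq P ν σ.th0 a / (σ.g a + P.γ) ^ 2 := by positivity
      have : vb P ν σ a ≤ 3 * (fq P ν σ.th0 a / (σ.g a + P.γ) ^ 2) := by
        unfold vb; split_ifs
        · exact le_rfl
        · positivity
      calc _ ≤ pol P σ.th c a * (3 * (fq P ν σ.th0 a / (σ.g a + P.γ) ^ 2)) := by gcongr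
        _ ≤ (3 * pol P σ.th0 c a) * (3 * (fq P ν σ.th0 a / (σ.g a + P.γ) ^ 2)) := by gcongr
        _ = _ := by ring
    · intro σ I h0
      rw [EI]
      simp only [Ex_sum, Ex_smul]
      have := ep_bar H σ.th1
      calc _ ≤ 9 * ∑ a, bar P ν σ.th1 a * (2 / (fq P ν σ.th1 a + P.γ)) := by
            gcongr with a _
            · exact (bar_pos H _ _).le
            · exact ep_v H I h0 a
        _ = 18 * ∑ a, bar P ν σ.th1 a / (fq P ν σ.th1 a + P.γ) := by
            rw [Finset.mul_sum, Finset.mul_sum]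
            refine Finset.sum_congr rfl fun a _ => by ring
        _ ≤ _ := by gcongr

end Full

section Third
variable {C A : Type} [Fintype C] [Fintype A] [DecidableEq A] [Nonempty A]
variable {P : Par A} {ℓ : ℕ → C → A → ℝ} {ν : C → ℝ} {Λ : ℝ}

lemma Hyp.Lam0 (H : Hyp P ℓ ν Λ) : 0 ≤ Λ := (Finset.sum_nonneg fun a _ => div_nonneg (bar_pos H _ _).le
    (add_nonneg (fq_pos H _ _).le H.γpos.le)).trans (ep_bar H (fun _ _ => 0))

lemma tT_small (H : Hyp P ℓ ν Λ) (t : ℕ) : EF P ℓ ν t (init P) (tT ℓ P ν) ≤ 1 := by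
  have := EF_mono H t (F := tT ℓ P ν) (G := fun _ => 1) ?_
  · simpa only [EF, Ex_const (ker_sum H)] using this
  intro σ hσ hn
  unfold tT
  refine le_trans ?_ H.ν1.le
  refine Finset.sum_le_sum fun c _ => mul_le_of_le_one_right (H.ν0 c) ?_
  refine le_trans ?_ (pol_sum (P := P) σ.th c).le
  refine Finset.sum_le_sum fun a _ => mul_le_of_le_one_right (pol_pos _ _ _).le ?_
  have := ub_nonneg H hσ.I a
  have := H.l0 σ.n c a
  have := H.l1 σ.n c a
  nlinarith

/-- pointwise bound -/
lemma tT_pt (H : Hyp P ℓ ν Λ) {σ0 σ' σ : St C A} (hth : σ0.th1 = σ0.th) (j : ℕ)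
    (hj : j < P.L) (h' : PI P σ0 P.L σ') (h : PI P (bd P σ') j σ) (pt : C → A → ℝ)
    (hpt : pt = fun c => smx P.eta
      (fun a => σ0.th c a + ∑ i ∈ Finset.range (P.L + j), ℓ (σ0.n + i) c a)) (c : C) :
    ∑ a, pol P σ.th c a * (ℓ σ.n c a * (1 - ub P ν σ a)) ≤
    ∑ a, ((pt c a * (ℓ (σ0.n + (P.L + j)) c a * (1 - rr P ν (bd P σ').th0 (bd P σ').g a)) +
      pol P (bd P σ').th0 c a * (36 * (P.eta ^ 2 * YY ℓ σ0 P.L c a σ' ^ 2) +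
        21 * (1 - rr P ν (bd P σ').th0 (bd P σ').g a) ^ 2)) +
      pol P (bd P σ').th0 c a * (36 * (P.eta ^ 2 * YY ℓ (bd P σ') j c a σ ^ 2) +
        6 * (if σ.D a < 12 * P.L then 0 else 1))) := by
  have he := H.etapos
  have heL := H.etaL
  have hn : σ.n = σ0.n + (P.L + j) := by
    rw [h.n]; simp only [bd]; rw [h'.n]; ring
  rw [hn]
  have hr := ratio H h.I c
  rw [h.th0] at hr
  set r : A → ℝ := rr P ν (bd P σ').th0 (bd P σ').g with hrr
  set s : A → ℝ := pol P (bd P σ').th0 c with hs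
  set l : A → ℝ := ℓ (σ0.n + (P.L + j)) c with hl
  set cap : A → ℝ := fun a => if σ.D a < 12 * P.L then 0 else 1 with hcap
  have hcap0 : ∀ a, 0 ≤ cap a := fun a => by rw [hcap]; dsimp only; split_ifs <;> norm_num
  have l0 : ∀ a, 0 ≤ l a := H.l0 _ _
  have l1 : ∀ a, l a ≤ 1 := H.l1 _ _
  have hs0 : ∀ a, 0 < s a := pol_pos _ _
  have eth0 : (bd P σ').th0 = σ0.th := by
    show σ'.th1 = σ0.th
    rw [h'.th1, hth]
  have t1 : ∀ a, l a * (1 - ub P ν σ a) ≤ l a * (1 - r a) + ((1 - r a) ^ 2 + 2 * cap a) := by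
    intro a
    have : 1 - ub P ν σ a ≤ (1 - r a) + ((1 - r a) ^ 2 + 2 * cap a) := by
      rw [hcap]
      unfold ub
      rw [h.th0, h.g, ← hrr]
      dsimp only
      split_ifs
      · nlinarith [sq_nonneg (1 - r a)]
      · nlinarith [sq_nonneg (r a - 3/2)]
    have := mul_le_mul_of_nonneg_left this (l0 a)
    rw [mul_add] at this
    refine this.trans ?_
    have := mul_le_of_le_one_left (add_nonneg (sq_nonneg (1 - r a)) (mul_nonneg (by norm_num : (0:ℝ) ≤ 2) (hcap0 a))) (l1 a)
    linarith
  set m : A → ℝ := fun a => ∑ i ∈ Finset.range (P.L + j), ℓ (σ0.n + i) c a with hm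
  have m0 : ∀ a, 0 ≤ m a := fun a => Finset.sum_nonneg fun i _ => H.l0 _ _ _
  have m1 : ∀ a, m a ≤ 2 * P.L := fun a => by
    calc m a ≤ ∑ i ∈ Finset.range (P.L + j), (1:ℝ) := Finset.sum_le_sum fun i _ => H.l1 _ _ _
      _ = P.L + j := by simp
      _ ≤ _ := by
        have : (j:ℝ) ≤ P.L := by exact_mod_cast hj.le
        linarith
  have hmY : ∀ a, σ.th c a - (σ0.th c a + m a) = YY ℓ σ0 P.L c a σ' + YY ℓ (bd P σ') j c a σ := by
    intro a
    simp only [YY, hm, Finset.sum_range_add, bd, h'.n]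
    simp only [add_assoc]
    ring
  have hLn : (0:ℝ) ≤ P.L := Nat.cast_nonneg _
  have pert := smx_perturb P.eta (σ.th c) (fun a => σ0.th c a + m a) (fun a => l a * (1 - r a))
    (fun a => P.eta * (σ.th c a - (σ0.th c a + m a))) (fun a => rfl) (by
      intro a
      have q1 := h.I.t01 c a
      have q2 := h.I.t10 c a
      have q3 := h.I.t1 c a
      have q4 := h.I.t2 c a
      have q5 := h.I.D1 a
      rw [h.th0, eth0] at q1 q2
      have := m0 a
      have := m1 a
      rw [abs_le]
      constructor
      · have := mul_le_mul_of_nonneg_left (by linarith : -(30 * (P.L:ℝ)) ≤ σ.th c a - (σ0.th c a + m a)) he.le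
        linarith
      · have := mul_le_mul_of_nonneg_left (by linarith : σ.th c a - (σ0.th c a + m a) ≤ 30 * (P.L:ℝ)) he.le
        linarith)
  have ptr : ∀ a, pt c a ≤ 3 * s a := fun a => by
    rw [hpt, hs, eth0]
    refine (smx_ratio P.eta (fun a => σ0.th c a + m a) (σ0.th c) ?_ ?_ a).2
    · intro b
      have := m0 b
      have : σ0.th c b + m b - σ0.th c b = m b := by ring
      rw [this]
      positivity
    · intro b
      have := m1 b
      have := mul_le_mul_of_nonneg_left (by linarith : σ0.th c b + m b - σ0.th c b ≤ 30 * (P.L:ℝ)) he.le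
      linarith
  have hpc : smx P.eta (fun a => σ0.th c a + m a) = pt c := by rw [hpt]
  rw [hpc] at pert
  calc ∑ a, pol P σ.th c a * (l a * (1 - ub P ν σ a))
      ≤ ∑ a, (smx P.eta (σ.th c) a * (l a * (1 - r a)) + (3 * s a) * ((1 - r a) ^ 2 + 2 * cap a)) := by
        refine Finset.sum_le_sum fun a _ => ?_
        have p0 := pol_pos (P := P) σ.th c a
        have := mul_le_mul_of_nonneg_left (t1 a) p0.le
        rw [mul_add] at this
        refine this.trans ?_
        have q := mul_le_mul_of_nonneg_right (hr a).2 (add_nonneg (sq_nonneg (1 - r a)) (mul_nonneg (by norm_num : (0:ℝ) ≤ 2) (hcap0 a)))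
        rw [pol] at q ⊢
        linarith
    _ = ∑ a, smx P.eta (σ.th c) a * (l a * (1 - r a)) + ∑ a, (3 * s a) * ((1 - r a) ^ 2 + 2 * cap a) :=
        Finset.sum_add_distrib
    _ ≤ _ := by
        refine (add_le_add_left pert _).trans ?_
        rw [Finset.mul_sum, ← Finset.sum_add_distrib, ← Finset.sum_add_distrib]
        refine Finset.sum_le_sum fun a _ => ?_
        rw [hmY a]
        set Y0 := YY ℓ σ0 P.L c a σ'
        set Y1 := YY ℓ (bd P σ') j c a σ
        have z1 : (P.eta * (Y0 + Y1)) ^ 2 + (l a * (1 - r a)) ^ 2 ≤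
            2 * (P.eta ^ 2 * Y0 ^ 2) + 2 * (P.eta ^ 2 * Y1 ^ 2) + (1 - r a) ^ 2 := by
          have : l a ^ 2 ≤ 1 := by have := l0 a; have := l1 a; nlinarith
          have := mul_le_mul_of_nonneg_right this (sq_nonneg (1 - r a))
          have := sq_nonneg (P.eta * Y0 - P.eta * Y1)
          nlinarith
        have z0 : 0 ≤ (P.eta * (Y0 + Y1)) ^ 2 + (l a * (1 - r a)) ^ 2 := by positivity
        have z2 := mul_le_mul_of_nonneg_right (ptr a) z0
        have z3 := mul_le_mul_of_nonneg_left z1 (hs0 a).le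
        have : 6 * (pt c a * ((P.eta * (Y0 + Y1)) ^ 2 + (l a * (1 - r a)) ^ 2)) ≤
          18 * (s a * (2 * (P.eta ^ 2 * Y0 ^ 2) + 2 * (P.eta ^ 2 * Y1 ^ 2) + (1 - r a) ^ 2)) := by
          linarith
        linarith

lemma tT_one (H : Hyp P ℓ ν Λ) {σ0 σ' : St C A} (hth : σ0.th1 = σ0.th) (j : ℕ)
    (hj : j < P.L) (h' : PI P σ0 P.L σ') (pt : C → A → ℝ)
    (hpt : pt = fun c => smx P.eta
      (fun a => σ0.th c a + ∑ i ∈ Finset.range (P.L + j), ℓ (σ0.n + i) c a)) :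
    EI P ℓ ν j (bd P σ') (tT ℓ P ν) ≤
    ∑ c, ν c * ∑ a, (pt c a * (ℓ (σ0.n + (P.L + j)) c a *
        (1 + (-1) * rr P ν σ0.th1 (fun b => σ'.acc b / P.L) a)) +
      pol P σ0.th1 c a * (36 * (P.eta ^ 2 * YY ℓ σ0 P.L c a σ' ^ 2) +
        22 * QQ P ν σ0.th1 (fun b => σ'.acc b / P.L) a)) := by
  have I1 := InvB_bd h'.I
  have eth0 : (bd P σ').th0 = σ0.th1 := h'.th1
  have h1 := EI_mono H I1 j (F := tT ℓ P ν) (G := fun σ => ∑ c, ν c * ∑ a, ((pt c a *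
    (ℓ (σ0.n + (P.L + j)) c a * (1 - rr P ν (bd P σ').th0 (bd P σ').g a)) +
      pol P (bd P σ').th0 c a * (36 * (P.eta ^ 2 * YY ℓ σ0 P.L c a σ' ^ 2) +
        21 * (1 - rr P ν (bd P σ').th0 (bd P σ').g a) ^ 2)) +
      pol P (bd P σ').th0 c a * (36 * (P.eta ^ 2 * YY ℓ (bd P σ') j c a σ ^ 2) +
        6 * (if σ.D a < 12 * P.L then 0 else 1)))) (fun σ h =>
      Finset.sum_le_sum fun c _ => mul_le_mul_of_nonneg_left (tT_pt H hth j hj h' h pt hpt c) (H.ν0 c))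
  refine h1.trans ?_
  have hY := fun c a => dev_fin H I1 rfl j hj.le c a
  have hc := fun a => in_cap H I1 rfl j hj.le a
  simp only [EI] at *
  simp only [Ex_sum, Ex_smul]
  refine Finset.sum_le_sum fun c _ => mul_le_mul_of_nonneg_left ?_ (H.ν0 c)
  refine Finset.sum_le_sum fun a _ => ?_
  rw [Ex_add, Ex_const (ker_sum H), Ex_smul, Ex_add, Ex_smul, Ex_smul 
    (F := fun σ : St C A => if σ.D a < 12 * (P.L:ℝ) then (0:ℝ) else 1)]
  specialize hY c a
  specialize hc a
  rw [eth0] at hY hc ⊢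
  have eg : (bd P σ').g = (fun b => σ'.acc b / P.L) := rfl
  rw [eg] at hY hc ⊢
  have p0 := pol_pos (P := P) σ0.th1 c a
  have Q0 := QQ_nonneg H σ0.th1 (fun b => σ'.acc b / P.L) a
  have hγ := H.γpos
  have hf := fq_pos H σ0.th1 a
  have Q1 : (1 - rr P ν σ0.th1 (fun b => σ'.acc b / P.L) a) ^ 2 + cp P ν σ0.th1 (fun b => σ'.acc b / P.L) a
      ≤ QQ P ν σ0.th1 (fun b => σ'.acc b / P.L) a := by
    have : 0 ≤ fq P ν σ0.th1 a / (σ'.acc a / P.L + P.γ) ^ 2 / P.L + 1 / P.L := by positivity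
    unfold QQ
    linarith
  have c0 : 0 ≤ cp P ν σ0.th1 (fun b => σ'.acc b / P.L) a := (Real.exp_pos _).le
  set X := Ex (ker P ν) (inner' P ℓ) j (bd P σ') fun s => P.eta ^ 2 * YY ℓ (bd P σ') j c a s ^ 2
  set Z := Ex (ker P ν) (inner' P ℓ) j (bd P σ') fun σ => if σ.D a < 12 * P.L then 0 else 1
  set Q := QQ P ν σ0.th1 (fun b => σ'.acc b / P.L) a
  set R := (1 - rr P ν σ0.th1 (fun b => σ'.acc b / P.L) a) ^ 2
  have : 21 * R + (36 * X + 6 * Z) ≤ 22 * Q := by linarith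
  have := mul_le_mul_of_nonneg_left this p0.le
  linarith

lemma tT_two (H : Hyp P ℓ ν Λ) {σ0 : St C A} (I : InvB P σ0) (h0 : σ0.acc = fun _ => 0)
    (hD : σ0.D = fun _ => 0) (hth : σ0.th1 = σ0.th) (j : ℕ) (hj : j < P.L) :
    EI P ℓ ν P.L σ0 (fun s => EI P ℓ ν j (bd P s) (tT ℓ P ν)) ≤
      179 * (P.γ * Λ) + 3 * ∑ a, bar P ν σ0.th0 a * QQ P ν σ0.th0 σ0.g a := by
  obtain ⟨pt, hpt⟩ : ∃ pt : C → A → ℝ, pt = fun c => smx P.eta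
      (fun a => σ0.th c a + ∑ i ∈ Finset.range (P.L + j), ℓ (σ0.n + i) c a) := ⟨_, rfl⟩
  have he := H.etapos
  have heL := H.etaL
  have hLn : (0:ℝ) ≤ P.L := Nat.cast_nonneg _
  have hγ := H.γpos
  have pt0 : ∀ c a, 0 ≤ pt c a := fun c a => by rw [hpt]; exact (smx_pos _ _ _).le
  have ptr : ∀ c a, pt c a ≤ 3 * pol P σ0.th1 c a := fun c a => by
    rw [hpt, hth]
    have m0 : ∀ b, 0 ≤ ∑ i ∈ Finset.range (P.L + j), ℓ (σ0.n + i) c b :=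
      fun a => Finset.sum_nonneg fun i _ => H.l0 _ _ _
    have m1 : ∀ b, ∑ i ∈ Finset.range (P.L + j), ℓ (σ0.n + i) c b ≤ 2 * P.L := fun b => by
      calc _ ≤ ∑ i ∈ Finset.range (P.L + j), (1:ℝ) := Finset.sum_le_sum fun i _ => H.l1 _ _ _
        _ = P.L + j := by simp
        _ ≤ _ := by
          have : (j:ℝ) ≤ P.L := by exact_mod_cast hj.le
          linarith
    refine (smx_ratio P.eta (fun a => σ0.th c a + _) (σ0.th c) ?_ ?_ a).2
    · intro b
      have := m0 b
      rw [add_sub_cancel_left]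
      positivity
    · intro b
      have := m1 b
      rw [add_sub_cancel_left]
      have := mul_le_mul_of_nonneg_left (by linarith : ∑ i ∈ Finset.range (P.L + j), ℓ (σ0.n + i) c b ≤ 30 * (P.L:ℝ)) he.le
      linarith
  have h1 := EI_mono H I P.L (F := fun s => EI P ℓ ν j (bd P s) (tT ℓ P ν)) (fun σ' h' => tT_one H hth j hj h' pt hpt)
  refine h1.trans ?_
  have hY := fun c a => dev_fin H I hD P.L le_rfl c a
  have hQ := fun a => ep_Q H I h0 a
  have hr := fun a => (ep_r H h0 a).2
  simp only [EI] at *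
  simp only [Ex_sum, Ex_smul]
  calc _ ≤ ∑ c, ν c * ∑ a, pol P σ0.th1 c a * (179 * (P.γ / (fq P ν σ0.th1 a + P.γ)) +
        QQ P ν σ0.th0 σ0.g a) := by
        refine Finset.sum_le_sum fun c _ => mul_le_mul_of_nonneg_left ?_ (H.ν0 c)
        refine Finset.sum_le_sum fun a _ => ?_
        rw [Ex_add, Ex_smul, Ex_smul, Ex_add, Ex_const (ker_sum H), Ex_smul, Ex_smul, Ex_add,
          Ex_smul, Ex_smul (F := fun s : St C A => QQ P ν σ0.th1 (fun b => s.acc b / P.L) a)]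
        specialize hY c a
        specialize hQ a
        specialize hr a
        have Q0 := QQ_nonneg H σ0.th0 σ0.g a
        have p0 := pol_pos (P := P) σ0.th1 c a
        have hf := fq_pos H σ0.th1 a
        have k0 : 0 ≤ P.γ / (fq P ν σ0.th1 a + P.γ) := by positivity
        have l0 := H.l0 (σ0.n + (P.L + j)) c a
        have l1 := H.l1 (σ0.n + (P.L + j)) c a
        set l := ℓ (σ0.n + (P.L + j)) c a
        set k := P.γ / (fq P ν σ0.th1 a + P.γ)
        set X := Ex (ker P ν) (inner' P ℓ) P.L σ0 fun s => P.eta ^ 2 * YY ℓ σ0 P.L c a s ^ 2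
        set Z := Ex (ker P ν) (inner' P ℓ) P.L σ0 fun s => QQ P ν σ0.th1 (fun b => s.acc b / P.L) a
        set R := Ex (ker P ν) (inner' P ℓ) P.L σ0 fun s => rr P ν σ0.th1 (fun b => s.acc b / P.L) a
        have z1 : pt c a * (l * (1 + -1 * R)) ≤ pol P σ0.th1 c a * (3 * k) := by
          calc pt c a * (l * (1 + -1 * R)) ≤ pt c a * (l * k) := by
                have := pt0 c a
                gcongr
                linarith
            _ ≤ pt c a * (1 * k) := by
                have := pt0 c a
                gcongr
            _ ≤ (3 * pol P σ0.th1 c a) * (1 * k) := by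
                gcongr
                exact ptr c a
            _ = _ := by ring
        have z2 : 36 * X + 22 * Z ≤ 176 * k + QQ P ν σ0.th0 σ0.g a := by linarith
        have := mul_le_mul_of_nonneg_left z2 p0.le
        linarith
    _ = ∑ a, bar P ν σ0.th1 a * (179 * (P.γ / (fq P ν σ0.th1 a + P.γ)) +
        QQ P ν σ0.th0 σ0.g a) := bar_mul _ _
    _ = 179 * (P.γ * ∑ a, bar P ν σ0.th1 a / (fq P ν σ0.th1 a + P.γ)) +
        ∑ a, bar P ν σ0.th1 a * QQ P ν σ0.th0 σ0.g a := by
        rw [Finset.mul_sum, Finset.mul_sum, ← Finset.sum_add_distrib]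
        refine Finset.sum_congr rfl fun a _ => by ring
    _ ≤ _ := by
        have := ep_bar H σ0.th1
        refine add_le_add (by gcongr) ?_
        rw [Finset.mul_sum]
        refine Finset.sum_le_sum fun a _ => ?_
        rw [← mul_assoc]
        refine mul_le_mul_of_nonneg_right ?_ (QQ_nonneg H _ _ _)
        unfold bar
        rw [Finset.mul_sum, hth]
        refine Finset.sum_le_sum fun c _ => ?_
        rw [mul_left_comm]
        exact mul_le_mul_of_nonneg_left (ratio H I c a).2 (H.ν0 c)

lemma tT_big (H : Hyp P ℓ ν Λ) (e j : ℕ) (hj : j < P.L) :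
    EF P ℓ ν ((e + 1 + 1) * P.L + j) (init P) (tT ℓ P ν) ≤ 203 * (P.γ * Λ) := by
  have hγ := H.γpos
  have h1 := EF_epoch H (e+1) j hj (tT ℓ P ν) (fun σ0 => 179 * (P.γ * Λ) +
    3 * ∑ a, bar P ν σ0.th0 a * QQ P ν σ0.th0 σ0.g a) (fun σ hσ hn => tT_two H hσ.I
      (hσ.b0 (by rw [hn]; simp)) (hσ.b2 (by rw [hn]; nlinarith) (by rw [hn]; simp))
      (hσ.b1 (by rw [hn]; simp)) j hj)
  refine h1.trans ?_
  have := EF_G H e 0 (by omega) (fun σ0 => 179 * (P.γ * Λ) +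
    3 * ∑ a, bar P ν σ0.th0 a * QQ P ν σ0.th0 σ0.g a)
    (fun θ g => 179 * (P.γ * Λ) + 3 * ∑ a, bar P ν θ a * QQ P ν θ g a) (203 * (P.γ * Λ))
    (fun σ _ _ => le_rfl) ?_
  · simpa using this
  intro σ I h0
  have hQ := fun a => ep_Q H I h0 a
  simp only [EI] at *
  rw [Ex_add, Ex_const (ker_sum H)]
  simp only [Ex_smul, Ex_sum]
  have : ∑ a, bar P ν σ.th1 a * Ex (ker P ν) (inner' P ℓ) P.L σ (fun s => QQ P ν σ.th1 (fun b => s.acc b / P.L) a)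
      ≤ 8 * (P.γ * Λ) := by
    calc _ ≤ ∑ a, bar P ν σ.th1 a * (8 * (P.γ / (fq P ν σ.th1 a + P.γ))) :=
          Finset.sum_le_sum fun a _ => mul_le_mul_of_nonneg_left (hQ a) (bar_pos H _ _).le
      _ = 8 * (P.γ * ∑ a, bar P ν σ.th1 a / (fq P ν σ.th1 a + P.γ)) := by
          rw [Finset.mul_sum, Finset.mul_sum]
          refine Finset.sum_congr rfl fun a _ => by ring
      _ ≤ _ := by
          have := ep_bar H σ.th1
          gcongr
  linarith

lemma tT_total (H : Hyp P ℓ ν Λ) (T : ℕ) :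
    ∑ t ∈ Finset.range T, EF P ℓ ν t (init P) (tT ℓ P ν) ≤ 2 * P.L + T * (203 * (P.γ * Λ)) := by
  have hγ := H.γpos
  have hL := H.Lam0
  have hL1 := H.L1
  have h1 : ∀ t, EF P ℓ ν t (init P) (tT ℓ P ν) ≤ (if t < 2 * P.L then 1 else 0) + 203 * (P.γ * Λ) := by
    intro t
    split_ifs with h
    · have := tT_small H t
      have : 0 ≤ P.γ * Λ := by positivity
      linarith
    · have h2 : 2 ≤ t / P.L := by rw [Nat.le_div_iff_mul_le (by omega)]; omega
      obtain ⟨e, he⟩ : ∃ e, t / P.L = e + 1 + 1 := ⟨t / P.L - 2, by omega⟩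
      have hd := Nat.div_add_mod t P.L
      rw [he, mul_comm] at hd
      rw [← hd, zero_add]
      exact tT_big H e _ (Nat.mod_lt _ (by omega))
  refine (Finset.sum_le_sum fun t _ => h1 t).trans ?_
  rw [Finset.sum_add_distrib]
  refine add_le_add ?_ (by simp)
  rw [← Finset.sum_filter]
  simp only [Finset.sum_const, nsmul_eq_mul, mul_one]
  have : ((Finset.range T).filter (fun t => t < 2 * P.L)).card ≤ 2 * P.L := by
    refine (Finset.card_le_card (t := Finset.range (2 * P.L)) ?_).trans (by simp)
    intro t
    simp
  exact_mod_cast this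

theorem regret_total (H : Hyp P ℓ ν Λ) (π : C → A) (T : ℕ) :
    ∑ t ∈ Finset.range T, EF P ℓ ν t (init P)
      (fun σ => ∑ x, ker P ν σ x * (ℓ σ.n x.1 x.2 - ℓ σ.n x.1 (π x.1))) ≤
    30 * P.L * Real.log (Fintype.card A) + P.eta * (T * (18 * Λ)) +
      (2 * P.L + T * (203 * (P.γ * Λ))) := by
  have he := H.etapos
  have h1 := pot_total H π T
  have h2 := tT_total H T
  have h3 : ∑ t ∈ Finset.range T, EF P ℓ ν t (init P) (tV P ν) ≤ T * (18 * Λ) := by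
    refine (Finset.sum_le_sum fun t _ => tV_le H t).trans (by simp)
  have h4 : ∑ t ∈ Finset.range T, EF P ℓ ν t (init P) (tI ℓ P ν π) ≤ 0 :=
    Finset.sum_nonpos fun t _ => tI_le H π t
  have h5 := mul_le_mul_of_nonneg_left h3 he.le
  simp only [decomp]
  simp only [EF] at *
  have e : ∀ t, Ex (ker P ν) (full P ℓ) t (init P)
      (fun σ => dd P ℓ ν π σ + (P.eta * tV P ν σ + (tT ℓ P ν σ + tI ℓ P ν π σ))) =
      Ex (ker P ν) (full P ℓ) t (init P) (dd P ℓ ν π) + (P.eta * Ex (ker P ν) (full P ℓ) t (init P) (tV P ν)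
      + (Ex (ker P ν) (full P ℓ) t (init P) (tT ℓ P ν) + Ex (ker P ν) (full P ℓ) t (init P) (tI ℓ P ν π))) := by
    intro t
    rw [Ex_add, Ex_add, Ex_smul, Ex_add]
  simp only [e, Finset.sum_add_distrib, ← Finset.mul_sum]
  linarith

end Third

section Link
variable {C A : Type} [Fintype C] [Fintype A] [DecidableEq A] [Nonempty A]
variable {P : Par A}

lemma run_n (ℓ : ℕ → C → A → ℝ) (t : ℕ) (w : Fin t → C × A) :
    (runS (full P ℓ) (init P) t w).n = t := by
  induction t with
  | zero => rfl
  | succ t ih => rw [runS, full_n, ih]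

lemma inner_congr (ℓ1 ℓ2 : ℕ → C → A → ℝ) (σ : St C A) (x : C × A)
    (h : ∀ c a, P.E x.2 a → ℓ1 σ.n c a = ℓ2 σ.n c a) : inner' P ℓ1 σ x = inner' P ℓ2 σ x := by
  unfold inner'
  congr 1
  funext c a
  by_cases hE : P.E x.2 a
  · rw [h c a hE]
  · have : uu P σ x a = 0 := by unfold uu; simp [hE]
    simp [this]

lemma run_congr (ℓ1 ℓ2 : ℕ → C → A → ℝ) (t : ℕ) (w : Fin t → C × A)
    (h : ∀ (s : Fin t) c a, P.E (w s).2 a → ℓ1 s.1 c a = ℓ2 s.1 c a) :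
    runS (full P ℓ1) (init P) t w = runS (full P ℓ2) (init P) t w := by
  induction t with
  | zero => rfl
  | succ t ih =>
    rw [runS, runS, ih (fun i => w i.castSucc) (fun s c a hE => h s.castSucc c a hE)]
    have hn := run_n (P := P) ℓ2 t (fun i => w i.castSucc)
    generalize runS (full P ℓ2) (init P) t (fun i => w i.castSucc) = σ at hn
    unfold full
    rw [inner_congr ℓ1 ℓ2 _ _ (fun c a hE => by
      rw [hn]
      exact h (Fin.last t) c a hE)]

end Link

lemma params (K T α : ℕ) (hK : 2 ≤ K) (hT : 2 ≤ T) (ha1 : 1 ≤ α) (haK : α ≤ K) :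
    ∃ (L : ℕ) (γ : ℝ), 1 ≤ L ∧ 0 < γ ∧ 2 < γ * L ∧ Real.exp (-4 * (γ * L)) ≤ 1 / L ∧
      2 * α * Real.log ((1 + γ) / γ) ≤ 4 * α * Real.log (K * T) ∧
      30 * L * Real.log K + 1 / (30 * L) * (T * (18 * (4 * α * Real.log (K * T)))) +
      (2 * L + T * (203 * (γ * (4 * α * Real.log (K * T))))) ≤
        1700 * Real.sqrt (α * T) * Real.log (K * T) ^ 2 := by
  have hK' : (2:ℝ) ≤ K := by exact_mod_cast hK
  have hT' : (2:ℝ) ≤ T := by exact_mod_cast hT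
  have ha' : (1:ℝ) ≤ α := by exact_mod_cast ha1
  have haK' : (α:ℝ) ≤ K := by exact_mod_cast haK
  have hN : (4:ℝ) ≤ K * T := by nlinarith
  set N : ℝ := K * T with hNd
  set lg := Real.log N with hlg
  have hlg1 : 1 < lg := by
    have h1 : Real.log 4 ≤ lg := Real.log_le_log (by norm_num) hN
    have h2 : Real.log 4 = 2 * Real.log 2 := by
      rw [show (4:ℝ) = 2 ^ 2 by norm_num, Real.log_pow]; norm_num
    linarith [Real.log_two_gt_d9]
  have hlK : Real.log K ≤ lg := Real.log_le_log (by linarith) (by nlinarith)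
  set R := Real.sqrt (α * T) with hR
  have hRR : R ^ 2 = α * T := Real.sq_sqrt (by positivity)
  have hR0 : 0 ≤ R := Real.sqrt_nonneg _
  have hR1 : 1 ≤ R := by
    rw [hR]; apply Real.one_le_sqrt.2; nlinarith
  have hRN : R ≤ N := by
    have : R ^ 2 ≤ N := by rw [hRR, hNd]; gcongr
    nlinarith
  obtain ⟨L, hL⟩ : ∃ L, L = ⌈R⌉₊ := ⟨_, rfl⟩
  have hL1 : R ≤ L := by rw [hL]; exact Nat.le_ceil R
  have hL2 : (L:ℝ) ≤ 2 * R := by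
    have := Nat.ceil_lt_add_one hR0
    rw [← hL] at this
    linarith
  have hL0 : (1:ℝ) ≤ L := hR1.trans hL1
  have hgL : 2 * lg / L * L = 2 * lg := by field_simp
  have hN0 : 0 < N := by linarith
  have hg0 : 0 < 2 * lg / L := by positivity
  refine ⟨L, 2 * lg / L, by exact_mod_cast hL0, hg0, by rw [hgL]; linarith, ?_, ?_, ?_⟩
  · rw [hgL]
    have : Real.exp (-4 * (2 * lg)) = 1 / N ^ 8 := by
      rw [show -4 * (2 * lg) = -(((8:ℕ):ℝ) * lg) by push_cast; ring, Real.exp_neg, Real.exp_nat_mul,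
        hlg, Real.exp_log hN0, one_div]
    rw [this]
    apply one_div_le_one_div_of_le (by linarith)
    calc (L:ℝ) ≤ N ^ 2 := by nlinarith
      _ ≤ N ^ 8 := pow_le_pow_right₀ (by linarith) (by norm_num)
  · have h1 : (1 + 2 * lg / L) / (2 * lg / L) ≤ N ^ 2 := by
      rw [div_le_iff₀ hg0]
      have : 1 ≤ 2 * N * (2 * lg / L) := by
        rw [← mul_div_assoc, le_div_iff₀ (by linarith)]
        nlinarith
      have : (1 + 2 * N) * (2 * lg / L) ≤ N ^ 2 * (2 * lg / L) := by
        gcongr; nlinarith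
      linarith
    have h2 : Real.log ((1 + 2 * lg / L) / (2 * lg / L)) ≤ 2 * lg := by
      have := Real.log_le_log (by positivity) h1
      rw [Real.log_pow] at this
      exact_mod_cast this
    nlinarith
  · have hq : (α:ℝ) * T / L ≤ R := by
      rw [← hRR, div_le_iff₀ (by linarith)]; nlinarith
    have e1 : 1 / (30 * (L:ℝ)) * (T * (18 * (4 * α * lg))) = 12 / 5 * ((α * T / L) * lg) := by
      field_simp; ring
    have e2 : (T:ℝ) * (203 * (2 * lg / L * (4 * α * lg))) = 1624 * ((α * T / L) * lg ^ 2) := by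
      field_simp; ring
    rw [e1, e2]
    have b1 : (α:ℝ) * T / L * lg ≤ R * lg ^ 2 := by
      calc (α:ℝ) * T / L * lg ≤ R * lg := by gcongr
        _ ≤ R * lg ^ 2 := by gcongr; nlinarith
    have b2 : (α:ℝ) * T / L * lg ^ 2 ≤ R * lg ^ 2 := by gcongr
    have b3 : (L:ℝ) * Real.log K ≤ 2 * (R * lg ^ 2) := by
      have : 0 ≤ Real.log K := Real.log_nonneg (by linarith)
      calc (L:ℝ) * Real.log K ≤ (2 * R) * lg := by gcongr
        _ ≤ (2 * R) * lg ^ 2 := by gcongr; nlinarith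
        _ = _ := by ring
    have b4 : (L:ℝ) ≤ 2 * (R * lg ^ 2) := by
      have : R * 1 ≤ R * lg ^ 2 := by gcongr; nlinarith
      linarith
    have : 0 ≤ R * lg ^ 2 := by positivity
    linarith

/-- Main theorem: there is a universal constant `C > 0` such that for every `K ≥ 2`,
`M ≥ 1`, `T ≥ 2` and every directed feedback graph on `[K]` with all self-loops,
there is a randomized learning algorithm (a map from the observation history — past
contexts, past plays, and the losses revealed by the graphical cross-learning
feedback — and the current context to a distribution over arms) whose expected
regret, against every `[0,1]`-valued oblivious loss assignment, every i.i.d. context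
distribution `ν`, and every policy `π`, is at most `C √(α T) (log (K T))²`, where `α`
is the independence number of the feedback graph. The expectation is the explicit
sum over trajectories `(cs, as)` weighted by the joint law
`∏_t ν(cs_t) · Alg(history_t, cs_t)(as_t)`, where the history at round `t` consists
of the contexts `cs_s`, plays `as_s` and revealed losses
`ℓ_{s,c}(a)` for `a ∈ N_out(as_s)` (encoded as an `Option ℝ`-valued table), `s < t`. -/
theorem stmt0 :
    ∃ C : ℝ, 0 < C ∧
      ∀ (K M T : ℕ), 2 ≤ K → 1 ≤ M → 2 ≤ T →
      ∀ (E : Fin K → Fin K → Prop) [DecidableRel E], (∀ a, E a a) →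
      ∃ Alg : (t : ℕ) → t < T → (Fin t → Fin M) → (Fin t → Fin K) →
          (Fin t → Fin M → Fin K → Option ℝ) → Fin M → Fin K → ℝ,
        (∀ t ht cs as fb c, (∀ k, 0 ≤ Alg t ht cs as fb c k) ∧
            (∑ k, Alg t ht cs as fb c k) = 1) ∧
        ∀ (ℓ : Fin T → Fin M → Fin K → ℝ), (∀ t c a, ℓ t c a ∈ Set.Icc (0 : ℝ) 1) →
        ∀ (ν : Fin M → ℝ), (∀ c, 0 ≤ ν c) → (∑ c, ν c = 1) →
        ∀ (π : Fin M → Fin K) (α : ℕ),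
          IsGreatest {n | ∃ S : Finset (Fin K),
            (∀ i ∈ S, ∀ j ∈ S, i ≠ j → ¬ E i j) ∧ S.card = n} α →
        (∑ cs : Fin T → Fin M, ∑ as : Fin T → Fin K,
          (∏ t : Fin T, ν (cs t) *
            Alg t.1 t.isLt
              (fun s => cs ⟨s.1, lt_trans s.isLt t.isLt⟩)
              (fun s => as ⟨s.1, lt_trans s.isLt t.isLt⟩)
              (fun s c a => if E (as ⟨s.1, lt_trans s.isLt t.isLt⟩) a
                then some (ℓ ⟨s.1, lt_trans s.isLt t.isLt⟩ c a) else none)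
              (cs t) (as t)) *
          (∑ t : Fin T, (ℓ t (cs t) (as t) - ℓ t (cs t) (π (cs t))))) ≤
        C * Real.sqrt (α * T) * (Real.log (K * T)) ^ 2 := by
  refine ⟨1700, by norm_num, ?_⟩
  intro K M T hK hM hT E hdec hrefl
  haveI : Nonempty (Fin K) := ⟨⟨0, by omega⟩⟩
  obtain ⟨α0, hα0⟩ : ∃ α0, IsGreatest {n | ∃ S : Finset (Fin K),
            (∀ i ∈ S, ∀ j ∈ S, i ≠ j → ¬ E i j) ∧ S.card = n} α0 := by
    have hb : BddAbove {n | ∃ S : Finset (Fin K),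
            (∀ i ∈ S, ∀ j ∈ S, i ≠ j → ¬ E i j) ∧ S.card = n} := by
      refine ⟨K, ?_⟩
      rintro n ⟨S, _, rfl⟩
      simpa using Finset.card_le_univ S
    exact ⟨_, Nat.sSup_mem ⟨0, ∅, by simp, rfl⟩ hb, fun n hn => le_csSup hb hn⟩
  have hal : ∀ S : Finset (Fin K), (∀ i ∈ S, ∀ j ∈ S, i ≠ j → ¬ E i j) → S.card ≤ α0 :=
    fun S hS => hα0.2 ⟨S, hS, rfl⟩
  have ha1 : 1 ≤ α0 := by
    have := hal {⟨0, by omega⟩} (by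
      intro i hi j hj hij
      rw [Finset.mem_singleton] at hi hj
      exact absurd (hi.trans hj.symm) hij)
    simpa using this
  have haK : α0 ≤ K := by
    obtain ⟨S, _, hS⟩ := hα0.1
    rw [← hS]
    simpa using Finset.card_le_univ S
  obtain ⟨L, γ, pL, pγ, pγL, pe, pl, pf⟩ := params K T α0 hK hT ha1 haK
  let P : Par (Fin K) := ⟨E, hdec, γ, L⟩
  refine ⟨fun t ht cs as fb c k => pol P (runS (full P (fun s c a =>
    if h : s < t then (fb ⟨s, h⟩ c a).getD 0 else 0)) (init P) t
      (fun s => (cs s, as s))).th c k, ?_, ?_⟩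
  · intro t ht cs as fb c
    exact ⟨fun k => (pol_pos _ _ _).le, pol_sum _ _⟩
  intro ℓ hℓ ν hν hν1 π α hα
  have hαe : α = α0 := hα.unique hα0
  subst hαe
  let ℓe : ℕ → Fin M → Fin K → ℝ := fun t c a => if h : t < T then ℓ ⟨t, h⟩ c a else 0
  have H : Hyp P ℓe ν (4 * α * Real.log (K * T)) :=
    { L1 := pL
      γL := pγL
      ecap := pe
      l0 := fun t c a => by
        simp only [ℓe]; split_ifs <;> [exact (hℓ _ _ _).1; exact le_rfl]
      l1 := fun t c a => by
        simp only [ℓe]; split_ifs <;> [exact (hℓ _ _ _).2; exact zero_le_one]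
      ν0 := hν
      ν1 := hν1
      refl := hrefl
      gr := fun w hw hw1 => (graph_lemma E hrefl w hw hw1 α hal ha1 γ pγ).trans pl }
  have key := regret_total H π T
  rw [← traj_reward (ker_sum H) (init P) T
    (fun σ x => ℓe σ.n x.1 x.2 - ℓe σ.n x.1 (π x.1))] at key
  rw [Fintype.card_fin] at key
  refine le_trans (le_of_eq ?_) (key.trans pf)
  rw [← Fintype.sum_prod_type' (f := fun (cs : Fin T → Fin M) (as : Fin T → Fin K) => _)]
  rw [← (Equiv.arrowProdEquivProdArrow (Fin T) (fun _ => Fin M) (fun _ => Fin K)).sum_comp]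
  refine Finset.sum_congr rfl fun w _ => ?_
  congr 1
  · refine Finset.prod_congr rfl fun t _ => ?_
    simp only [ker, Equiv.arrowProdEquivProdArrow, Equiv.coe_fn_mk]
    rw [run_congr (P := P) _ ℓe]
    intro s c a hE
    have hs : s.1 < t.1 := s.isLt
    have hs2 : s.1 < T := hs.trans t.isLt
    have hE' : E (w ⟨s.1, hs2⟩).2 a := hE
    simp [ℓe, hs2, hE']
  · refine Finset.sum_congr rfl fun t _ => ?_
    simp only [run_n, Equiv.arrowProdEquivProdArrow, Equiv.coe_fn_mk, ℓe, t.isLt, dif_pos]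
end

section
/- Consider the known-distribution algorithm: for each round t ∈ [T] and each context c ∈ [M], set p_{t,c}(a) ∝ exp(−η Σ_{s<t} ℓ̃_{s,c}(a)) (the FTRL iterate with unnormalized negative entropy regularizer and learning rate η > 0); after observing c_t ~ ν, play a_t ~ p_{t,c_t}; set w_t(a) = Σ_{c∈[M]} ν(c)·p_{t,c}(N_in(a)) and define the importance-weighted estimator ℓ̃_{t,c}(a) = (ℓ_{t,c}(a)/w_t(a))·1[a_t ∈ N_in(a)] for all c, a. Then for every policy π : [M] → [K], the expected regret satisfies E[Σ_{t=1}^T (ℓ_{t,c_t}(a_t) − ℓ_{t,c_t}(π(c_t)))] ≤ (log K)/η + (η/2)·E[Σ_{t=1}^T Σ_{a∈[K]} p̄_t(a)/w_t(a)], where p̄_t(a) = Σ_{c∈[M]} ν(c)·p_{t,c}(a). -/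
open Finset


lemma aux_exp {x : ℝ} (hx : 0 ≤ x) : Real.exp (-x) ≤ 1 - x + x ^ 2 / 2 := by
  have h := Real.quadratic_le_exp_of_nonneg hx
  rw [Real.exp_neg, inv_le_iff_one_le_mul₀ (Real.exp_pos x)]
  have h2 : 0 < 1 - x + x ^ 2 / 2 := by nlinarith [sq_nonneg (x - 1)]
  calc (1:ℝ) ≤ (1 - x + x ^ 2 / 2) * (1 + x + x ^ 2 / 2) := by nlinarith [sq_nonneg (x ^ 2)]
    _ ≤ _ := mul_le_mul_of_nonneg_left h h2.le

lemma aux_cons {X : Type*} [Fintype X] {T : ℕ} (F : (Fin (T + 1) → X) → ℝ) :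
    ∑ z, F z = ∑ x, ∑ z : Fin T → X, F (Fin.cons x z) := by
  rw [← (Fin.consEquiv (fun _ => X)).sum_comp, Fintype.sum_prod_type]
  rfl

lemma aux_mass {X : Type*} [Fintype X] [Nonempty X] (T : ℕ) : ∀ (q : Fin T → (Fin T → X) → X → ℝ)
    (_ : ∀ t z z', (∀ s, s < t → z s = z' s) → q t z = q t z')
    (_ : ∀ t z, ∑ x, q t z x = 1), ∑ z : Fin T → X, ∏ s, q s z (z s) = 1 := by
  induction T with
  | zero => intro q _ _; simp
  | succ T ih =>
    intro q hq h1
    rw [aux_cons]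
    simp only [Fin.prod_univ_succ, Fin.cons_zero, Fin.cons_succ]
    obtain ⟨x0⟩ := ‹Nonempty X›
    have h0 : ∀ z, q 0 z = q 0 (fun _ => x0) := fun z => hq 0 _ _ (fun s hs => by simp at hs)
    rw [← h1 0 (fun _ => x0)]
    refine Finset.sum_congr rfl fun x _ => ?_
    have := ih (fun s z => q s.succ (Fin.cons x z)) ?_ (fun t z => h1 _ _)
    · simp only [h0, ← Finset.mul_sum]
      rw [this, mul_one]
    · intro t z z' h
      refine hq _ _ _ fun s hs => ?_
      induction s using Fin.cases with
      | zero => simp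
      | succ s => simpa using h s (by simpa using hs)

lemma aux_tower {X : Type*} [Fintype X] [Nonempty X] (T : ℕ) : ∀ (q : Fin T → (Fin T → X) → X → ℝ)
    (_ : ∀ t z z', (∀ s, s < t → z s = z' s) → q t z = q t z')
    (_ : ∀ t z, ∑ x, q t z x = 1) (t : Fin T) (f : (Fin T → X) → X → ℝ)
    (_ : ∀ z z', (∀ s, s < t → z s = z' s) → f z = f z'),
    ∑ z : Fin T → X, (∏ s, q s z (z s)) * f z (z t)
      = ∑ z : Fin T → X, (∏ s, q s z (z s)) * ∑ x, q t z x * f z x := by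
  induction T with
  | zero => intro q _ _ t; exact t.elim0
  | succ T ih =>
    intro q hq h1 t f hf
    have hq' : ∀ x : X, ∀ (t : Fin T) (z z' : Fin T → X), (∀ s, s < t → z s = z' s) →
        q t.succ (Fin.cons x z) = q t.succ (Fin.cons x z') := by
      intro x t z z' h
      refine hq _ _ _ fun s hs => ?_
      induction s using Fin.cases with
      | zero => simp
      | succ s => simpa using h s (by simpa using hs)
    rw [aux_cons, aux_cons]
    simp only [Fin.prod_univ_succ, Fin.cons_zero, Fin.cons_succ]
    obtain ⟨x0⟩ := ‹Nonempty X›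
    have h0 : ∀ z, q 0 z = q 0 (fun _ => x0) := fun z => hq 0 _ _ (fun s hs => by simp at hs)
    induction t using Fin.cases with
    | zero =>
      have hf0 : ∀ z, f z = f (fun _ => x0) := fun z => hf _ _ (fun s hs => by simp at hs)
      have hm := fun x : X => aux_mass T (fun s z => q s.succ (Fin.cons x z)) (hq' x)
        (fun t z => h1 _ _)
      have e : ∀ (g : X → ℝ), ∑ x, ∑ z : Fin T → X, (q 0 (Fin.cons x z) x *
          ∏ i : Fin T, q i.succ (Fin.cons x z) (z i)) * g x
          = ∑ x, q 0 (fun _ => x0) x * g x := by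
        intro g
        refine Finset.sum_congr rfl fun x _ => ?_
        have := hm x
        calc _ = ∑ z : Fin T → X, (q 0 (fun _ => x0) x * g x) *
              ∏ i : Fin T, q i.succ (Fin.cons x z) (z i) := by
              refine Finset.sum_congr rfl fun z _ => ?_
              rw [h0]; ring
          _ = _ := by rw [← Finset.mul_sum, this, mul_one]
      have e1 := e (f (fun _ => x0))
      have e2 := e (fun _ => ∑ x, q 0 (fun _ => x0) x * f (fun _ => x0) x)
      rw [← Finset.sum_mul, h1, one_mul] at e2
      simp only [Fin.cons_zero, hf0, h0] at e1 e2 ⊢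
      rw [e1, e2]
    | succ t =>
      refine Finset.sum_congr rfl fun x _ => ?_
      have := ih (fun s z => q s.succ (Fin.cons x z)) (hq' x) (fun t z => h1 _ _) t
        (fun z => f (Fin.cons x z)) (by
          intro z z' h
          refine hf _ _ fun s hs => ?_
          induction s using Fin.cases with
          | zero => simp
          | succ s => simpa using h s (by simpa using hs))
      simp only [h0, mul_assoc, Fin.cons_succ, ← Finset.mul_sum] at this ⊢
      rw [this]

lemma aux_hedge_nat (K : ℕ) (η : ℝ) (hη : 0 < η) (L : ℕ → Fin K → ℝ) (hL : ∀ t k, 0 ≤ L t k)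
    (p : ℕ → Fin K → ℝ) (hp : ∀ t k, p t k = Real.exp (-η * ∑ s ∈ range t, L s k) /
      ∑ k', Real.exp (-η * ∑ s ∈ range t, L s k')) (j : Fin K) (n : ℕ) :
    ∑ t ∈ range n, (∑ k, p t k * L t k - L t j) ≤
      Real.log K / η + η / 2 * ∑ t ∈ range n, ∑ k, p t k * L t k ^ 2 := by
  set Z : ℕ → ℝ := fun t => ∑ k', Real.exp (-η * ∑ s ∈ range t, L s k') with hZ
  have hZpos : ∀ t, 0 < Z t := fun t => Finset.sum_pos (fun _ _ => Real.exp_pos _) ⟨j, mem_univ _⟩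
  have hppos : ∀ t k, 0 ≤ p t k := fun t k => by
    rw [hp]; exact div_nonneg (Real.exp_pos _).le (hZpos t).le
  have hpsum : ∀ t, ∑ k, p t k = 1 := fun t => by
    simp only [hp]; rw [← Finset.sum_div]; exact div_self (hZpos t).ne'
  have hstep : ∀ t, Real.log (Z (t+1)) - Real.log (Z t) ≤
      -η * ∑ k, p t k * L t k + η ^ 2 / 2 * ∑ k, p t k * L t k ^ 2 := by
    intro t
    rw [← Real.log_div (hZpos _).ne' (hZpos _).ne']
    have e : Z (t+1) / Z t = ∑ k, p t k * Real.exp (-(η * L t k)) := by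
      simp only [hZ, hp, Finset.sum_div]
      refine Finset.sum_congr rfl fun k _ => ?_
      rw [Finset.sum_range_succ, mul_add, Real.exp_add, neg_mul η (L t k)]; ring
    have h1 := Real.log_le_sub_one_of_pos (div_pos (hZpos (t+1)) (hZpos t))
    refine h1.trans ?_
    rw [e]
    have h2 : ∑ k, p t k * Real.exp (-(η * L t k)) ≤
        ∑ k, p t k * (1 - η * L t k + (η * L t k) ^ 2 / 2) :=
      Finset.sum_le_sum fun k _ => mul_le_mul_of_nonneg_left
        (aux_exp (mul_nonneg hη.le (hL t k))) (hppos t k)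
    have h3 : ∑ k, p t k * (1 - η * L t k + (η * L t k) ^ 2 / 2) =
        1 + (-η * ∑ k, p t k * L t k + η ^ 2 / 2 * ∑ k, p t k * L t k ^ 2) := by
      conv_rhs => rw [← hpsum t]
      rw [Finset.mul_sum, Finset.mul_sum, ← Finset.sum_add_distrib,
        ← Finset.sum_add_distrib]
      refine Finset.sum_congr rfl fun k _ => ?_
      ring
    linarith
  have hs : Real.log (Z n) - Real.log (Z 0) ≤
      ∑ t ∈ range n, (-η * ∑ k, p t k * L t k + η ^ 2 / 2 * ∑ k, p t k * L t k ^ 2) := by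
    rw [← Finset.sum_range_sub (fun t => Real.log (Z t))]
    exact Finset.sum_le_sum fun t _ => hstep t
  have hZ0 : Z 0 = K := by simp [hZ]
  have hlow : -η * ∑ s ∈ range n, L s j ≤ Real.log (Z n) := by
    rw [Real.le_log_iff_exp_le (hZpos n)]
    exact Finset.single_le_sum (f := fun k => Real.exp (-η * ∑ s ∈ range n, L s k))
      (fun _ _ => (Real.exp_pos _).le) (mem_univ j)
  rw [Finset.sum_add_distrib, ← Finset.mul_sum, ← Finset.mul_sum, hZ0] at hs
  rw [Finset.sum_sub_distrib]
  have : Real.log K / η + η / 2 * ∑ t ∈ range n, ∑ k, p t k * L t k ^ 2 =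
    (Real.log K + η ^ 2 / 2 * ∑ t ∈ range n, ∑ k, p t k * L t k ^ 2) / η := by
      field_simp
  rw [this, le_div_iff₀ hη]
  linarith

lemma aux_hedge (K T : ℕ) (η : ℝ) (hη : 0 < η) (L : Fin T → Fin K → ℝ) (hL : ∀ t k, 0 ≤ L t k)
    (p : Fin T → Fin K → ℝ) (hp : ∀ t k, p t k =
      Real.exp (-η * ∑ s ∈ univ.filter (fun s => s < t), L s k) /
      ∑ k', Real.exp (-η * ∑ s ∈ univ.filter (fun s => s < t), L s k')) (j : Fin K) :
    ∑ t, (∑ k, p t k * L t k - L t j) ≤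
      Real.log K / η + η / 2 * ∑ t, ∑ k, p t k * L t k ^ 2 := by
  set L' : ℕ → Fin K → ℝ := fun n k => if h : n < T then L ⟨n, h⟩ k else 0 with hL'
  have hLL : ∀ (t : Fin T) k, L' t k = L t k := fun t k => by simp [hL']
  set p' : ℕ → Fin K → ℝ := fun t k => Real.exp (-η * ∑ s ∈ range t, L' s k) /
      ∑ k', Real.exp (-η * ∑ s ∈ range t, L' s k') with hp'
  have hs : ∀ (t : Fin T) k, ∑ s ∈ univ.filter (fun s => s < t), L s k =
      ∑ s ∈ range t, L' s k := by
    intro t k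
    rw [Finset.sum_filter]
    have := Fin.sum_univ_eq_sum_range (fun n => if n < (t:ℕ) then L' n k else 0) T
    simp only [hLL] at this
    simp only [Fin.lt_def]
    rw [this, ← Finset.sum_filter]
    congr 1
    ext n
    have := t.2
    simp only [mem_filter, mem_range]; omega
  have hpp : ∀ (t : Fin T) k, p' t k = p t k := fun t k => by
    rw [hp]; simp only [hs, hp']
  have := aux_hedge_nat K η hη L' (fun t k => by
    simp only [hL']; split_ifs
    · exact hL _ _
    · exact le_rfl) p' (fun _ _ => rfl) j T
  rw [← Fin.sum_univ_eq_sum_range (fun t => ∑ k, p' t k * L' t k - L' t j),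
    ← Fin.sum_univ_eq_sum_range (fun t => ∑ k, p' t k * L' t k ^ 2)] at this
  simpa only [hpp, hLL] using this

/-- Regret bound of the known-distribution algorithm. The algorithm is specified by
the defining equations for the FTRL iterates `p`, the observation probabilities
(importance weights) `w`, and the importance-weighted estimators `est = ℓ̃`; all
three are functions of the trajectory `(cs, as)` (the equations force them to
depend only on the relevant prefix). The expected regret (an explicit sum over
trajectories weighted by the joint law `∏_t ν(cs_t) p_{t,cs_t}(as_t)`) is at most
`log K / η + (η/2) E[∑_t ∑_a p̄_t(a)/w_t(a)]` where `p̄_t(a) = ∑_c ν(c) p_{t,c}(a)`. -/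
theorem stmt1 (K M T : ℕ) (hK : 1 ≤ K)
    (E : Fin K → Fin K → Prop) [DecidableRel E] (hself : ∀ a, E a a)
    (η : ℝ) (hη : 0 < η)
    (ℓ : Fin T → Fin M → Fin K → ℝ) (hℓ : ∀ t c a, ℓ t c a ∈ Set.Icc (0 : ℝ) 1)
    (ν : Fin M → ℝ) (hν0 : ∀ c, 0 ≤ ν c) (hν1 : ∑ c, ν c = 1)
    (p : Fin T → (Fin T → Fin M) → (Fin T → Fin K) → Fin M → Fin K → ℝ)
    (w : Fin T → (Fin T → Fin M) → (Fin T → Fin K) → Fin K → ℝ)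
    (est : Fin T → (Fin T → Fin M) → (Fin T → Fin K) → Fin M → Fin K → ℝ)
    (hp : ∀ t cs as c k, p t cs as c k =
      Real.exp (-η * ∑ s ∈ univ.filter (fun s => s < t), est s cs as c k) /
        ∑ k', Real.exp (-η * ∑ s ∈ univ.filter (fun s => s < t), est s cs as c k'))
    (hw : ∀ t cs as k, w t cs as k =
      ∑ c, ν c * ∑ v ∈ univ.filter (fun v => E v k), p t cs as c v)
    (hest : ∀ t cs as c k, est t cs as c k =
      (ℓ t c k / w t cs as k) * (if E (as t) k then 1 else 0))
    (π : Fin M → Fin K) :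
    (∑ cs : Fin T → Fin M, ∑ as : Fin T → Fin K,
      (∏ t, ν (cs t) * p t cs as (cs t) (as t)) *
        (∑ t, (ℓ t (cs t) (as t) - ℓ t (cs t) (π (cs t))))) ≤
      Real.log K / η + η / 2 *
        (∑ cs : Fin T → Fin M, ∑ as : Fin T → Fin K,
          (∏ t, ν (cs t) * p t cs as (cs t) (as t)) *
            (∑ t, ∑ a, (∑ c, ν c * p t cs as c a) / w t cs as a)) := by
  classical
  obtain ⟨c0, hc0⟩ : ∃ c, 0 < ν c := by
    by_contra! h
    have : ∑ c, ν c ≤ 0 := Finset.sum_nonpos fun c _ => h c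
    linarith
  have hKne : Nonempty (Fin K) := ⟨⟨0, hK⟩⟩
  have hXne : Nonempty (Fin M × Fin K) := ⟨(c0, ⟨0, hK⟩)⟩
  -- prefix dependence
  have hpre : ∀ t cs as cs' as', (∀ s, s < t → as s = as' s) → p t cs as = p t cs' as' := by
    intro t
    induction t using WellFoundedLT.induction with
    | ind t ih =>
      intro cs as cs' as' h
      have he : ∀ c k, ∑ s ∈ univ.filter (fun s => s < t), est s cs as c k =
          ∑ s ∈ univ.filter (fun s => s < t), est s cs' as' c k := by
        intro c k
        refine Finset.sum_congr rfl fun s hs => ?_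
        have hs : s < t := by simpa using hs
        rw [hest, hest, hw, hw, ih s hs cs as cs' as' (fun r hr => h r (hr.trans hs)), h s hs]
      funext c k
      rw [hp, hp]
      simp only [he]
  have hwpre : ∀ t cs as cs' as', (∀ s, s < t → as s = as' s) → w t cs as = w t cs' as' := by
    intro t cs as cs' as' h
    funext k
    rw [hw, hw, hpre t cs as cs' as' h]
  have hZpos : ∀ t cs as c, 0 < ∑ k', Real.exp (-η * ∑ s ∈ univ.filter (fun s => s < t),
      est s cs as c k') := fun t cs as c =>
    Finset.sum_pos (fun _ _ => Real.exp_pos _) univ_nonempty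
  have hppos : ∀ t cs as c k, 0 < p t cs as c k := fun t cs as c k => by
    rw [hp]; exact div_pos (Real.exp_pos _) (hZpos t cs as c)
  have hpsum : ∀ t cs as c, ∑ k, p t cs as c k = 1 := fun t cs as c => by
    simp only [hp]; rw [← Finset.sum_div]; exact div_self (hZpos t cs as c).ne'
  have hwpos : ∀ t cs as k, 0 < w t cs as k := fun t cs as k => by
    rw [hw]
    have hin : ∀ c, 0 < ∑ v ∈ univ.filter (fun v => E v k), p t cs as c v := fun c =>
      Finset.sum_pos (fun _ _ => hppos _ _ _ _ _) ⟨k, by simp [hself]⟩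
    exact Finset.sum_pos' (fun c _ => mul_nonneg (hν0 c) (hin c).le)
      ⟨c0, mem_univ _, mul_pos hc0 (hin c0)⟩
  have hestnn : ∀ t cs as c k, 0 ≤ est t cs as c k := fun t cs as c k => by
    rw [hest]
    refine mul_nonneg (div_nonneg (hℓ t c k).1 (hwpos _ _ _ _).le) ?_
    split_ifs <;> norm_num
  -- pass to trajectories in the product
  have hconv : ∀ F : (Fin T → Fin M) → (Fin T → Fin K) → ℝ, ∑ cs, ∑ as, F cs as =
      ∑ z : Fin T → Fin M × Fin K, F (fun t => (z t).1) (fun t => (z t).2) := by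
    intro F
    rw [← Fintype.sum_prod_type' F]
    rw [← (Equiv.arrowProdEquivProdArrow (Fin T) (fun _ => Fin M) (fun _ => Fin K)).sum_comp]
    rfl
  rw [hconv, hconv]
  set P : Fin T → (Fin T → Fin M × Fin K) → Fin M → Fin K → ℝ :=
    fun t z => p t (fun t => (z t).1) (fun t => (z t).2) with hP
  set w' : Fin T → (Fin T → Fin M × Fin K) → Fin K → ℝ :=
    fun t z => w t (fun t => (z t).1) (fun t => (z t).2) with hw'
  set e' : Fin T → (Fin T → Fin M × Fin K) → Fin M → Fin K → ℝ :=
    fun t z => est t (fun t => (z t).1) (fun t => (z t).2) with he'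
  set q : Fin T → (Fin T → Fin M × Fin K) → (Fin M × Fin K) → ℝ :=
    fun t z x => ν x.1 * P t z x.1 x.2 with hq
  set W : (Fin T → Fin M × Fin K) → ℝ := fun z => ∏ t, q t z (z t) with hW
  change ∑ z, W z * (∑ t, (ℓ t (z t).1 (z t).2 - ℓ t (z t).1 (π (z t).1))) ≤
    Real.log K / η + η / 2 * ∑ z, W z * (∑ t, ∑ a, (∑ c, ν c * P t z c a) / w' t z a)
  have hPpre : ∀ t z z', (∀ s, s < t → z s = z' s) → P t z = P t z' := fun t z z' h =>
    hpre _ _ _ _ _ fun s hs => by rw [h s hs]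
  have hw'pre : ∀ t z z', (∀ s, s < t → z s = z' s) → w' t z = w' t z' := fun t z z' h =>
    hwpre _ _ _ _ _ fun s hs => by rw [h s hs]
  have hqpre : ∀ t z z', (∀ s, s < t → z s = z' s) → q t z = q t z' := fun t z z' h => by
    simp only [hq, hPpre t z z' h]
  have hPsum : ∀ t z c, ∑ k, P t z c k = 1 := fun t z c => hpsum _ _ _ _
  have hqsum : ∀ t z, ∑ x, q t z x = 1 := fun t z => by
    simp only [hq, Fintype.sum_prod_type, ← Finset.mul_sum, hPsum, mul_one, hν1]
  have hWnn : ∀ z, 0 ≤ W z := fun z =>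
    Finset.prod_nonneg fun t _ => mul_nonneg (hν0 _) (hppos _ _ _ _ _).le
  have hmass : ∑ z, W z = 1 := aux_mass T q hqpre hqsum
  have htow := aux_tower T q hqpre hqsum
  have hw'pos : ∀ t z a, 0 < w' t z a := fun t z a => hwpos _ _ _ _
  have he'eq : ∀ t z c a, e' t z c a =
      (ℓ t c a / w' t z a) * (if E (z t).2 a then 1 else 0) := fun t z c a => hest _ _ _ _ _
  -- observation lemma
  have hobs : ∀ t (B : (Fin T → Fin M × Fin K) → Fin K → ℝ),
      (∀ z z', (∀ s, s < t → z s = z' s) → B z = B z') →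
      ∑ z, W z * ∑ a, B z a * (if E (z t).2 a then 1 else 0) =
      ∑ z, W z * ∑ a, B z a * w' t z a := by
    intro t B hB
    rw [htow t (fun z x => ∑ a, B z a * (if E x.2 a then 1 else 0))
      (fun z z' h => by simp only [hB z z' h])]
    refine Finset.sum_congr rfl fun z _ => ?_
    congr 1
    simp only [Finset.mul_sum]
    rw [Finset.sum_comm]
    refine Finset.sum_congr rfl fun a _ => ?_
    have : w' t z a = ∑ x, q t z x * (if E x.2 a then 1 else 0) := by
      simp only [hw', hw, Fintype.sum_prod_type, hq]
      refine Finset.sum_congr rfl fun c _ => ?_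
      rw [Finset.mul_sum, Finset.sum_filter]
      refine Finset.sum_congr rfl fun v _ => ?_
      split_ifs <;> simp [hP]
    rw [this, Finset.mul_sum]
    refine Finset.sum_congr rfl fun x _ => ?_
    ring
  -- regret terms
  have hA : ∀ t, ∑ z, W z * (ℓ t (z t).1 (z t).2 - ℓ t (z t).1 (π (z t).1)) =
      ∑ z, W z * ∑ c, ν c * (∑ a, P t z c a * e' t z c a - e' t z c (π c)) := by
    intro t
    rw [htow t (fun z x => ℓ t x.1 x.2 - ℓ t x.1 (π x.1)) (fun _ _ _ => rfl)]
    set B : (Fin T → Fin M × Fin K) → Fin K → ℝ := fun z a =>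
      ∑ c, ν c * ((P t z c a - if a = π c then 1 else 0) * (ℓ t c a / w' t z a)) with hBdef
    have h1 := hobs t B (fun z z' h => by simp only [hBdef, hPpre t z z' h, hw'pre t z z' h])
    have h2 : ∀ z, ∑ c, ν c * (∑ a, P t z c a * e' t z c a - e' t z c (π c)) =
        ∑ a, B z a * (if E (z t).2 a then 1 else 0) := by
      intro z
      simp only [hBdef, Finset.sum_mul]
      rw [Finset.sum_comm]
      refine Finset.sum_congr rfl fun c _ => ?_
      have : e' t z c (π c) = ∑ a, (if a = π c then 1 else 0) * e' t z c a := by simp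
      rw [this, ← Finset.sum_sub_distrib, Finset.mul_sum]
      refine Finset.sum_congr rfl fun a _ => ?_
      rw [he'eq]; ring
    simp only [h2]
    rw [h1]
    refine Finset.sum_congr rfl fun z _ => ?_
    congr 1
    simp only [hBdef, Finset.sum_mul]
    rw [Finset.sum_comm, Fintype.sum_prod_type]
    refine Finset.sum_congr rfl fun c _ => ?_
    have e1 : ∀ a, ν c * ((P t z c a - if a = π c then 1 else 0) * (ℓ t c a / w' t z a)) * w' t z a
        = ν c * (P t z c a * ℓ t c a) - ν c * ((if a = π c then 1 else 0) * ℓ t c a) := by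
      intro a
      have := (hw'pos t z a).ne'
      field_simp
    simp only [e1, hq, Finset.sum_sub_distrib, ← Finset.mul_sum, mul_sub, mul_assoc,
      ← Finset.sum_mul, hPsum]
    simp
  have hB : ∀ t, ∑ z, W z * ∑ c, ν c * ∑ a, P t z c a * e' t z c a ^ 2 ≤
      ∑ z, W z * ∑ a, (∑ c, ν c * P t z c a) / w' t z a := by
    intro t
    set B : (Fin T → Fin M × Fin K) → Fin K → ℝ := fun z a =>
      ∑ c, ν c * (P t z c a * (ℓ t c a / w' t z a) ^ 2) with hBdef
    have h1 := hobs t B (fun z z' h => by simp only [hBdef, hPpre t z z' h, hw'pre t z z' h])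
    have h2 : ∀ z, ∑ c, ν c * ∑ a, P t z c a * e' t z c a ^ 2 =
        ∑ a, B z a * (if E (z t).2 a then 1 else 0) := by
      intro z
      simp only [hBdef, Finset.sum_mul]
      rw [Finset.sum_comm]
      refine Finset.sum_congr rfl fun c _ => ?_
      rw [Finset.mul_sum]
      refine Finset.sum_congr rfl fun a _ => ?_
      rw [he'eq]
      split_ifs <;> ring
    simp only [h2]
    rw [h1]
    refine Finset.sum_le_sum fun z _ => mul_le_mul_of_nonneg_left ?_ (hWnn z)
    refine Finset.sum_le_sum fun a _ => ?_
    simp only [hBdef]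
    rw [Finset.sum_mul, Finset.sum_div]
    refine Finset.sum_le_sum fun c _ => ?_
    have hwp := hw'pos t z a
    have e1 : ν c * (P t z c a * (ℓ t c a / w' t z a) ^ 2) * w' t z a =
        (ν c * P t z c a / w' t z a) * ℓ t c a ^ 2 := by
      field_simp
    rw [e1]
    refine mul_le_of_le_one_right (div_nonneg (mul_nonneg (hν0 c) (hppos _ _ _ _ _).le) hwp.le) ?_
    exact pow_le_one₀ (hℓ t c a).1 (hℓ t c a).2
  have hhedge : ∀ z, ∑ t, ∑ c, ν c * (∑ a, P t z c a * e' t z c a - e' t z c (π c)) ≤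
      Real.log K / η + η / 2 * ∑ t, ∑ c, ν c * ∑ a, P t z c a * e' t z c a ^ 2 := by
    intro z
    have h := fun c => aux_hedge K T η hη (fun t k => e' t z c k) (fun t k => hestnn _ _ _ _ _)
      (fun t k => P t z c k) (fun t k => hp _ _ _ _ _) (π c)
    rw [Finset.sum_comm]
    rw [Finset.sum_comm (f := fun t c => ν c * ∑ a, P t z c a * e' t z c a ^ 2)]
    simp only [← Finset.mul_sum]
    calc _ ≤ ∑ c, ν c * (Real.log K / η + η / 2 * ∑ t, ∑ a, P t z c a * e' t z c a ^ 2) :=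
          Finset.sum_le_sum fun c _ => mul_le_mul_of_nonneg_left (h c) (hν0 c)
      _ = _ := by
        simp only [mul_add, Finset.sum_add_distrib]
        rw [← Finset.sum_mul, hν1, one_mul, Finset.mul_sum]
        congr 1
        refine Finset.sum_congr rfl fun c _ => ?_
        ring
  have hswap : ∀ F : (Fin T → Fin M × Fin K) → Fin T → ℝ,
      ∑ z, W z * ∑ t, F z t = ∑ t, ∑ z, W z * F z t := by
    intro F
    simp only [Finset.mul_sum]
    exact Finset.sum_comm
  rw [hswap]
  simp only [hA]
  rw [← hswap]
  calc _ ≤ ∑ z, W z * (Real.log K / η + η / 2 * ∑ t, ∑ c, ν c * ∑ a, P t z c a * e' t z c a ^ 2) :=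
        Finset.sum_le_sum fun z _ => mul_le_mul_of_nonneg_left (hhedge z) (hWnn z)
    _ = Real.log K / η +
        η / 2 * ∑ z, W z * ∑ t, ∑ c, ν c * ∑ a, P t z c a * e' t z c a ^ 2 := by
        simp only [mul_add, Finset.sum_add_distrib]
        rw [← Finset.sum_mul, hmass, one_mul, Finset.mul_sum]
        congr 1
        refine Finset.sum_congr rfl fun z _ => ?_
        ring
    _ ≤ _ := by
        refine add_le_add le_rfl (mul_le_mul_of_nonneg_left ?_ (by positivity))
        rw [hswap, hswap]
        exact Finset.sum_le_sum fun t _ => hB t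
end

section
/- Let G = (V, E) be a directed graph with |V| = K, in which each node i ∈ V is assigned a positive weight w_i. Assume Σ_{i∈V} w_i ≤ 1 and w_i ≥ ε for all i ∈ V, for some constant 0 < ε < 1/2. Then Σ_{i∈V} w_i / (w_i + Σ_{j∈N_in(i)} w_j) ≤ 4·α·ln(4K/(α·ε)), where α = α(G) is the independence number of G. -/
open Finset

theorem aux_indep {K : ℕ} (E : Fin K → Fin K → Prop) [DecidableRel E]
    (w : Fin K → ℝ) (hw : ∀ i, 0 < w i) (c : ℝ) (n : ℕ) :
    ∀ T : Finset (Fin K), T.card ≤ n →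
      (∀ i ∈ T, w i + ∑ j ∈ T with E j i, w j ≤ c) →
      ∃ I ⊆ T, (∀ i ∈ I, ∀ j ∈ I, i ≠ j → ¬ E i j) ∧ ∑ i ∈ T, w i ≤ 2 * c * I.card := by
  induction n with
  | zero =>
    intro T hT _
    have : T = ∅ := by simpa using hT
    subst this
    exact ⟨∅, by simp, by simp, by simp⟩
  | succ n ih =>
    intro T hT hc
    rcases T.eq_empty_or_nonempty with rfl | hne
    · exact ⟨∅, by simp, by simp, by simp⟩
    have hcomm : ∑ i ∈ T, w i * ∑ j ∈ T with E i j, w j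
        = ∑ i ∈ T, w i * ∑ j ∈ T with E j i, w j := by
      simp only [Finset.mul_sum, Finset.sum_filter]
      simp only [mul_ite, mul_zero, Finset.mul_sum]
      rw [Finset.sum_comm]
      refine Finset.sum_congr rfl fun i _ => Finset.sum_congr rfl fun j _ => ?_
      rw [mul_comm]
    have hav : ∃ i ∈ T, w i + (∑ j ∈ T with E j i, w j) + ∑ j ∈ T with E i j, w j ≤ 2 * c := by
      by_contra! hcon
      have h1 : ∑ i ∈ T, w i * (2 * c) <
          ∑ i ∈ T, w i * (w i + (∑ j ∈ T with E j i, w j) + ∑ j ∈ T with E i j, w j) :=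
        Finset.sum_lt_sum_of_nonempty hne fun i hi => mul_lt_mul_of_pos_left (hcon i hi) (hw i)
      have h2 : ∑ i ∈ T, w i * (w i + ∑ j ∈ T with E j i, w j) ≤ ∑ i ∈ T, w i * c :=
        Finset.sum_le_sum fun i hi => mul_le_mul_of_nonneg_left (hc i hi) (hw i).le
      have h3 : 0 ≤ ∑ i ∈ T, w i * w i :=
        Finset.sum_nonneg fun i _ => mul_nonneg (hw i).le (hw i).le
      have h4 : ∑ i ∈ T, w i * (2 * c) = 2 * ∑ i ∈ T, w i * c := by
        rw [Finset.mul_sum]; exact Finset.sum_congr rfl fun i _ => by ring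
      simp only [mul_add, Finset.sum_add_distrib] at h1 h2
      rw [hcomm] at h1
      linarith
    obtain ⟨i, hi, hic⟩ := hav
    let U := T.filter (fun j => ¬ (j = i ∨ E j i ∨ E i j))
    have hUT : U ⊆ T := Finset.filter_subset _ _
    have hiU : i ∉ U := by simp [U]
    have hcard : U.card < T.card :=
      Finset.card_lt_card ⟨hUT, fun h => hiU (h hi)⟩
    obtain ⟨I, hIU, hI, hIw⟩ := ih U (by omega) (by
      intro j hj
      refine le_trans ?_ (hc j (hUT hj))
      have : ∑ k ∈ U with E k j, w k ≤ ∑ k ∈ T with E k j, w k :=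
        Finset.sum_le_sum_of_subset_of_nonneg (Finset.filter_subset_filter _ hUT)
          fun k _ _ => (hw k).le
      linarith)
    have hiI : i ∉ I := fun h => hiU (hIU h)
    refine ⟨insert i I, ?_, ?_, ?_⟩
    · intro x hx
      rcases Finset.mem_insert.1 hx with rfl | hx
      · exact hi
      · exact hUT (hIU hx)
    · intro a ha b hb hab
      rcases Finset.mem_insert.1 ha with ha1 | ha1 <;> rcases Finset.mem_insert.1 hb with hb1 | hb1
      · exact absurd (ha1.trans hb1.symm) hab
      · subst ha1
        have := hIU hb1
        simp only [U, Finset.mem_filter] at this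
        tauto
      · subst hb1
        have := hIU ha1
        simp only [U, Finset.mem_filter] at this
        tauto
      · exact hI a ha1 b hb1 hab
    · rw [Finset.card_insert_of_notMem hiI]
      have hsplit := Finset.sum_filter_add_sum_filter_not T (fun j => j = i ∨ E j i ∨ E i j) w
      have hb : ∑ j ∈ T with (j = i ∨ E j i ∨ E i j), w j ≤
          w i + (∑ j ∈ T with E j i, w j) + ∑ j ∈ T with E i j, w j := by
        have e : w i = ∑ j ∈ T with j = i, w j := by
          rw [Finset.sum_filter, Finset.sum_ite_eq' T i w, if_pos hi]
        rw [e]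
        simp only [Finset.sum_filter, ← Finset.sum_add_distrib]
        refine Finset.sum_le_sum fun j _ => ?_
        have := hw j
        split_ifs <;> first | linarith | (exfalso; tauto)
      push_cast
      change _ + ∑ j ∈ U, w j = _ at hsplit
      linarith

theorem aux_main {K : ℕ} (E : Fin K → Fin K → Prop) [DecidableRel E]
    (w : Fin K → ℝ) (hw : ∀ i, 0 < w i) (ε : ℝ) (hε0 : 0 < ε) (hwε : ∀ i, ε ≤ w i)
    (α : ℕ) (hα0 : 1 ≤ α)
    (hα : ∀ S : Finset (Fin K), (∀ i ∈ S, ∀ j ∈ S, i ≠ j → ¬ E i j) → S.card ≤ α) (n : ℕ) :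
    ∀ S : Finset (Fin K), S.card = α + n →
      ∑ i ∈ S, w i / (w i + ∑ j ∈ S with E j i, w j)
        ≤ α + 2 * α * Real.log ((∑ i ∈ S, w i) / (α * ε)) := by
  have hαp : (0:ℝ) < α := by exact_mod_cast hα0
  have hd : ∀ (S : Finset (Fin K)) i, 0 ≤ ∑ j ∈ S with E j i, w j :=
    fun S i => Finset.sum_nonneg fun j _ => (hw j).le
  induction n with
  | zero =>
    intro S hS
    have h1 : ∑ i ∈ S, w i / (w i + ∑ j ∈ S with E j i, w j) ≤ ∑ i ∈ S, (1:ℝ) :=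
      Finset.sum_le_sum fun i _ => by
        have := hd S i
        have := hw i
        rw [div_le_one (by linarith)]; linarith
    have h2 : (α * ε : ℝ) ≤ ∑ i ∈ S, w i := by
      have := Finset.card_nsmul_le_sum S w ε fun i _ => hwε i
      simpa [hS] using this
    have h3 : 0 ≤ Real.log ((∑ i ∈ S, w i) / (α * ε)) :=
      Real.log_nonneg (by rwa [one_le_div (by positivity)])
    have h4 : ∑ i ∈ S, (1:ℝ) = α := by simp [hS]
    have : 0 ≤ 2 * α * Real.log ((∑ i ∈ S, w i) / (α * ε)) := by positivity
    linarith
  | succ n ih =>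
    intro S hS
    have hne : S.Nonempty := Finset.card_pos.1 (by omega)
    obtain ⟨i, hi, himax⟩ := Finset.exists_max_image S
      (fun i => w i + ∑ j ∈ S with E j i, w j) hne
    obtain ⟨I, _, hI, hIw⟩ := aux_indep E w hw _ _ S le_rfl himax
    have hIα : (I.card : ℝ) ≤ α := by exact_mod_cast hα I hI
    set c := w i + ∑ j ∈ S with E j i, w j with hcdef
    have hcpos : 0 < c := by have := hd S i; have := hw i; linarith
    have hW : ∑ i ∈ S, w i ≤ 2 * c * α := hIw.trans (by gcongr)
    have hcardE : (S.erase i).card = α + n := by rw [Finset.card_erase_of_mem hi]; omega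
    have hih := ih _ hcardE
    have hsum := Finset.add_sum_erase S w hi
    have hsum2 := Finset.add_sum_erase S (fun i => w i / (w i + ∑ j ∈ S with E j i, w j)) hi
    have hV : 0 < ∑ j ∈ S.erase i, w j :=
      Finset.sum_pos (fun j _ => hw j) (Finset.card_pos.1 (by omega))
    have hwi := hw i
    have hmono : ∑ k ∈ S.erase i, w k / (w k + ∑ j ∈ S with E j k, w j) ≤
        ∑ k ∈ S.erase i, w k / (w k + ∑ j ∈ S.erase i with E j k, w j) := by
      refine Finset.sum_le_sum fun k _ => ?_
      have h1 := hw k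
      have h2 := hd (S.erase i) k
      have : ∑ j ∈ S.erase i with E j k, w j ≤ ∑ j ∈ S with E j k, w j :=
        Finset.sum_le_sum_of_subset_of_nonneg
          (Finset.filter_subset_filter _ (Finset.erase_subset _ _)) fun k _ _ => (hw k).le
      exact div_le_div_of_nonneg_left h1.le (by linarith) (by linarith)
    set W := ∑ j ∈ S, w j
    set V := ∑ j ∈ S.erase i, w j
    have hWp : 0 < W := by linarith
    have hlog : Real.log (V / (α * ε)) = Real.log (W / (α * ε)) + Real.log (V / W) := by
      rw [← Real.log_mul (by positivity) (by positivity)]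
      congr 1; field_simp
    have hlog2 : Real.log (V / W) ≤ V / W - 1 := Real.log_le_sub_one_of_pos (by positivity)
    have hVW : V / W - 1 = - (w i / W) := by
      field_simp; linarith
    have hterm : w i / c ≤ 2 * α * (w i / W) := by
      rw [← mul_div_assoc, div_le_div_iff₀ hcpos hWp]
      nlinarith
    have h5 : 2 * α * Real.log (V / W) ≤ 2 * α * (- (w i / W)) := by
      rw [← hVW]; gcongr
    rw [← hsum2]
    rw [hlog] at hih
    change w i / c + _ ≤ _
    linarith

/-- Lemma 5 of Alon et al.: for a directed graph on `K` vertices with positive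
weights summing to at most 1 and each at least `ε`, the sum of
`w i / (w i + w(N_in(i)))` is at most `4 α ln (4K/(α ε))` where `α` is the
independence number. -/
theorem stmt2 (K : ℕ) (hK : 1 ≤ K) (E : Fin K → Fin K → Prop) [DecidableRel E]
    (w : Fin K → ℝ) (hw : ∀ i, 0 < w i) (hsum : ∑ i, w i ≤ 1)
    (ε : ℝ) (hε0 : 0 < ε) (hε : ε < 1 / 2) (hwε : ∀ i, ε ≤ w i)
    (α : ℕ)
    (hα : IsGreatest {n | ∃ S : Finset (Fin K),
        (∀ i ∈ S, ∀ j ∈ S, i ≠ j → ¬ E i j) ∧ S.card = n} α) :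
    ∑ i, w i / (w i + ∑ j ∈ univ.filter (fun j => E j i), w j)
      ≤ 4 * α * Real.log (4 * K / (α * ε)) := by
  obtain ⟨⟨S₀, hS₀, hS₀c⟩, hub⟩ := hα
  have hub' : ∀ S : Finset (Fin K), (∀ i ∈ S, ∀ j ∈ S, i ≠ j → ¬ E i j) → S.card ≤ α :=
    fun S hS => hub ⟨S, hS, rfl⟩
  have hα0 : 1 ≤ α := by
    have := hub' {⟨0, hK⟩} (by
      intro i hi j hj hij
      rw [Finset.mem_singleton] at hi hj
      exact absurd (hi.trans hj.symm) hij)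
    simpa using this
  have hαK : α ≤ K := by
    have := Finset.card_le_univ S₀
    simpa [hS₀c] using this
  have hm := aux_main E w hw ε hε0 hwε α hα0 hub' (K - α) univ (by simp; omega)
  refine hm.trans ?_
  have hαp : (1:ℝ) ≤ α := by exact_mod_cast hα0
  have hαK' : (α:ℝ) ≤ K := by exact_mod_cast hαK
  have hWp : 0 < ∑ i, w i := Finset.sum_pos (fun j _ => hw j) ⟨⟨0, hK⟩, Finset.mem_univ _⟩
  have h1 : Real.log ((∑ i, w i) / (α * ε)) ≤ Real.log (4 * K / (α * ε)) := by
    apply Real.log_le_log (by positivity)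
    gcongr
    linarith
  have h2 : 1 ≤ Real.log (4 * K / (α * ε)) := by
    rw [Real.le_log_iff_exp_le (by positivity)]
    refine Real.exp_one_lt_three.le.trans ?_
    rw [le_div_iff₀ (by positivity)]
    nlinarith
  nlinarith
end

section
/- Fix any λ > 0 and δ ∈ (0,1). Let (X_t) be a real-valued random process adapted to a filtration (𝓕_t) with μ_t = E[X_t | 𝓕_{t−1}] and V_t = E[X_t² | 𝓕_{t−1}], and satisfying λ·X_t ≤ 1 almost surely for all t. Then with probability at least 1 − δ, simultaneously for all t: Σ_{s=1}^t (X_s − μ_s) ≤ λ·Σ_{s=1}^t V_s + log(1/δ)/λ. -/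
open MeasureTheory ProbabilityTheory

lemma exp_le_quad {x : ℝ} (hx : x ≤ 1) : Real.exp x ≤ 1 + x + x ^ 2 := by
  by_cases h : -1 ≤ x
  · have := Real.abs_exp_sub_one_sub_id_le (abs_le.2 ⟨h, hx⟩)
    have := (abs_le.1 this).2
    linarith
  · have h1 : Real.exp x ≤ 1 := Real.exp_le_one_iff.2 (by linarith)
    nlinarith

lemma integrable_of_bdd {Ω : Type*} {m0 : MeasurableSpace Ω} {μ : Measure Ω}
    [IsProbabilityMeasure μ] {f : Ω → ℝ} (hf : StronglyMeasurable f) (c : ℝ)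
    (h0 : ∀ ω, 0 ≤ f ω) (hc : ∀ᵐ ω ∂μ, f ω ≤ c) : Integrable f μ := by
  refine Integrable.of_bound hf.aestronglyMeasurable c ?_
  filter_upwards [hc] with ω h
  rwa [Real.norm_of_nonneg (h0 ω)]

lemma step {Ω : Type*} {m0 : MeasurableSpace Ω} {μ : Measure Ω} [IsProbabilityMeasure μ]
    (m : MeasurableSpace Ω) (hm : m ≤ m0) (X C : Ω → ℝ)
    (hint : Integrable X μ) (hint2 : Integrable (fun ω => (X ω) ^ 2) μ)
    (lam : ℝ) (hbound : ∀ᵐ ω ∂μ, lam * X ω ≤ 1)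
    (hC : StronglyMeasurable[m] C) (hC0 : ∀ ω, 0 ≤ C ω) (c : ℝ) (hCc : ∀ᵐ ω ∂μ, C ω ≤ c) :
    (∀ᵐ ω ∂μ, lam * (X ω - (μ[X | m]) ω) - lam ^ 2 * (μ[fun ω' => (X ω') ^ 2 | m]) ω ≤ 2) ∧
    ∫ ω, C ω * Real.exp (lam * (X ω - (μ[X | m]) ω)
      - lam ^ 2 * (μ[fun ω' => (X ω') ^ 2 | m]) ω) ∂μ ≤ ∫ ω, C ω ∂μ := by
  set M := μ[X | m] with hM
  set V := μ[fun ω' => (X ω') ^ 2 | m] with hV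
  have hMm : StronglyMeasurable[m] M := stronglyMeasurable_condExp
  have hVm : StronglyMeasurable[m] V := stronglyMeasurable_condExp
  let g : Ω → ℝ := (fun _ => (1 : ℝ)) + (lam • X + (lam ^ 2) • (fun ω => (X ω) ^ 2))
  have hg : Integrable g μ := (integrable_const _).add ((hint.smul _).add (hint2.smul _))
  have hgE : μ[g | m] =ᵐ[μ] fun ω => 1 + (lam * M ω + lam ^ 2 * V ω) := by
    have h1 := condExp_add (m := m) (integrable_const (μ := μ) (1 : ℝ))
      ((hint.smul lam).add (hint2.smul (lam ^ 2)))
    have h2 := condExp_add (m := m) (hint.smul lam) (hint2.smul (lam ^ 2))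
    have h3 := condExp_smul (μ := μ) lam X m
    have h4 := condExp_smul (μ := μ) (lam ^ 2) (fun ω => (X ω) ^ 2) m
    have h5 := condExp_const (μ := μ) hm (1 : ℝ)
    filter_upwards [h1, h2, h3, h4] with ω h1 h2 h3 h4
    simp only [Pi.add_apply, Pi.smul_apply, smul_eq_mul] at h1 h2 h3 h4
    change (μ[(fun _ => (1 : ℝ)) + (lam • X + (lam ^ 2) • (fun ω => (X ω) ^ 2)) | m]) ω = _
    rw [h1, h2, h3, h4, h5]
  have hlow : ∀ᵐ ω ∂μ, -(1/4) ≤ lam * M ω + lam ^ 2 * V ω := by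
    have h1 : (fun _ => (3/4 : ℝ)) ≤ᵐ[μ] g := by
      refine Filter.Eventually.of_forall fun ω => ?_
      simp only [g, Pi.add_apply, Pi.smul_apply, smul_eq_mul]
      nlinarith [sq_nonneg (lam * X ω + 1/2)]
    have h2 := condExp_mono (m := m) (integrable_const _) hg h1
    rw [condExp_const hm] at h2
    filter_upwards [h2, hgE] with ω h2 h3
    rw [h3] at h2
    linarith
  refine ⟨?_, ?_⟩
  · filter_upwards [hlow, hbound] with ω h1 h2
    linarith
  let B : Ω → ℝ := fun ω => C ω * Real.exp (-(lam * M ω + lam ^ 2 * V ω))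
  have hBm : StronglyMeasurable[m] B :=
    hC.mul (Real.continuous_exp.comp_stronglyMeasurable
      ((hMm.const_mul lam).add (hVm.const_mul (lam ^ 2))).neg)
  have hB0 : ∀ ω, 0 ≤ B ω := fun ω => mul_nonneg (hC0 ω) (Real.exp_pos _).le
  have hBb : ∀ᵐ ω ∂μ, ‖B ω‖ ≤ c * Real.exp (1/4) := by
    filter_upwards [hCc, hlow] with ω h1 h2
    rw [Real.norm_of_nonneg (hB0 ω)]
    exact mul_le_mul h1 (Real.exp_le_exp.2 (by linarith)) (Real.exp_pos _).le ((hC0 ω).trans h1)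
  have hBg : Integrable (B * g) μ :=
    hg.bdd_mul (hBm.mono hm).aestronglyMeasurable hBb
  have hpull := condExp_stronglyMeasurable_mul_of_bound hm hBm hg _ hBb
  have hCi : Integrable C μ := integrable_of_bdd (hC.mono hm) c hC0 hCc
  calc _ ≤ ∫ ω, (B * g) ω ∂μ := by
        refine integral_mono_of_nonneg (Filter.Eventually.of_forall fun ω =>
          mul_nonneg (hC0 ω) (Real.exp_pos _).le) hBg ?_
        filter_upwards [hbound] with ω h1
        have h2 := exp_le_quad h1
        have h3 : C ω * Real.exp (lam * (X ω - M ω) - lam ^ 2 * V ω)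
            = B ω * Real.exp (lam * X ω) := by
          simp only [B]
          rw [mul_assoc, ← Real.exp_add]
          ring_nf
        simp only [h3, Pi.mul_apply]
        refine mul_le_mul_of_nonneg_left ?_ (hB0 ω)
        simp only [g, Pi.add_apply, Pi.smul_apply, smul_eq_mul]
        linarith
    _ = ∫ ω, (μ[B * g | m]) ω ∂μ := (integral_condExp hm).symm
    _ ≤ ∫ ω, C ω ∂μ := by
        refine integral_mono_ae integrable_condExp hCi ?_
        filter_upwards [hpull, hgE] with ω h1 h2
        rw [h1, Pi.mul_apply, h2]
        have h3 := Real.add_one_le_exp (lam * M ω + lam ^ 2 * V ω)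
        calc B ω * _ ≤ B ω * Real.exp (lam * M ω + lam ^ 2 * V ω) :=
              mul_le_mul_of_nonneg_left (by linarith) (hB0 ω)
          _ = C ω := by
              simp only [B]
              rw [mul_assoc, ← Real.exp_add]
              simp

/-- The stopped log-supermartingale. -/
noncomputable def stopW {Ω : Type*} (Y : ℕ → Ω → ℝ) (c : ℝ) : ℕ → Ω → ℝ
  | 0 => fun _ => 0
  | n + 1 => fun ω => stopW Y c n ω + if c < stopW Y c n ω then 0 else Y n ω

lemma stopW_succ_of_lt {Ω : Type*} {Y : ℕ → Ω → ℝ} {c : ℝ} {n : ℕ} {ω : Ω}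
    (h : c < stopW Y c n ω) : stopW Y c (n + 1) ω = stopW Y c n ω := by
  simp [stopW, h]

lemma stopW_succ_of_not {Ω : Type*} {Y : ℕ → Ω → ℝ} {c : ℝ} {n : ℕ} {ω : Ω}
    (h : ¬ c < stopW Y c n ω) : stopW Y c (n + 1) ω = stopW Y c n ω + Y n ω := by
  simp only [stopW, if_neg h]

lemma stopW_eq_sum {Ω : Type*} {Y : ℕ → Ω → ℝ} {c : ℝ} {ω : Ω}
    (h : ∀ n, ¬ c < stopW Y c n ω) (n : ℕ) :
    stopW Y c n ω = ∑ s ∈ Finset.range n, Y s ω := by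
  induction n with
  | zero => simp [stopW]
  | succ n ih => rw [stopW_succ_of_not (h n), ih, Finset.sum_range_succ]

/-- Freedman's inequality: for an adapted process `X` with conditional means `μ_t`
and conditional second moments `V_t`, satisfying `λ X_t ≤ 1` a.s., with probability
at least `1 - δ`, simultaneously for all `t`,
`∑_{s≤t} (X_s - μ_s) ≤ λ ∑_{s≤t} V_s + log(1/δ)/λ`.
Here `X (t+1)` plays the role of the `(t+1)`-st variable, adapted to `ℱ (t+1)`. -/
theorem stmt3 {Ω : Type*} {m0 : MeasurableSpace Ω} {μ : Measure Ω} [IsProbabilityMeasure μ]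
    (ℱ : Filtration ℕ m0) (X : ℕ → Ω → ℝ)
    (hadapt : ∀ t : ℕ, StronglyMeasurable[ℱ (t + 1)] (X (t + 1)))
    (hint : ∀ t, Integrable (X t) μ)
    (hint2 : ∀ t, Integrable (fun ω => (X t ω) ^ 2) μ)
    (lam δ : ℝ) (hlam : 0 < lam) (hδ : δ ∈ Set.Ioo (0 : ℝ) 1)
    (hbound : ∀ t : ℕ, ∀ᵐ ω ∂μ, lam * X (t + 1) ω ≤ 1) :
    ENNReal.ofReal (1 - δ) ≤
      μ {ω | ∀ t : ℕ,
        ∑ s ∈ Finset.range t, (X (s + 1) ω - (μ[X (s + 1) | ℱ s]) ω)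
          ≤ lam * ∑ s ∈ Finset.range t, (μ[fun ω' => (X (s + 1) ω') ^ 2 | ℱ s]) ω
            + Real.log (1 / δ) / lam} := by
  obtain ⟨hδ0, hδ1⟩ := hδ
  let Y : ℕ → Ω → ℝ := fun s ω => lam * (X (s + 1) ω - (μ[X (s + 1) | ℱ s]) ω)
      - lam ^ 2 * (μ[fun ω' => (X (s + 1) ω') ^ 2 | ℱ s]) ω
  let c : ℝ := Real.log (1 / δ)
  let W := stopW Y c
  have hYm : ∀ n, StronglyMeasurable[ℱ (n + 1)] (Y n) := fun n =>
    (((hadapt n).sub (stronglyMeasurable_condExp.mono (ℱ.mono n.le_succ))).const_mul lam).sub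
      ((stronglyMeasurable_condExp.mono (ℱ.mono n.le_succ)).const_mul (lam ^ 2))
  have hset : ∀ n, StronglyMeasurable[ℱ n] (W n) → MeasurableSet[ℱ n] {ω | c < W n ω} := 
    fun n h => h.measurable (measurableSet_Ioi (a := c))
  have hWm : ∀ n, StronglyMeasurable[ℱ n] (W n) := by
    intro n
    induction n with
    | zero => exact stronglyMeasurable_const
    | succ n ih =>
      have hle := ℱ.mono n.le_succ
      exact (ih.mono hle).add
        (StronglyMeasurable.ite (hle _ (hset n ih)) stronglyMeasurable_const (hYm n))
  have hstep := fun (n : ℕ) (C : Ω → ℝ) => step (μ := μ) (ℱ n) (ℱ.le n) (X (n + 1)) C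
    (hint _) (hint2 _) lam (hbound n)
  have hYb : ∀ n, ∀ᵐ ω ∂μ, Y n ω ≤ 2 := fun n =>
    (hstep n (fun _ => 0) stronglyMeasurable_const (fun _ => le_rfl) 0
      (Filter.Eventually.of_forall fun _ => le_rfl)).1
  have hWb : ∀ n : ℕ, ∀ᵐ ω ∂μ, W n ω ≤ 2 * n := by
    intro n
    induction n with
    | zero => exact Filter.Eventually.of_forall fun ω => by simp [W, stopW]
    | succ n ih =>
      filter_upwards [ih, hYb n] with ω h1 h2
      push_cast
      by_cases h : c < W n ω
      · have := stopW_succ_of_lt h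
        change W (n + 1) ω = W n ω at this
        linarith
      · have := stopW_succ_of_not h
        change W (n + 1) ω = W n ω + Y n ω at this
        linarith
  have hZm : ∀ n, StronglyMeasurable[ℱ n] (fun ω => Real.exp (W n ω)) := fun n =>
    Real.continuous_exp.comp_stronglyMeasurable (hWm n)
  have hZb : ∀ n : ℕ, ∀ᵐ ω ∂μ, Real.exp (W n ω) ≤ Real.exp (2 * n) := by
    intro n
    filter_upwards [hWb n] with ω h
    exact Real.exp_le_exp.2 h
  have hZi : ∀ n, Integrable (fun ω => Real.exp (W n ω)) μ := fun n =>
    integrable_of_bdd ((hZm n).mono (ℱ.le n)) _ (fun ω => (Real.exp_pos _).le) (hZb n)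
  have hZle : ∀ n, ∫ ω, Real.exp (W n ω) ∂μ ≤ 1 := by
    intro n
    induction n with
    | zero => simp [W, stopW]
    | succ n ih =>
      refine le_trans ?_ ih
      let C : Ω → ℝ := fun ω => if c < W n ω then 0 else Real.exp (W n ω)
      let D : Ω → ℝ := fun ω => if c < W n ω then Real.exp (W n ω) else 0
      have hCm : StronglyMeasurable[ℱ n] C :=
        StronglyMeasurable.ite (hset n (hWm n)) stronglyMeasurable_const (hZm n)
      have hDm : StronglyMeasurable[ℱ n] D :=
        StronglyMeasurable.ite (hset n (hWm n)) (hZm n) stronglyMeasurable_const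
      have hC0 : ∀ ω, 0 ≤ C ω := fun ω => by
        simp only [C]; split_ifs
        · exact le_rfl
        · positivity
      have hD0 : ∀ ω, 0 ≤ D ω := fun ω => by
        simp only [D]; split_ifs
        · positivity
        · exact le_rfl
      have hCD : ∀ ω, Real.exp (W n ω) = D ω + C ω := fun ω => by
        simp only [C, D]; split_ifs <;> simp
      have hCb : ∀ᵐ ω ∂μ, C ω ≤ Real.exp (2 * n) := by
        filter_upwards [hZb n] with ω h
        have := hCD ω
        have := hD0 ω
        linarith
      have hDb : ∀ᵐ ω ∂μ, D ω ≤ Real.exp (2 * n) := by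
        filter_upwards [hZb n] with ω h
        have := hCD ω
        have := hC0 ω
        linarith
      have hCi : Integrable C μ := integrable_of_bdd (hCm.mono (ℱ.le n)) _ hC0 hCb
      have hDi : Integrable D μ := integrable_of_bdd (hDm.mono (ℱ.le n)) _ hD0 hDb
      have hsucc : ∀ ω, Real.exp (W (n + 1) ω) = D ω + C ω * Real.exp (Y n ω) := by
        intro ω
        by_cases h : c < W n ω
        · have := stopW_succ_of_lt h
          change W (n + 1) ω = W n ω at this
          simp [C, D, h, this]
        · have := stopW_succ_of_not h
          change W (n + 1) ω = W n ω + Y n ω at this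
          simp only [C, D, if_neg h, this, Real.exp_add, zero_add]
      have hCYi : Integrable (fun ω => C ω * Real.exp (Y n ω)) μ := by
        have := (hZi (n + 1)).sub hDi
        refine this.congr (Filter.Eventually.of_forall fun ω => ?_)
        simp only [Pi.sub_apply]
        rw [hsucc]; ring
      have h2 := (hstep n C hCm hC0 _ hCb).2
      change ∫ ω, C ω * Real.exp (Y n ω) ∂μ ≤ _ at h2
      simp_rw [hsucc, hCD]
      rw [integral_add hDi hCYi, integral_add hDi hCi]
      linarith
  have hec : Real.exp c = 1 / δ := Real.exp_log (by positivity)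
  have hmark : ∀ n, μ {ω | c < W n ω} ≤ ENNReal.ofReal δ := by
    intro n
    have h1 := mul_meas_ge_le_integral_of_nonneg
      (Filter.Eventually.of_forall fun ω => (Real.exp_pos (W n ω)).le) (hZi n) (1 / δ)
    have h2 : μ.real {ω | 1 / δ ≤ Real.exp (W n ω)} ≤ δ := by
      have := h1.trans (hZle n)
      rw [one_div, inv_mul_le_iff₀ hδ0] at this
      simpa using this
    have h3 : μ {ω | 1 / δ ≤ Real.exp (W n ω)} ≤ ENNReal.ofReal δ := by
      rw [← ofReal_measureReal]
      exact ENNReal.ofReal_le_ofReal h2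
    refine (measure_mono fun ω hω => ?_).trans h3
    change 1 / δ ≤ _
    rw [← hec]
    exact Real.exp_le_exp.2 (le_of_lt hω)
  have hmono : Monotone fun n => {ω | c < W n ω} := by
    refine monotone_nat_of_le_succ fun n ω hω => ?_
    have := stopW_succ_of_lt hω
    change W (n + 1) ω = W n ω at this
    change c < W (n + 1) ω
    rw [this]; exact hω
  have hU : μ (⋃ n, {ω | c < W n ω}) ≤ ENNReal.ofReal δ := by
    rw [hmono.measure_iUnion]
    exact iSup_le hmark
  have hUm : MeasurableSet (⋃ n, {ω | c < W n ω}) :=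
    MeasurableSet.iUnion fun n => ℱ.le n _ (hset n (hWm n))
  have hcompl : ENNReal.ofReal (1 - δ) ≤ μ (⋃ n, {ω | c < W n ω})ᶜ := by
    rw [prob_compl_eq_one_sub hUm, ENNReal.ofReal_sub _ hδ0.le, ENNReal.ofReal_one]
    exact tsub_le_tsub_left hU _
  refine hcompl.trans (measure_mono fun ω hω => ?_)
  have hω' : ∀ n, ¬ c < W n ω := by
    intro n h
    exact hω (Set.mem_iUnion.2 ⟨n, h⟩)
  intro t
  have h1 := stopW_eq_sum hω' t
  have h2 : ∑ s ∈ Finset.range t, Y s ω ≤ c := by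
    rw [← h1]; exact not_lt.1 (hω' t)
  simp only [Y, Finset.sum_sub_distrib, ← Finset.mul_sum] at h2
  rw [← sub_le_iff_le_add', le_div_iff₀ hlam, Finset.sum_sub_distrib]
  change _ ≤ c
  linarith
end

section
/- Let z ∈ [−1/2, 1/2]^K, let x ∈ Δ([K]), and let x̃ ∈ Δ([K]) be defined by x̃_k = x_k·exp(z_k) / Σ_{j=1}^K x_j·exp(z_j). Then for all k ∈ [K]: x_k·exp(z_k − 2⟨x, |z|⟩) ≤ x̃_k ≤ x_k·exp(z_k + ⟨x, |z|⟩), where |z| denotes the vector of coordinatewise absolute values and ⟨·,·⟩ the standard inner product on ℝ^K. -/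
/-- Multiplicative stability of exponential reweighting (Lemma 11 of Schneider–Zimmert):
for `z ∈ [-1/2,1/2]^K`, `x` in the simplex and `x̃ ∝ x ∘ exp(z)`,
`x_k exp(z_k - 2⟨x,|z|⟩) ≤ x̃_k ≤ x_k exp(z_k + ⟨x,|z|⟩)`. -/
theorem stmt4 (K : ℕ) (z x : Fin K → ℝ)
    (hz : ∀ k, z k ∈ Set.Icc (-(1 / 2) : ℝ) (1 / 2))
    (hx0 : ∀ k, 0 ≤ x k) (hx1 : ∑ k, x k = 1)
    (xt : Fin K → ℝ)
    (hxt : ∀ k, xt k = x k * Real.exp (z k) / ∑ j, x j * Real.exp (z j)) :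
    ∀ k, x k * Real.exp (z k - 2 * ∑ j, x j * |z j|) ≤ xt k ∧
      xt k ≤ x k * Real.exp (z k + ∑ j, x j * |z j|) := by
  have hl : Real.exp (-∑ j, x j * |z j|) ≤ ∑ j, x j * Real.exp (z j) := by
    set A := ∑ j, x j * |z j| with hA
    have h1 : ∑ j, x j * (1 - |z j| + A) ≤ ∑ j, x j * (Real.exp (z j) * Real.exp A) := by
      apply Finset.sum_le_sum
      intro j _
      apply mul_le_mul_of_nonneg_left _ (hx0 j)
      rw [← Real.exp_add]
      have := Real.add_one_le_exp (z j + A)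
      have := neg_abs_le (z j)
      linarith
    have h2 : ∑ j, x j * (1 - |z j| + A) = 1 := by
      have : ∀ j, x j * (1 - |z j| + A) = x j * (1 + A) - x j * |z j| := fun j => by ring
      simp only [this]
      rw [Finset.sum_sub_distrib, ← Finset.sum_mul, hx1, ← hA]
      ring
    have h3 : ∑ j, x j * (Real.exp (z j) * Real.exp A)
        = (∑ j, x j * Real.exp (z j)) * Real.exp A := by
      rw [Finset.sum_mul]
      exact Finset.sum_congr rfl fun j _ => by ring
    rw [h2, h3] at h1
    rw [Real.exp_neg, inv_le_iff_one_le_mul₀ (Real.exp_pos A)]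
    exact h1
  have hu : ∑ j, x j * Real.exp (z j) ≤ Real.exp (2 * ∑ j, x j * |z j|) := by
    have h1 : ∑ j, x j * Real.exp (z j) ≤ ∑ j, (x j + 2 * (x j * |z j|)) := by
      apply Finset.sum_le_sum
      intro j _
      have hz1 : |z j| ≤ 1 := abs_le.2 ⟨by linarith [(hz j).1], by linarith [(hz j).2]⟩
      have h := (abs_le.1 (Real.abs_exp_sub_one_le hz1)).2
      have := mul_le_mul_of_nonneg_left h (hx0 j)
      linarith
    rw [Finset.sum_add_distrib, hx1, ← Finset.mul_sum] at h1
    linarith [Real.add_one_le_exp (2 * ∑ j, x j * |z j|)]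
  have hS : 0 < ∑ j, x j * Real.exp (z j) := lt_of_lt_of_le (Real.exp_pos _) hl
  intro k
  have hk : 0 ≤ x k * Real.exp (z k) := mul_nonneg (hx0 k) (Real.exp_pos _).le
  rw [hxt k]
  constructor
  · rw [Real.exp_sub, ← mul_div_assoc]
    exact div_le_div_of_nonneg_left hk hS hu
  · have h := div_le_div_of_nonneg_left hk (Real.exp_pos _) hl
    rw [Real.exp_neg, div_inv_eq_mul] at h
    rw [Real.exp_add, ← mul_assoc]
    exact h
end

section
/- Let (𝓕_t)_{t=0}^L be a filtration, let X_1, …, X_L be {0,1}-valued random variables with X_t measurable with respect to 𝓕_t and E[X_t | 𝓕_{t−1}] ≤ w/2 for some w ∈ [0,1], and let γ > 0, ι > 0. Then with probability at least 1 − exp(−ι): Σ_{t=1}^L 2·X_t/(w + γ) ≤ L + ι/γ. -/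
open MeasureTheory ProbabilityTheory

lemma aux_ineq (w γ : ℝ) (hw : 0 ≤ w) (hγ : 0 < γ) :
    1 + (Real.exp (2 * γ / (w + γ)) - 1) * (w / 2) ≤ Real.exp γ := by
  have h1 := Real.add_one_le_exp γ
  rcases hw.eq_or_lt with h | h
  · subst h; simp; linarith
  · have h2 := Real.le_log_one_add_of_nonneg (x := 2 * γ / w) (by positivity)
    have h3 : 2 * (2 * γ / w) / (2 * γ / w + 2) = 2 * γ / (w + γ) := by
      field_simp
      ring
    rw [h3, Real.le_log_iff_exp_le (by positivity)] at h2
    have h4 : (Real.exp (2 * γ / (w + γ)) - 1) * (w / 2) ≤ (2 * γ / w) * (w / 2) := by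
      gcongr
      linarith
    have h5 : (2 * γ / w) * (w / 2) = γ := by field_simp
    linarith

lemma aux_mart {Ω : Type*} {m0 : MeasurableSpace Ω} {μ : Measure Ω} [IsProbabilityMeasure μ]
    (ℱ : Filtration ℕ m0) (X : ℕ → Ω → ℝ)
    (hbool : ∀ t, ∀ᵐ ω ∂μ, X t ω = 0 ∨ X t ω = 1)
    (hmeas : ∀ t : ℕ, StronglyMeasurable[ℱ (t + 1)] (X (t + 1)))
    (w : ℝ) (hcond : ∀ t : ℕ, ∀ᵐ ω ∂μ, (μ[X (t + 1) | ℱ t]) ω ≤ w / 2)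
    (c K : ℝ) (hc : 0 ≤ c) (hK0 : 0 ≤ K) (hK : 1 + c * (w / 2) ≤ K) (n : ℕ) :
    StronglyMeasurable[ℱ n] (fun ω => ∏ t ∈ Finset.range n, (1 + c * X (t + 1) ω)) ∧
    (∀ᵐ ω ∂μ, 0 ≤ ∏ t ∈ Finset.range n, (1 + c * X (t + 1) ω)) ∧
    Integrable (fun ω => ∏ t ∈ Finset.range n, (1 + c * X (t + 1) ω)) μ ∧
    ∫ ω, ∏ t ∈ Finset.range n, (1 + c * X (t + 1) ω) ∂μ ≤ K ^ n := by
  induction n with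
  | zero => simp [stronglyMeasurable_const]
  | succ n ih =>
    obtain ⟨h1, h2, h3, h4⟩ := ih
    set M : Ω → ℝ := fun ω => ∏ t ∈ Finset.range n, (1 + c * X (t + 1) ω) with hM
    have hX : StronglyMeasurable (X (n + 1)) := (hmeas n).mono (ℱ.le _)
    have hb : ∀ᵐ ω ∂μ, ‖X (n + 1) ω‖ ≤ 1 := by
      filter_upwards [hbool (n + 1)] with ω h
      rcases h with h | h <;> simp [h]
    have hXi : Integrable (X (n + 1)) μ := Integrable.of_bound hX.aestronglyMeasurable 1 hb
    have hMX : Integrable (M * X (n + 1)) μ := h3.mul_bdd (c := 1) hX.aestronglyMeasurable hb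
    have hce : ∫ ω, (M * X (n + 1)) ω ∂μ ≤ (w / 2) * ∫ ω, M ω ∂μ := by
      rw [← integral_condExp (ℱ.le n), ← integral_const_mul]
      apply integral_mono_ae integrable_condExp (h3.const_mul _)
      filter_upwards [condExp_mul_of_stronglyMeasurable_left h1 hMX hXi, hcond n, h2]
        with ω e1 e2 e3
      rw [e1]
      simp only [Pi.mul_apply]
      rw [mul_comm]
      exact mul_le_mul_of_nonneg_right e2 e3
    have heq : (fun ω => ∏ t ∈ Finset.range (n + 1), (1 + c * X (t + 1) ω))
        = fun ω => M ω + c * (M * X (n + 1)) ω := by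
      funext ω
      rw [Finset.prod_range_succ]
      simp only [hM, Pi.mul_apply]
      ring
    have hMn : 0 ≤ ∫ ω, M ω ∂μ := integral_nonneg_of_ae h2
    refine ⟨?_, ?_, ?_, ?_⟩
    · rw [heq]
      have h1' := h1.mono (ℱ.mono (Nat.le_succ n))
      exact h1'.add ((h1'.mul (hmeas n)).const_mul c)
    · filter_upwards [h2, hbool (n + 1)] with ω e1 e2
      rw [Finset.prod_range_succ]
      refine mul_nonneg e1 ?_
      rcases e2 with h | h <;> rw [h] <;> linarith
    · rw [heq]; exact h3.add (hMX.const_mul c)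
    · rw [heq, integral_add h3 (hMX.const_mul c), integral_const_mul]
      calc _ ≤ (∫ ω, M ω ∂μ) * (1 + c * (w / 2)) := by nlinarith
        _ ≤ (∫ ω, M ω ∂μ) * K := by gcongr
        _ ≤ K ^ n * K := by gcongr
        _ = _ := (pow_succ _ _).symm

/-- Concentration bound underlying the event `L_e`: for `{0,1}`-valued random variables
`X_1, …, X_L` adapted to a filtration with conditional means at most `w/2`, with
probability at least `1 - exp(-ι)`, `∑_{t=1}^L 2 X_t / (w + γ) ≤ L + ι/γ`.
Here `X (t+1)` plays the role of the `(t+1)`-st variable, measurable w.r.t. `ℱ (t+1)`. -/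
theorem stmt6 {Ω : Type*} {m0 : MeasurableSpace Ω} {μ : Measure Ω} [IsProbabilityMeasure μ]
    (L : ℕ) (ℱ : Filtration ℕ m0) (X : ℕ → Ω → ℝ)
    (hbool : ∀ t, ∀ᵐ ω ∂μ, X t ω = 0 ∨ X t ω = 1)
    (hmeas : ∀ t : ℕ, StronglyMeasurable[ℱ (t + 1)] (X (t + 1)))
    (w : ℝ) (hw : w ∈ Set.Icc (0 : ℝ) 1)
    (hcond : ∀ t : ℕ, ∀ᵐ ω ∂μ, (μ[X (t + 1) | ℱ t]) ω ≤ w / 2)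
    (γ ι : ℝ) (hγ : 0 < γ) (hι : 0 < ι) :
    ENNReal.ofReal (1 - Real.exp (-ι)) ≤
      μ {ω | ∑ t ∈ Finset.range L, 2 * X (t + 1) ω / (w + γ) ≤ (L : ℝ) + ι / γ} := by
  have hs : 0 < 2 * γ / (w + γ) := by have := hw.1; positivity
  have hwg : 0 < w + γ := by have := hw.1; positivity
  set s := 2 * γ / (w + γ) with hs_def
  have hc : 0 ≤ Real.exp s - 1 := by have := Real.add_one_le_exp s; linarith
  obtain ⟨h1, h2, h3, h4⟩ := aux_mart ℱ X hbool hmeas w hcond (Real.exp s - 1) (Real.exp γ)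
    hc (Real.exp_pos _).le (aux_ineq w γ hw.1 hγ) L
  have hXm : ∀ t, Measurable (X (t + 1)) := fun t => ((hmeas t).mono (ℱ.le _)).measurable
  have hSm : Measurable (fun ω => ∑ t ∈ Finset.range L, 2 * X (t + 1) ω / (w + γ)) :=
    Finset.measurable_sum _ (fun t _ => ((hXm t).const_mul 2).div_const _)
  have hset : MeasurableSet {ω | ∑ t ∈ Finset.range L, 2 * X (t + 1) ω / (w + γ)
      ≤ (L : ℝ) + ι / γ} := measurableSet_le hSm measurable_const
  set A := {ω | ∑ t ∈ Finset.range L, 2 * X (t + 1) ω / (w + γ) ≤ (L : ℝ) + ι / γ} with hA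
  have hmk := mul_meas_ge_le_integral_of_nonneg h2 h3 (Real.exp (γ * L + ι))
  have hsub : μ.real Aᶜ ≤ μ.real {ω | Real.exp (γ * L + ι) ≤
      ∏ t ∈ Finset.range L, (1 + (Real.exp s - 1) * X (t + 1) ω)} := by
    refine ENNReal.toReal_mono (measure_ne_top _ _) (measure_mono_ae ?_)
    filter_upwards [ae_all_iff.2 hbool] with ω hω hmem
    have hlt : (L : ℝ) + ι / γ < ∑ t ∈ Finset.range L, 2 * X (t + 1) ω / (w + γ) :=
      not_le.1 hmem
    change Real.exp (γ * L + ι) ≤ ∏ t ∈ Finset.range L, (1 + (Real.exp s - 1) * X (t + 1) ω)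
    have hp : ∏ t ∈ Finset.range L, (1 + (Real.exp s - 1) * X (t + 1) ω)
        = Real.exp (γ * ∑ t ∈ Finset.range L, 2 * X (t + 1) ω / (w + γ)) := by
      rw [Finset.mul_sum, Real.exp_sum]
      refine Finset.prod_congr rfl fun t _ => ?_
      rcases hω (t + 1) with h | h
      · simp [h]
      · rw [h, hs_def]
        have : γ * (2 * 1 / (w + γ)) = 2 * γ / (w + γ) := by ring
        rw [this]; ring
    rw [hp, Real.exp_le_exp]
    have := mul_lt_mul_of_pos_left hlt hγ
    have h5 : γ * ((L : ℝ) + ι / γ) = γ * L + ι := by field_simp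
    linarith
  have hbd : μ.real Aᶜ ≤ Real.exp (-ι) := by
    have h6 : Real.exp (γ * L + ι) * μ.real Aᶜ ≤ Real.exp γ ^ L :=
      (mul_le_mul_of_nonneg_left hsub (Real.exp_pos _).le).trans (hmk.trans h4)
    have h7 : Real.exp γ ^ L = Real.exp (γ * L + ι) * Real.exp (-ι) := by
      rw [← Real.exp_add, ← Real.exp_nat_mul]; congr 1; ring
    rw [h7] at h6
    exact le_of_mul_le_mul_left h6 (Real.exp_pos _)
  rw [probReal_compl_eq_one_sub hset] at hbd
  refine ENNReal.ofReal_le_of_le_toReal ?_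
  change _ ≤ μ.real A
  linarith
end
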